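/- arXiv:2401.08800 — 4 statements merged into one kernel-verified Lean document; each statement's English description precedes it below -/
import Mathlib

section
/- Exactly 5,120 of the 10-element cliques in C with weights in {1,2} whose weight-2 graph is a disjoint union of three triangles and one isolated vertex contain both of the exceptional classes (1,1,1,0,0,0,0,0,0) and (1,0,0,1,1,0,0,0,0). -/
/-- The intersection pairing on `ℤ⁹`, the Picard lattice of a del Pezzo surface of degree 1. -/
def B (v w : Fin 9 → ℤ) : ℤ := v 0 * w 0 - ∑ i : Fin 8, v i.succ * w i.succ

/-- The canonical class `K = (-3, -1, …, -1)`. -/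
def Kcl : Fin 9 → ℤ := fun i => if i = 0 then -3 else -1

/-- A vector is an exceptional class if `B(v,v) = -1` and `B(v,K) = -1`. -/
def IsExc (v : Fin 9 → ℤ) : Prop := B v v = -1 ∧ B v Kcl = -1

/-- The type of exceptional classes (the set `C`). -/
abbrev Exc : Type := {v : Fin 9 → ℤ // IsExc v}

/-- The pairing on exceptional classes. -/
def Bx (x y : Exc) : ℤ := B x.1 y.1

/-- `S` is a clique with weights in `M` if `B(x,y) ∈ M` for all distinct `x, y ∈ S`. -/
def IsClique (M : Set ℤ) (S : Finset Exc) : Prop :=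
  ∀ x ∈ S, ∀ y ∈ S, x ≠ y → Bx x y ∈ M

/-- A bijection of `C` preserving the pairing `B`: an element of the Weyl group `W`. -/
def PreservesB (g : Exc ≃ Exc) : Prop := ∀ x y : Exc, Bx (g x) (g y) = Bx x y

/-- Two finite subsets of `C` lie in the same orbit of `W`. -/
def SameOrbit (S T : Finset Exc) : Prop :=
  ∃ g : Exc ≃ Exc, PreservesB g ∧ S.image g = T

/-- The weight-2 graph of the clique `S` is (isomorphic to) the graph on `Fin 10` in which
`i ≠ j` are adjacent iff `p i j`. -/
def HasWeight2Graph (p : Fin 10 → Fin 10 → Prop) (S : Finset Exc) : Prop :=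
  ∃ σ : Fin 10 ≃ {x // x ∈ S}, ∀ i j : Fin 10, i ≠ j → (Bx (σ i).1 (σ j).1 = 2 ↔ p i j)

/-- Block structure of a disjoint union of three triangles (`{0,1,2}`, `{3,4,5}`, `{6,7,8}`)
and one isolated vertex (`{9}`). -/
def blockTTTV (i : Fin 10) : ℕ :=
  if i.1 < 3 then 0 else if i.1 < 6 then 1 else if i.1 < 9 then 2 else 3

/-- The class of the line `ℓ_{1,2}`. -/
def l12 : Fin 9 → ℤ := ![1, 1, 1, 0, 0, 0, 0, 0, 0]
/-- The class of the line `ℓ_{3,4}`. -/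
def l34 : Fin 9 → ℤ := ![1, 0, 0, 1, 1, 0, 0, 0, 0]


def vl : List (List ℤ) := [
  [1, 1, 1, 0, 0, 0, 0, 0, 0], [1, 0, 0, 1, 1, 0, 0, 0, 0], [2, 0, 0, 0, 1, 1, 1, 1, 1],
  [2, 0, 0, 1, 0, 1, 1, 1, 1], [3, 0, 1, 1, 1, 1, 1, 1, 2], [3, 0, 1, 1, 1, 1, 1, 2, 1],
  [3, 0, 1, 1, 1, 1, 2, 1, 1], [3, 0, 1, 1, 1, 2, 1, 1, 1], [3, 1, 0, 1, 1, 1, 1, 1, 2],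
  [3, 1, 0, 1, 1, 1, 1, 2, 1], [3, 1, 0, 1, 1, 1, 2, 1, 1], [3, 1, 0, 1, 1, 2, 1, 1, 1],
  [4, 1, 1, 1, 2, 1, 1, 2, 2], [4, 1, 1, 1, 2, 1, 2, 1, 2], [4, 1, 1, 1, 2, 1, 2, 2, 1],
  [4, 1, 1, 1, 2, 2, 1, 1, 2], [4, 1, 1, 1, 2, 2, 1, 2, 1], [4, 1, 1, 1, 2, 2, 2, 1, 1],
  [4, 1, 1, 2, 1, 1, 1, 2, 2], [4, 1, 1, 2, 1, 1, 2, 1, 2], [4, 1, 1, 2, 1, 1, 2, 2, 1],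
  [4, 1, 1, 2, 1, 2, 1, 1, 2], [4, 1, 1, 2, 1, 2, 1, 2, 1], [4, 1, 1, 2, 1, 2, 2, 1, 1],
  [5, 1, 2, 2, 2, 1, 2, 2, 2], [5, 1, 2, 2, 2, 2, 1, 2, 2], [5, 1, 2, 2, 2, 2, 2, 1, 2],
  [5, 1, 2, 2, 2, 2, 2, 2, 1], [5, 2, 1, 2, 2, 1, 2, 2, 2], [5, 2, 1, 2, 2, 2, 1, 2, 2],
  [5, 2, 1, 2, 2, 2, 2, 1, 2], [5, 2, 1, 2, 2, 2, 2, 2, 1], [6, 2, 2, 2, 3, 2, 2, 2, 2],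
  [6, 2, 2, 3, 2, 2, 2, 2, 2], [2, 0, 1, 0, 0, 1, 1, 1, 1], [2, 1, 0, 0, 0, 1, 1, 1, 1],
  [3, 1, 1, 0, 1, 1, 1, 1, 2], [3, 1, 1, 0, 1, 1, 1, 2, 1], [3, 1, 1, 0, 1, 1, 2, 1, 1],
  [3, 1, 1, 0, 1, 2, 1, 1, 1], [3, 1, 1, 1, 0, 1, 1, 1, 2], [3, 1, 1, 1, 0, 1, 1, 2, 1],
  [3, 1, 1, 1, 0, 1, 2, 1, 1], [3, 1, 1, 1, 0, 2, 1, 1, 1], [4, 1, 2, 1, 1, 1, 1, 2, 2],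
  [4, 1, 2, 1, 1, 1, 2, 1, 2], [4, 1, 2, 1, 1, 1, 2, 2, 1], [4, 1, 2, 1, 1, 2, 1, 1, 2],
  [4, 1, 2, 1, 1, 2, 1, 2, 1], [4, 1, 2, 1, 1, 2, 2, 1, 1], [4, 2, 1, 1, 1, 1, 1, 2, 2],
  [4, 2, 1, 1, 1, 1, 2, 1, 2], [4, 2, 1, 1, 1, 1, 2, 2, 1], [4, 2, 1, 1, 1, 2, 1, 1, 2],
  [4, 2, 1, 1, 1, 2, 1, 2, 1], [4, 2, 1, 1, 1, 2, 2, 1, 1], [5, 2, 2, 1, 2, 1, 2, 2, 2],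
  [5, 2, 2, 1, 2, 2, 1, 2, 2], [5, 2, 2, 1, 2, 2, 2, 1, 2], [5, 2, 2, 1, 2, 2, 2, 2, 1],
  [5, 2, 2, 2, 1, 1, 2, 2, 2], [5, 2, 2, 2, 1, 2, 1, 2, 2], [5, 2, 2, 2, 1, 2, 2, 1, 2],
  [5, 2, 2, 2, 1, 2, 2, 2, 1], [6, 2, 3, 2, 2, 2, 2, 2, 2], [6, 3, 2, 2, 2, 2, 2, 2, 2],
  [1, 0, 0, 0, 0, 0, 0, 1, 1], [1, 0, 0, 0, 0, 0, 1, 0, 1], [1, 0, 0, 0, 0, 0, 1, 1, 0],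
  [1, 0, 0, 0, 0, 1, 0, 0, 1], [1, 0, 0, 0, 0, 1, 0, 1, 0], [1, 0, 0, 0, 0, 1, 1, 0, 0],
  [2, 0, 1, 0, 1, 0, 1, 1, 1], [2, 0, 1, 0, 1, 1, 0, 1, 1], [2, 0, 1, 0, 1, 1, 1, 0, 1],
  [2, 0, 1, 0, 1, 1, 1, 1, 0], [2, 0, 1, 1, 0, 0, 1, 1, 1], [2, 0, 1, 1, 0, 1, 0, 1, 1],
  [2, 0, 1, 1, 0, 1, 1, 0, 1], [2, 0, 1, 1, 0, 1, 1, 1, 0], [2, 1, 0, 0, 1, 0, 1, 1, 1],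
  [2, 1, 0, 0, 1, 1, 0, 1, 1], [2, 1, 0, 0, 1, 1, 1, 0, 1], [2, 1, 0, 0, 1, 1, 1, 1, 0],
  [2, 1, 0, 1, 0, 0, 1, 1, 1], [2, 1, 0, 1, 0, 1, 0, 1, 1], [2, 1, 0, 1, 0, 1, 1, 0, 1],
  [2, 1, 0, 1, 0, 1, 1, 1, 0], [3, 0, 2, 1, 1, 1, 1, 1, 1], [3, 1, 1, 0, 2, 1, 1, 1, 1],
  [3, 1, 1, 1, 1, 0, 1, 1, 2], [3, 1, 1, 1, 1, 0, 1, 2, 1], [3, 1, 1, 1, 1, 0, 2, 1, 1],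
  [3, 1, 1, 1, 1, 1, 0, 1, 2], [3, 1, 1, 1, 1, 1, 0, 2, 1], [3, 1, 1, 1, 1, 1, 1, 0, 2],
  [3, 1, 1, 1, 1, 1, 1, 2, 0], [3, 1, 1, 1, 1, 1, 2, 0, 1], [3, 1, 1, 1, 1, 1, 2, 1, 0],
  [3, 1, 1, 1, 1, 2, 0, 1, 1], [3, 1, 1, 1, 1, 2, 1, 0, 1], [3, 1, 1, 1, 1, 2, 1, 1, 0],
  [3, 1, 1, 2, 0, 1, 1, 1, 1], [3, 2, 0, 1, 1, 1, 1, 1, 1], [4, 1, 2, 1, 2, 1, 1, 1, 2],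
  [4, 1, 2, 1, 2, 1, 1, 2, 1], [4, 1, 2, 1, 2, 1, 2, 1, 1], [4, 1, 2, 1, 2, 2, 1, 1, 1],
  [4, 1, 2, 2, 1, 1, 1, 1, 2], [4, 1, 2, 2, 1, 1, 1, 2, 1], [4, 1, 2, 2, 1, 1, 2, 1, 1],
  [4, 1, 2, 2, 1, 2, 1, 1, 1], [4, 2, 1, 1, 2, 1, 1, 1, 2], [4, 2, 1, 1, 2, 1, 1, 2, 1],
  [4, 2, 1, 1, 2, 1, 2, 1, 1], [4, 2, 1, 1, 2, 2, 1, 1, 1], [4, 2, 1, 2, 1, 1, 1, 1, 2],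
  [4, 2, 1, 2, 1, 1, 1, 2, 1], [4, 2, 1, 2, 1, 1, 2, 1, 1], [4, 2, 1, 2, 1, 2, 1, 1, 1],
  [5, 2, 2, 2, 2, 1, 1, 2, 2], [5, 2, 2, 2, 2, 1, 2, 1, 2], [5, 2, 2, 2, 2, 1, 2, 2, 1],
  [5, 2, 2, 2, 2, 2, 1, 1, 2], [5, 2, 2, 2, 2, 2, 1, 2, 1], [5, 2, 2, 2, 2, 2, 2, 1, 1]]

def R1 : List ℕ := [
  85070591730234615865843651840762183682, 85070591730234615792056675580283715581,
  78203900192100464589419538437373954, 1251034235250187481195175310499508226,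
  14714611372247621215232727487178034690, 28094816990775959940602458638188719362,
  50867541833799624863639535251437755138, 75145339438889815898732705087674414850,
  15857626565481882579169699418736902370, 29061983692582789652315722448657621202,
  51483011552997248775350911613087879346, 75057415192991856962695211872270708850,
  40189605528842196987833899291116178634, 60284403683019846650413916535062334122,
  68337961464684093890237489107071437210, 68572527531695711287073462982823134826,
  60675347128221256217197136920473511258, 40893303730204734208043695984856273722,
  40893303730204734208043695983128865990, 60675347128221256217197136917597182630,
  68572527531695711287073462977661450646, 68337961464684093890237489103619962470,
  60284403683019846650413916529330148694, 40189605528842196987833899284246684470,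
  75057415192991856962695211862653634446, 51483011552997248775350911602941127502,
  29061983692582789652315722437461630254, 15857626565481882579169699405455212062,
  75145339438889815898732705071262566526, 50867541833799624863639535235251201214,
  28094816990775959940602458622462874334, 14714611372247621215232727472386388462,
  1251034235250187481195175297647644662, 78203900192100464589419529847963642,
  5182155343039103044721072584785665, 1324045839513417110190213098511528177,
  14777897560505063735019299176717438697, 28148367622414582714339447246719200729,
  50901621352214208561619468803859127225, 75140476730863121653402235178122770297,
  15794350517810271922187727640999280357, 29008443201529998731560632291431112149,
  51448942175168496925414083723845331893, 75062288041604383053577668205872121717,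
  40145790453795193156948508409016738765, 60260059721196881890346834100435211693,
  68323353059479948866397390547536787101, 68587125796314024467825968236249168237,
  60699680949458389134176942708340742749, 40937108664665906195842601868567637053,
  40937108664665906188423442152770104381, 60699680949458389121823205318532192861,
  68587125796314024445656703490868590957, 68323353059479948851573419416266684061,
  60260059721196881865727285152567449005, 40145790453795193127444255634573878221,
  75062288041604383012272648157493430133, 51448942175168496881834116393237638069,
  29008443201529998683474217323459075541, 15794350517810271865143302132539113189,
  75140476730863121582913883359630358393, 50901621352214208492098749065338657721,
  28148367622414582646797457149494996441, 14777897560505063671489662373455679209,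
  1324045839513417054991879398477525233, 5182155343039066153484690619629313,
  1595085509062526722876452360207068355, 3101542039246232310980709449337330339,
  5848612996151745017525273246263359891, 11431366522028366712055304568970360419,
  22153803217923664149334070123671508307, 43598678006234415666790120013572989747,
  9343376561615702641377515944399570827, 33291469919358688540860532794981772107,
  55899338490368059556657939363272416555, 69197113566326575569377996357567036955,
  9888871968140663169344259203805509511, 34146069248207103584835300265939278663,
  56908489780323906446757333462450351399, 70283540836727547558780932815751958039,
  9927814194578541013052168477048014971, 34165540361424342459102168452128203963,
  56918225336929125787594706840258695899, 70288408615023357035517751183558095339,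
  10007828300211993306270959709995432055, 33623695788627826751260734241426216119,
  56065451424944614400430168198417392343, 69280170033498824451105676907525390823,
  83741373875035536466086577224684662799, 83741378945328452406220406405531176947,
  16482434425891931851780146931990316655, 24369188701678406179649660609530242399,
  44130380735402774524697496874190771007, 24812258882677326753577380733818317487,
  16748278326904665195842160478726965663, 44927905883177090173799523503902694607,
  44927905883177090173799523503902694607, 16748278326904665195842160478726965663,
  24812258882677326753577380733818317487, 44130380735402774524697496874190771007,
  24369188701678406179649660609530242399, 16482434425891931851780146931990316655,
  83741378945328452406220406405531176947, 83741373875035536466086577224684662799,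
  69280170033498824451105676907525390823, 56065451424944614400430168198417392343,
  33623695788627826751260734241426216119, 10007828300211993306270959709995432055,
  70288408615023357035517751183558095339, 56918225336929125787594706840258695899,
  34165540361424342459102168452128203963, 9927814194578541013052168477048014971,
  70283540836727547558780932815751958039, 56908489780323906446757333462450351399,
  34146069248207103584835300265939278663, 9888871968140663169344259203805509511,
  69197113566326575569377996357567036955, 55899338490368059556657939363272416555,
  33291469919358688540860532794981772107, 9343376561615702641377515944399570827,
  43598678006234415666790120013572989747, 22153803217923664149334070123671508307,
  11431366522028366712055304568970360419, 5848612996151745017525273246263359891,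
  3101542039246232310980709449337330339, 1595085509062526722876452360207068355]

def R2 : List ℕ := [
  17179869180, 73786976277658337280, 84992387829405336010240572042617290753,
  83819552424090747258487947724811403265, 70355635505958143178423385497324748801,
  56975085035710678905165080797760192513, 34201670211950675989167909874985598977,
  9922489446550989476014449624709332993, 69124685926053434796249864538660274177,
  55832059701519686349103413899640700929, 33234493369064286333107186701275496449,
  9307009586212391243828161239526146049, 43536120433756095468298539339264032769,
  22101668954419100182529898101140881409, 11384442402603681652044672691077120001,
  5817325067226576868593249545102557185, 3075467607980509492957973452218171393,
  1579436904740600043056061303876747265, 42597851095289281614743894561482997761,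
  21319776994032850155688541478098894849, 10680739131312327710176939324007809025,
  5348187862946840323561490052930355201, 2684519092795669032899837216017096705,
  1344865767636323409711213222410850305, 706166951030367659320278742372190209,
  353086808173080757385553540078896129, 176548336132139864424515506685346305,
  88279238699298490424087898662895873, 2762844793810491096497145308512385,
  1379684484315013036206731290476609, 689703747977020076112421802999841,
  344852028851472187538873318899729, 5070893681126160528822614622217,
  637179391013660276887126021, 85065409574580882900943821499569012738,
  83746535749208116197166040502310535170, 70287481539078405671705711341240057858,
  56911798847140351271472198216539701250, 34148119579992367893353554890539139074,
  9888409927813320351855296508688334850, 69192834822640256334671751192720392194,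
  55895340819797098019411860293201076226, 33288038930729678468006503060355518466,
  9341084034657144408317837686207442946, 43594538844030613593672143791842266114,
  22150351808081598772494357126075976194, 11428257477956770373895657370652018946,
  5846536807668436488147967502569195010, 3099811570112959244399111511208371458,
  1594045310261030259087790052433203970, 42539437755307679377730196080940941506,
  21271099210663267456552244831863242914, 10636929126252154884063182521542672530,
  5318981192797896596073640150558589026, 2660180200956135178427771757976363090,
  1330262432408809093099661100077813810, 667219653973088387743201046288140426,
  333610624336440457391620393277064266, 166807708907519102164994906054197802,
  83406389784087600901128565530820890, 41705071558173859513268968729315462,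
  20850798028039409890421536020653126, 10425260679681879215356382399255078,
  5212630651146458601657655573393686, 10141513082558416449022342467342,
  310693861853983420241150206, 40940210322568501804451721518361214976,
  60701401554066459542505817951793381376, 68588154364049398827292757947473494016,
  68322311273949287279991101029379751936, 60258329252373091564637605488163823616,
  40142681449646919751082468876189175808, 75062459184263838586097968732558067712,
  51446591040957100454271754057536766976, 29004834602413920940430364850689147392,
  15790114528056213331314594880674332928, 75137904677752117469548961532678998016,
  50900177856015553010899611604591207424, 28147492078284661166209279793496674816,
  14777307334387499056794288565927325952, 75103825158690229585738630776076894336,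
  50846627223735292890377261707089674304, 28084205889396914977652323994110787616,
  14709153367199409934846766690782150672, 74481048701825682440002908951870144640,
  50532954689230468038480607070902181952, 27925085316072057527542363384805675040,
  14627308774464748695364473960659988496, 1324035699234657166241426883437661952,
  1251019024644510613706305246485807112, 64511856875924567702645185182683039872,
  53878033979142905990123781602358233216, 32610386512008441573578662251304421504,
  48206666016592894992740702840603952192, 45548208876132178560969407724318762048,
  26761790485476854613765081309148955168, 13380895242738427306882540654574477584,
  22774104348934406451937324069422436896, 12051666504148223748185175710150988048,
  8329823844046339496311270884498760768, 6823367779286823389270047599552123424,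
  4076297891878975815674136474963161360, 78188689040281913356644081662685188,
  5172014450135397859090707469304048, 1163092639706696562792404508142997000,
  1080014424321365382074936113035218184, 913860122699220843192946623017913096,
  581552468900768093092557551270889224, 72705229448519062195433794183581188,
  67511466796422543864596194832592132, 57126070857928957817859816292457220,
  36356228535368927418972727477827332, 4551262260429959730092665346195688,
  4225277908676366165073952042909912, 3575438577668843867166173447848120,
  2276709473481048058461236500365432, 286886115231944162709721271451876,
  265137979501995176440282864591060, 223770972588457752447501063000244,
  141986462611979549780781199028340, 4278568362213884014473076935884,
  3268368027225472741408134728364, 1951117297791886207659764910492,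
  403754144742647259002609616492, 204363269898322258902649415004, 33486279331806675755564536636]

def triA : List (List ℕ × ℕ × ℕ) := [
  ([0, 2, 33], 78203900192100464589419529847701506, 8589934597),
  ([0, 3, 32], 1251034235250187481195175297631125506, 4294967305),
  ([0, 4, 31], 14714611372247621215232727472266018818, 2147483665),
  ([0, 5, 30], 28094816990775959940602458622272733186, 1073741857),
  ([0, 6, 29], 50867541833799624863639535235022979074, 536870977),
  ([0, 7, 28], 75145339438889815898732705071012773890, 268435585),
  ([0, 8, 27], 15857626565481882579169699403573231618, 134217985),
  ([0, 9, 26], 29061983692582789652315722434503245826, 67109377),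
  ([0, 10, 25], 51483011552997248775350911599441346562, 33555457),
  ([0, 11, 24], 75057415192991856962695211858880626690, 16779265),
  ([0, 12, 23], 40189605528842196987833899279095693314, 8392705),
  ([0, 13, 22], 60284403683019846650413916523608408066, 4202497),
  ([0, 14, 21], 68337961464684093890237489096756822018, 2113537),
  ([0, 15, 20], 68572527531695711287073462971652898818, 1081345),
  ([0, 16, 19], 60675347128221256217197136910445707266, 589825),
  ([0, 17, 18], 40893303730204734208043695975402831874, 393217)]

def triB : List (List ℕ × ℕ × ℕ) := [
  ([1, 34, 65], 5182155343039066152358825072525057, 36893488164598972418),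
  ([1, 35, 64], 1324045839513417054920930163700003057, 18446744108069289986),
  ([1, 36, 63], 14777897560505063670972678689044516585, 9223372105574252546),
  ([1, 37, 62], 28148367622414582645980807137211100633, 4611686155866341378),
  ([1, 38, 61], 50901621352214208491118542437815524281, 2305843284091600898),
  ([1, 39, 60], 75140476730863121581841032157228726137, 1152922054362660866),
  ([1, 40, 59], 15794350517810271857060257673847553765, 576461851815051266),
  ([1, 41, 58], 29008443201529998670768052956203408853, 288232575174967298),
  ([1, 42, 57], 51448942175168496866802671712773499829, 144119586122366978),
  ([1, 43, 56], 75062288041604382996067703237919082357, 72066390130950146),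
  ([1, 44, 55], 40145790453795193105320917077568644045, 36046389205008386),
  ([1, 45, 54], 60260059721196881841152596279112947117, 18049582881570818),
  ([1, 46, 53], 68323353059479948822096455627072026269, 9077567998918658),
  ([1, 47, 52], 68587125796314024419850169893287573869, 4644337115725826),
  ([1, 48, 51], 60699680949458389091107852512002497117, 2533274790395906),
  ([1, 49, 50], 40937108664665906155240378296769834045, 1688849860263938)]

def triO : List (List ℕ × ℕ × ℕ) := [
  ([66, 97, 124], 88629060459068070847048896887179395, 21267648091014979068776564446411620352),
  ([66, 98, 123], 177242907934894142281505470560151683, 10633824283191977114074783151256764416),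
  ([66, 100, 122], 88629060459068072078884275451667523, 5316913250790263793631606032662790144),
  ([66, 101, 121], 177242907934894143499618944006800451, 2658458526871032276053393408805306368),
  ([66, 106, 119], 1345778560879155574053801617140581507, 664695127530872616920575613983522816),
  ([66, 107, 118], 1345778560879155575154619190108776515, 332469258223058255376319637918580736),
  ([66, 110, 115], 1578519211297815114813181074698429571, 42836449082912401722352889554272256),
  ([66, 111, 114], 1578519211297815113752262580182288451, 23365335863406798115363528319696896),
  ([67, 94, 125], 88629060459068070847048896887179395, 42535295884924348709061862917033426944),
  ([67, 96, 123], 354470603010338400135793973817383043, 10633824045507489645068746665463119872),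
  ([67, 99, 122], 88629060459068074545992518246732323, 5316912616964963753303881579149393920),
  ([67, 101, 120], 354470603010338403786710927264498211, 1329230531086116476936562643363168256),
  ([67, 105, 119], 2686040395459814407797088924921660035, 664654562711665387366704014319157248),
  ([67, 107, 117], 2686040395459814411078477612373268515, 166315758749943845050320050221744128),
  ([67, 109, 115], 3073941479310283125867441951659283075, 42187411975595622055762872351326208),
  ([67, 111, 113], 3073941479310283122663634806173501475, 12980742146337216645278830499463168),
  ([68, 93, 125], 177242907934894142281505470560151683, 42535295875020828542352773307516846080),
  ([68, 95, 124], 354470603010338400135793973817383043, 21267647972172735518740986940610314240),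
  ([68, 99, 121], 177242907934894150873503366849630483, 2658456625395132155070220048265117696),
  ([68, 100, 120], 354470603010338408693487107312263443, 1329229263435516396281113736336375808),
  ([68, 104, 119], 5350013053883896168971329391620456835, 664634280302061883270232656744284160),
  ([68, 107, 116], 5350013053883896176587257830357088275, 83239009013386750567784698630635520),
  ([68, 108, 115], 5815494354396080323548831755827949955, 41862893421937342902932306007162880),
  ([68, 111, 112], 5815494354396080316032651015486375955, 7788445287802536590700923846656000),
  ([69, 91, 125], 88629060459068072078884275451667523, 42535295867593188601788396837474926592),
  ([69, 92, 124], 88629060459068074545992518246732323, 21267647937510414713898244422787661824),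
  ([69, 96, 121], 708925993223122974526013083358729283, 2658456070797994850367762072810291200),
  ([69, 98, 120], 708925993223122976958816563359195683, 1329228312697566520256967793161797632),
  ([69, 105, 118], 10683477841539767419084246985149391427, 332347563765436861862610018278309888),
  ([69, 106, 117], 10683477841539767421264818099632804899, 166234629111529681090482030245838848),
  ([69, 109, 114], 11381699792308043641763148529878504003, 21418224541456754263498656063684608),
  ([69, 110, 113], 11381699792308043639620259878908863523, 11682667931703952460003975446396928),
  ([70, 90, 125], 177242907934894143499618944006800451, 42535295866355249152798826921281454080),
  ([70, 92, 123], 177242907934894150873503366849630483, 10633823971231088320963598299250556928),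
  ([70, 95, 122], 708925993223122974526013083358729283, 5316912022753745929339017755304656896),
  ([70, 97, 120], 708925993223122981851870838289121555, 1329228154241242082024102964779548672),
  ([70, 104, 118], 21322817356813489385697938396091400515, 332327281355833800487996429732675584),
  ([70, 106, 116], 21322817356813489392213049261859836947, 83157879374973029329804447683969024),
  ([70, 108, 114], 22098619524243481044883989278290383171, 21093705987798917832525858748760064),
  ([70, 110, 112], 22098619524243481038428727032464950291, 6490371073169715127283837822828544),
  ([71, 90, 124], 354470603010338403786710927264498211, 21267647933796596366929534674207244288),
  ([71, 91, 123], 354470603010338408693487107312263443, 10633823968755209422984458466863611904),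
  ([71, 93, 122], 708925993223122976958816563359195683, 5316911993043186167081511875136978944),
  ([71, 94, 121], 708925993223122981851870838289121555, 2658456011376874735556939953769283584),
  ([71, 104, 117], 42601498288844540786478568382130635043, 166173781882720496966641264608935936),
  ([71, 105, 116], 42601498288844540790813108133415658003, 83117314555766906580577270592700416),
  ([71, 108, 113], 43532460889706341618652133068056338723, 10709112270730443167085583501623296),
  ([71, 109, 112], 43532460889706341614339759473200546323, 5841333965854042265338243192979456),
  ([72, 85, 125], 1345778560879155574053801617140581507, 42535295865155998281515976932206837760),
  ([72, 86, 124], 2686040395459814407797088924921660035, 21267647932636029941282732101311922176),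
  ([72, 87, 123], 5350013053883896168971329391620456835, 10633823966434074210507611886250360832),
  ([72, 99, 118], 1345778560879155592062709753862030091, 332307632771533804707135383066902528),
  ([72, 100, 117], 2686040395459814425519459933331457291, 166154767123719434708860248883462144),
  ([72, 101, 116], 5350013053883896186121463971267511819, 83079285037762420881773804319145984),
  ([72, 102, 115], 9304596594416195060684591052399576963, 41543445470684256312332827091795968),
  ([72, 103, 111], 9304596594416195044390716553832661003, 2606289634073962015960091435466752),
  ([73, 84, 125], 1345778560879155575154619190108776515, 42535295865136660190768625735056752640),
  ([73, 86, 122], 10683477841539767419084246985149391427, 5316911983217044188803530247593000960),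
  ([73, 87, 121], 21322817356813489385697938396091400515, 2658455991724583695451252394213507072),
  ([73, 92, 119], 1345778560879155592062709753862030091, 664614002844227538326390369027096576),
  ([73, 97, 117], 10683477841539767435574782614994700555, 166153657929448957374616808913371136),
  ([73, 98, 116], 21322817356813489401629959502291806731, 83077066649216743846804054733750272),
  ([73, 102, 114], 33230703820130764218916687525548395331, 20774258036549668164693711420129280),
  ([73, 103, 110], 33230703820130764203683731521497620491, 1308215419444977475310336998375424),
  ([74, 84, 124], 2686040395459814411078477612373268515, 21267647932578015669040678509861666816),
  ([74, 85, 122], 10683477841539767421264818099632804899, 5316911983178368007308827853292830720),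
  ([74, 87, 120], 42601498288844540786478568382130635043, 1329227995939677267280411073223589888),
  ([74, 91, 119], 2686040395459814425519459933331457291, 664614000368356904488595558519275520),
  ([74, 94, 118], 10683477841539767435574782614994700555, 332307018753288486257967642036928512),
  ([74, 96, 116], 42601498288844540799977786008330574859, 83076828964738645786757013392326656),
  ([74, 102, 113], 55827579325098839368321597754321145123, 10389664319489457640598458052116480),
  ([74, 103, 109], 55827579325098839355231530401240010763, 659178312137568754709764247650304),
  ([75, 84, 123], 5350013053883896176587257830357088275, 10633823966298707575276153506199764992),
  ([75, 85, 121], 21322817356813489392213049261859836947, 2658455991608555150967145211312996352),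
  ([75, 86, 120], 42601498288844540790813108133415658003, 1329227995862324904291006284623249408),
  ([75, 90, 119], 5350013053883896186121463971267511819, 664613999130435754669146762201006080),
  ([75, 93, 118], 21322817356813489401629959502291806731, 332307008849787061440856921424789504),
  ([75, 95, 117], 42601498288844540799977786008330574859, 166153539087233520177007636468727808),
  ([75, 102, 112], 69119857867982532456311334277258153491, 5197367460973519477999440303751168),
  ([75, 103, 108], 69119857867982532447533640519032811531, 334659758498031493858086807928832),
  ([76, 81, 125], 1578519211297815114813181074698429571, 42535295865119801342424781101643857920),
  ([76, 82, 124], 3073941479310283125867441951659283075, 21267647932563565227603097395507757056),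
  ([76, 83, 123], 5815494354396080323548831755827949955, 10633823966289073947651099429963825152),
  ([76, 89, 119], 9304596594416195060684591052399576963, 664613998511503513958319581913153536),
  ([76, 99, 114], 1578519211297815144711585016431252231, 20769821259514982492548647991902208),
  ([76, 100, 113], 3073941479310283151155848999627400455, 10385861367745441350188403685064704),
  ([76, 101, 112], 5815494354396080339618089028892509703, 5194832159810841951059404059049984),
  ([76, 103, 107], 9304596594416195058441948426328371207, 172400481706597062329465959350272),
  ([77, 80, 125], 1578519211297815113752262580182288451, 42535295865118667974468892386792570880),
  ([77, 82, 122], 11381699792308043641763148529878504003, 5316911983144650310621138586467041280),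
  ([77, 83, 121], 22098619524243481044883989278290383171, 2658455991579654268091982982605176832),
  ([77, 89, 118], 33230703820130764218916687525548395331, 332306999565350103596093731166486528),
  ([77, 92, 115], 1578519211297815144711585016431252231, 41538379820189893897216898877095936),
  ([77, 97, 113], 11381699792308043665819720199282133255, 10384752173545799513188008393179136),
  ([77, 98, 112], 22098619524243481059735133077908294151, 5192613771336000413332699151859712),
  ([77, 103, 106], 33230703820130764215573227326508994567, 91270843367548244359591277625344),
  ([78, 80, 124], 3073941479310283122663634806173501475, 21267647932560165123735431250953895936),
  ([78, 81, 122], 11381699792308043639620259878908863523, 5316911983142383574709361156764467200),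
  ([78, 83, 120], 43532460889706341618652133068056338723, 1329227995794889510915627750971670528),
  ([78, 89, 117], 55827579325098839368321597754321145123, 166153500092386735210569677278281728),
  ([78, 91, 115], 3073941479310283151155848999627400455, 41538377344460931053908177725685760),
  ([78, 94, 114], 11381699792308043665819720199282133255, 20769207241482170535110040996544512),
  ([78, 96, 112], 43532460889706341631070473387673783303, 5192376086999573347771747166846976),
  ([78, 103, 105], 55827579325098839362797566440798330887, 50706024311360630963525421891584),
  ([79, 80, 123], 5815494354396080316032651015486375955, 10633823966281140371959878426004815872),
  ([79, 81, 121], 22098619524243481038428727032464950291, 2658455991572854060356650693497454592),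
  ([79, 82, 120], 43532460889706341614339759473200546323, 1329227995790356039092072891566522368),
  ([79, 89, 116], 69119857867982532456311334277258153491, 83076750356131724608985393304436736),
  ([79, 90, 115], 5815494354396080339618089028892509703, 41538376106823123223431560120238080),
  ([79, 93, 114], 22098619524243481059735133077908294151, 20769197338264087706971499097227264),
  ([79, 95, 113], 43532460889706341631070473387673783303, 10384633331755375299037104017768448),
  ([79, 103, 104], 69119857867982532446452763212450316295, 30423615009940415443235464282112),
  ([80, 88, 119], 9304596594416195044390716553832661003, 664613998203151872092863228039659520),
  ([80, 99, 110], 1578519211297815150222322776572035131, 1298708041142746841448001608613888),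
  ([80, 100, 109], 3073941479310283158809475410737823835, 650304759126007502582437919064064),
  ([80, 101, 108], 5815494354396080351584089034858725483, 327053856067809005200778601693184),
  ([80, 102, 107], 9304596594416195079185642190519928947, 167329880439052100612193997815808),
  ([81, 88, 118], 33230703820130764203683731521497620491, 332306999258131829686526092144279552),
  ([81, 92, 111], 1578519211297815150222322776572035131, 2596153383445422595015606110519296),
  ([81, 97, 109], 11381699792308043674534265104908697755, 649195566059733621470757478465536),
  ([81, 98, 108], 22098619524243481072762051578390651051, 324835468726335423362788545789952),
  ([81, 102, 106], 33230703820130764237377839585216693427, 86200243233371238531034167377920),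
  ([82, 88, 117], 55827579325098839355231530401240010763, 166153499787435197212779467958648832),
  ([82, 91, 111], 3073941479310283158809475410737823835, 2596150909983195663484314661683200),
  ([82, 94, 110], 11381699792308043674534265104908697755, 1298094026510038751675539167117312),
  ([82, 96, 108], 43532460889706341646240280539125780683, 324597786656644269579266263351296),
  ([82, 102, 105], 55827579325098839386745067350475670227, 45635426443919536912398014218240),
  ([83, 88, 116], 69119857867982532447533640519032811531, 83076750055713658434750043389952000),
  ([83, 90, 111], 5815494354396080351584089034858725483, 2596149676878859656562556461383680),
  ([83, 93, 110], 22098619524243481072762051578390651051, 1298084127825427747091856672948224),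
  ([83, 95, 109], 43532460889706341646240280539125780683, 649076731069517142652142210777088),
  ([83, 102, 104], 69119857867982532474712637716983448035, 25353021675971144946967461756928),
  ([84, 88, 115], 9304596594416195058441948426328371207, 41538375197106443963423106153840640),
  ([84, 89, 111], 9304596594416195079185642190519928947, 2596149067580246570789452409470976),
  ([84, 99, 106], 1345778560879155623514175191509897271, 81763483057533910230604152045568),
  ([84, 100, 105], 2686040395459814454790354256495910999, 41832489150344684083458001076224),
  ([84, 101, 104], 5350013053883896211057818543146942567, 22817730146921243061007452995584),
  ([85, 88, 114], 33230703820130764215573227326508994567, 20769187782309946563135187632259072),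
  ([85, 89, 110], 33230703820130764237377839585216693427, 1298074872289352777490895122464768),
  ([85, 92, 107], 1345778560879155623514175191509897271, 162264267274996732580811197382656),
  ([85, 97, 105], 10683477841539767463744859365190959255, 40723314217958097191215181070336),
  ([85, 98, 104], 21322817356813489425465496501203042471, 20599360939334955442455017684992),
  ([86, 88, 113], 55827579325098839362797566440798330887, 10384594103925917533742328564416512),
  ([86, 89, 109], 55827579325098839386745067350475670227, 649037803658125551592716671909888),
  ([86, 91, 107], 2686040395459814454790354256495910999, 162261830080544389488394989731840),
  ([86, 94, 106], 10683477841539767463744859365190959255, 81149522826487703116454572326912),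
  ([86, 96, 104], 42601498288844540821632751892758397127, 20361715137418390097807976431616),
  ([87, 88, 112], 69119857867982532446452763212450316295, 5192297322762342360548099416391680),
  ([87, 89, 108], 69119857867982532474712637716983448035, 324519327370951280145827832528896),
  ([87, 90, 107], 5350013053883896211057818543146942567, 162260669511757559444387271802880),
  ([87, 93, 106], 21322817356813489425465496501203042471, 81139696677425875410522560528384),
  ([87, 95, 105], 42601498288844540821632751892758397127, 40604588031065383689225636937728),
  ([90, 96, 100], 354470603010338456663265446302057551, 1348116702781779119365146279936),
  ([90, 98, 99], 177242907934894201276085185839890991, 951975890210457431397426528256),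
  ([91, 95, 101], 354470603010338456663265446302057551, 2577391161792161732339976634368),
  ([91, 97, 99], 88629060459068134748404792214683935, 794757505221214136485237751808),
  ([92, 93, 101], 177242907934894201276085185839890991, 2550156480927883366292195901440),
  ([92, 94, 100], 88629060459068134748404792214683935, 1292409401013937006994685689856),
  ([93, 96, 97], 708925993223123028603535703832266895, 247588007857076054979824844800),
  ([94, 95, 98], 708925993223123028603535703832266895, 376333771942755603569333764096)]

def dfsE : ℕ → ℤ → ℤ → List (List ℤ)
  | 0, s, q => if s = 0 ∧ q = 0 then [[]] else []
  | n + 1, s, q => if s * s ≤ ((n + 1 : ℕ) : ℤ) * q then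
      ([-7, -6, -5, -4, -3, -2, -1, 0, 1, 2, 3, 4, 5, 6, 7] : List ℤ).flatMap
        (fun b => (dfsE n (s - b) (q - b * b)).map (fun l => b :: l)) else []

def dotL : List ℤ → List ℤ → ℤ
  | x :: l, y :: m => x * y + dotL l m
  | _, _ => 0

def BL : List ℤ → List ℤ → ℤ
  | x :: l, y :: m => x * y - dotL l m
  | _, _ => 0

def relv (v : List ℤ) : Bool :=
  v == [1, 1, 1, 0, 0, 0, 0, 0, 0] || v == [1, 0, 0, 1, 1, 0, 0, 0, 0] ||
  ((BL [1, 1, 1, 0, 0, 0, 0, 0, 0] v == 1 || BL [1, 1, 1, 0, 0, 0, 0, 0, 0] v == 2) &&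
   (BL [1, 0, 0, 1, 1, 0, 0, 0, 0] v == 1 || BL [1, 0, 0, 1, 1, 0, 0, 0, 0] v == 2) &&
   !(BL [1, 1, 1, 0, 0, 0, 0, 0, 0] v == 2 && BL [1, 0, 0, 1, 1, 0, 0, 0, 0] v == 2))

theorem dfs_ok : ∀ a ∈ ([-1, 0, 1, 2, 3, 4, 5, 6, 7] : List ℤ),
    ((dfsE 8 (3 * a - 1) (a * a + 1)).all fun l => !relv (a :: l) || vl.contains (a :: l)) = true := by
  decide +kernel

theorem vl_exc : (vl.all fun v => v.length == 9 && BL v v == -1 &&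
    BL v [-3, -1, -1, -1, -1, -1, -1, -1, -1] == -1) = true := by
  decide +kernel

theorem vl_nodup : vl.Nodup := by decide +kernel

def rowOf (k : ℤ) (v : List ℤ) : List (List ℤ) → ℕ
  | [] => 0
  | w :: l => bif BL v w == k then 2 * rowOf k v l + 1 else 2 * rowOf k v l

theorem R1_ok : R1 = vl.map (fun v => rowOf 1 v vl) := by decide +kernel
theorem R2_ok : R2 = vl.map (fun v => rowOf 2 v vl) := by decide +kernel

def tb (m i : ℕ) : Bool := Nat.beq (Nat.land 1 (Nat.shiftRight m i)) 1

def o1 (i j : ℕ) : Bool := tb (R1.getD i 0) j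
def o2 (i j : ℕ) : Bool := tb (R2.getD i 0) j

def rA : List ℕ := List.range' 2 32
def rB : List ℕ := List.range' 34 32
def rO : List ℕ := List.range' 66 60

def sm (p q r : ℕ) : ℕ := Nat.lor (Nat.pow 2 p) (Nat.lor (Nat.pow 2 q) (Nat.pow 2 r))

abbrev TT : Type := List ℕ × ℕ × ℕ

noncomputable def fil {α : Type} (p : α → Bool) (l : List α) : List α :=
  List.rec (motive := fun _ => List α) []
    (fun a _ ih => Bool.rec (motive := fun _ => List α) ih (a :: ih) (p a)) l

noncomputable def app {α : Type} (l m : List α) : List α :=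
  List.rec (motive := fun _ => List α) m (fun a _ ih => a :: ih) l

noncomputable def flm {α β : Type} (f : α → List β) (l : List α) : List β :=
  List.rec (motive := fun _ => List β) [] (fun a _ ih => app (f a) ih) l

noncomputable def mp {α β : Type} (f : α → β) (l : List α) : List β :=
  List.rec (motive := fun _ => List β) [] (fun a _ ih => f a :: ih) l

noncomputable def len {α : Type} (l : List α) : ℕ :=
  List.rec (motive := fun _ => ℕ) 0 (fun _ _ ih => Nat.succ ih) l

noncomputable def triG (P Q : List ℕ) : List TT :=
  flm (fun p => flm (fun q => mp (fun r =>
      ([p, q, r], Nat.land (R1.getD p 0) (Nat.land (R1.getD q 0) (R1.getD r 0)), sm p q r))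
      (fil (fun r => and (Nat.blt q r) (and (o2 p r) (o2 q r))) Q))
      (fil (fun q => and (Nat.blt p q) (o2 p q)) Q)) P

theorem triA_ok : triA = triG [0] rA := by decide +kernel
theorem triB_ok : triB = triG [1] rB := by decide +kernel
theorem triO_ok : triO = triG rO rO := by decide +kernel

def hd : List ℕ → ℕ
  | [] => 0
  | i :: _ => i

def chk (o : ℕ) (t : TT) : Bool := Nat.beq (Nat.land o t.2.2) t.2.2

noncomputable def L1a (z : ℕ) (Y : List TT) : List ℕ :=
  flm (fun u => mp (fun w => Nat.lor z (Nat.lor u.2.2 w.2.2))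
    (fil (fun w => and (Nat.blt (hd u.1) (hd w.1)) (chk u.2.1 w)) Y)) Y

noncomputable def G1 (c : ℕ) (X : List TT) : List (ℕ × List ℕ) :=
  mp (fun t => (Nat.lor (Nat.pow 2 c) t.2.2,
    L1a (Nat.lor (Nat.pow 2 c) t.2.2) (fil (chk t.2.1) triO))) X

noncomputable def L2b (z : ℕ) (W : List TT) (Q : List ℕ) : List ℕ :=
  flm (fun w => mp (fun r => Nat.lor (Nat.lor z w.2.2) (Nat.pow 2 r)) (fil (tb w.2.1) Q)) W

noncomputable def G2a (t : TT) (W : List TT) (Q : List ℕ) : List (ℕ × List ℕ) :=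
  mp (fun u => (Nat.lor t.2.2 u.2.2,
    L2b (Nat.lor t.2.2 u.2.2) (fil (chk u.2.1) W) (fil (tb u.2.1) Q)))
    (fil (chk t.2.1) triB)

noncomputable def G2 : List (ℕ × List ℕ) :=
  flm (fun t => G2a t (fil (chk t.2.1) triO) (fil (tb t.2.1) rO)) triA

noncomputable def GG : List (ℕ × List ℕ) := app (G1 0 triB) (app (G1 1 triA) G2)

noncomputable def LL : List ℕ := flm (fun g => g.2) GG

noncomputable def nin (x : ℕ) (l : List ℕ) : Bool :=
  List.rec (motive := fun _ => Bool) true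
    (fun a _ ih => Bool.rec (motive := fun _ => Bool) ih false (Nat.beq x a)) l

noncomputable def qnd (n : ℕ) : List ℕ → Bool :=
  Nat.rec (motive := fun _ => List ℕ → Bool) (fun _ => false)
    (fun _ ih l => List.rec (motive := fun _ => Bool) true
      (fun x l _ => and (nin x l)
        (and (ih (fil (fun y => Nat.blt y x) l)) (ih (fil (fun y => Nat.blt x y) l)))) l) n

noncomputable def slen (l : List (ℕ × List ℕ)) : ℕ :=
  List.rec (motive := fun _ => ℕ) 0 (fun g _ ih => Nat.add (len g.2) ih) l

theorem GG_len : slen GG = 5120 := by decide +kernel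

noncomputable def al {α : Type} (p : α → Bool) (l : List α) : Bool :=
  List.rec (motive := fun _ => Bool) true
    (fun a _ ih => Bool.rec (motive := fun _ => Bool) false ih (p a)) l

theorem GG_keys : qnd 192 (mp (fun g => g.1) GG) = true := by decide +kernel
theorem GG_q : al (fun g => and (qnd 40 g.2)
    (al (fun m => Nat.beq (Nat.mod m 73786976294838206464) g.1) g.2)) GG = true := by
  decide +kernel

theorem tyA : ∀ i ∈ List.range 126, i ∈ rA ↔ (o2 0 i = true ∧ o1 1 i = true) := by decide +kernel
theorem tyB : ∀ i ∈ List.range 126, i ∈ rB ↔ (o2 1 i = true ∧ o1 0 i = true) := by decide +kernel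
theorem tyO : ∀ i ∈ List.range 126, i ∈ rO ↔ (o1 0 i = true ∧ o1 1 i = true) := by decide +kernel
theorem o01 : o1 0 1 = true ∧ o2 0 1 = false := by decide +kernel

theorem B_eq_BL (v w : Fin 9 → ℤ) : B v w = BL (List.ofFn v) (List.ofFn w) := by
  simp [B, BL, dotL, List.ofFn_succ, Fin.sum_univ_succ]

theorem Bx_comm (x y : Exc) : Bx x y = Bx y x := by
  simp [Bx, B, mul_comm]

theorem cauchyL (l : List ℤ) :
    l.sum * l.sum ≤ (l.length : ℤ) * (l.map fun b => b * b).sum := by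
  induction l with
  | nil => simp
  | cons b l ih =>
    simp only [List.sum_cons, List.length_cons, List.map_cons]
    push_cast
    set s := l.sum
    set q := (l.map fun b => b * b).sum
    rcases Nat.eq_zero_or_pos l.length with h | h
    · have hl : l = [] := List.length_eq_zero_iff.mp h
      subst hl
      simp [s, q]
    · have hn : (0 : ℤ) < (l.length : ℤ) := by exact_mod_cast h
      set n : ℤ := (l.length : ℤ)
      have h1 : 0 ≤ n * (n * (b * b) + q - 2 * b * s) := by
        nlinarith [mul_self_nonneg (n * b - s)]
      have h2 := nonneg_of_mul_nonneg_right h1 hn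
      nlinarith

theorem mem_dfsE (l : List ℤ) (h : ∀ b ∈ l, -7 ≤ b ∧ b ≤ 7) :
    l ∈ dfsE l.length l.sum (l.map fun b => b * b).sum := by
  induction l with
  | nil => simp [dfsE]
  | cons b l ih =>
    have hc := cauchyL (b :: l)
    have hb := h b (by simp)
    have := ih (fun x hx => h x (by simp [hx]))
    simp only [List.length_cons, dfsE]
    rw [if_pos (by simpa only [List.length_cons] using hc), List.mem_flatMap]
    refine ⟨b, ?_, ?_⟩
    · obtain ⟨h1, h2⟩ := hb
      interval_cases b <;> simp
    · rw [List.mem_map]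
      refine ⟨l, ?_, rfl⟩
      simpa using this

def Relv (x : Exc) : Prop := x.1 = l12 ∨ x.1 = l34 ∨
  ((B l12 x.1 = 1 ∨ B l12 x.1 = 2) ∧ (B l34 x.1 = 1 ∨ B l34 x.1 = 2) ∧
    ¬ (B l12 x.1 = 2 ∧ B l34 x.1 = 2))

theorem l12_list : List.ofFn l12 = [1, 1, 1, 0, 0, 0, 0, 0, 0] := by decide
theorem l34_list : List.ofFn l34 = [1, 0, 0, 1, 1, 0, 0, 0, 0] := by decide

theorem mem_vl (x : Exc) (h : Relv x) : List.ofFn x.1 ∈ vl := by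
  obtain ⟨v, hv1, hv2⟩ := x
  have hr : relv (List.ofFn v) = true := by
    simp only [Relv, B_eq_BL, l12_list, l34_list] at h
    simp only [relv, Bool.or_eq_true, Bool.and_eq_true, beq_iff_eq, Bool.not_eq_true',
      Bool.and_eq_false_iff, beq_eq_false_iff_ne]
    rcases h with h | h | h
    · left; left; rw [h, l12_list]
    · left; right; rw [h, l34_list]
    · right
      refine ⟨⟨h.1, h.2.1⟩, ?_⟩
      exact not_and_or.mp h.2.2
  have e : List.ofFn v = v 0 :: List.ofFn (fun i : Fin 8 => v i.succ) := by
    rw [List.ofFn_succ]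
  set l := List.ofFn (fun i : Fin 8 => v i.succ) with hl
  have hlen : l.length = 8 := by simp [hl]
  have hs : l.sum = 3 * v 0 - 1 := by
    have : B v Kcl = - 3 * v 0 + l.sum := by
      simp [B, Kcl, hl, Fin.sum_univ_succ]
      ring
    linarith
  have hq : (l.map fun b => b * b).sum = v 0 * v 0 + 1 := by
    have : B v v = v 0 * v 0 - (l.map fun b => b * b).sum := by
      simp [B, hl, Fin.sum_univ_succ]
    linarith
  have hc := cauchyL l
  rw [hlen, hs, hq] at hc
  push_cast at hc
  have ha1 : -1 ≤ v 0 := by nlinarith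
  have ha2 : v 0 ≤ 7 := by nlinarith
  have hb : ∀ b ∈ l, -7 ≤ b ∧ b ≤ 7 := by
    intro b hb
    have h1 : b * b ≤ (l.map fun b => b * b).sum := by
      apply List.single_le_sum
      · intro x hx
        rw [List.mem_map] at hx
        obtain ⟨y, _, rfl⟩ := hx
        exact mul_self_nonneg y
      · exact List.mem_map.mpr ⟨b, hb, rfl⟩
    rw [hq] at h1
    constructor <;> nlinarith
  have hm := mem_dfsE l hb
  rw [hlen, hs, hq] at hm
  have hall := dfs_ok (v 0) (by interval_cases (v 0) <;> simp)
  rw [List.all_eq_true] at hall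
  have := hall l hm
  rw [← e, hr] at this
  simpa using this

theorem tb_eq (m i : ℕ) : tb m i = m.testBit i := by
  rw [tb, Nat.testBit]
  show Nat.beq (1 &&& (m >>> i)) 1 = _
  rw [Nat.and_comm, Nat.and_one_is_mod]
  rcases Nat.mod_two_eq_zero_or_one (m >>> i) with h | h <;> simp [h] <;> rfl

theorem tb_row (k : ℤ) (v : List ℤ) (l : List (List ℤ)) (j : ℕ) :
    tb (rowOf k v l) j = true ↔ j < l.length ∧ BL v (l.getD j []) = k := by
  rw [tb_eq]
  induction l generalizing j with
  | nil => simp [rowOf]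
  | cons w l ih =>
    rw [rowOf]
    by_cases h : BL v w = k
    · simp only [h, beq_self_eq_true, cond_true]
      cases j with
      | zero => simp [h, Nat.testBit_zero]
      | succ j => rw [Nat.testBit_succ]; 
                  have : (2 * rowOf k v l + 1) / 2 = rowOf k v l := by omega
                  rw [this, ih]; simp
    · have : (BL v w == k) = false := by simpa using h
      simp only [this, cond_false]
      cases j with
      | zero => simp [h, Nat.testBit_zero]
      | succ j => 
                  rw [Nat.testBit_succ]
                  have : (2 * rowOf k v l) / 2 = rowOf k v l := by omega
                  rw [this, ih]; simp

theorem vl_len : vl.length = 126 := by decide +kernel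

theorem o1_iff (i j : ℕ) : o1 i j = true ↔
    i < 126 ∧ j < 126 ∧ BL (vl.getD i []) (vl.getD j []) = 1 := by
  rw [o1, R1_ok]
  by_cases h : i < 126
  · have h' : i < vl.length := by rw [vl_len]; exact h
    simp only [List.getD_eq_getElem?_getD, List.getElem?_map, List.getElem?_eq_getElem h']
    simp only [Option.map_some, Option.getD_some]
    rw [tb_row, vl_len]
    simp [h]
  · have h' : vl.length ≤ i := by rw [vl_len]; omega
    simp [List.getD_eq_getElem?_getD, h', h, tb_eq]

theorem o2_iff (i j : ℕ) : o2 i j = true ↔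
    i < 126 ∧ j < 126 ∧ BL (vl.getD i []) (vl.getD j []) = 2 := by
  rw [o2, R2_ok]
  by_cases h : i < 126
  · have h' : i < vl.length := by rw [vl_len]; exact h
    simp only [List.getD_eq_getElem?_getD, List.getElem?_map, List.getElem?_eq_getElem h']
    simp only [Option.map_some, Option.getD_some]
    rw [tb_row, vl_len]
    simp [h]
  · have h' : vl.length ≤ i := by rw [vl_len]; omega
    simp [List.getD_eq_getElem?_getD, h', h, tb_eq]

def fv (i : ℕ) : Fin 9 → ℤ := fun k => (vl.getD i []).getD k 0

theorem ofFn_getD (l : List ℤ) (h : l.length = 9) :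
    List.ofFn (fun k : Fin 9 => l.getD k 0) = l := by
  apply List.ext_getElem
  · simp [h]
  · intro n h1 h2
    rw [List.getElem_ofFn]
    simp [List.getD_eq_getElem?_getD, List.getElem?_eq_getElem h2]

theorem getD_mem_vl (i : ℕ) (h : i < 126) : vl.getD i [] ∈ vl := by
  have h' : i < vl.length := by rw [vl_len]; exact h
  simp [List.getD_eq_getElem?_getD, List.getElem?_eq_getElem h']

theorem ofFn_fv (i : ℕ) (h : i < 126) : List.ofFn (fv i) = vl.getD i [] := by
  apply ofFn_getD
  have := List.all_eq_true.mp vl_exc _ (getD_mem_vl i h)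
  simp only [Bool.and_eq_true, beq_iff_eq] at this
  exact this.1.1

theorem Kcl_list : List.ofFn Kcl = [-3, -1, -1, -1, -1, -1, -1, -1, -1] := by decide

theorem fv_exc (i : ℕ) (h : i < 126) : IsExc (fv i) := by
  have := List.all_eq_true.mp vl_exc _ (getD_mem_vl i h)
  simp only [Bool.and_eq_true, beq_iff_eq] at this
  rw [IsExc, B_eq_BL, B_eq_BL, ofFn_fv i h, Kcl_list]
  exact ⟨this.1.2, this.2⟩

open Classical in
noncomputable def ee (i : ℕ) : Exc :=
  if h : IsExc (fv i) then ⟨fv i, h⟩ else ⟨fv 0, fv_exc 0 (by norm_num)⟩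

noncomputable def idx (x : Exc) : ℕ := vl.idxOf (List.ofFn x.1)

theorem ee_val (i : ℕ) (h : i < 126) : (ee i).1 = fv i := by
  rw [ee, dif_pos (fv_exc i h)]

theorem ee_inj (i j : ℕ) (hi : i < 126) (hj : j < 126) (h : ee i = ee j) : i = j := by
  have h1 : fv i = fv j := by rw [← ee_val i hi, ← ee_val j hj, h]
  have h2 : vl.getD i [] = vl.getD j [] := by rw [← ofFn_fv i hi, ← ofFn_fv j hj, h1]
  have hi' : i < vl.length := by rw [vl_len]; exact hi
  have hj' : j < vl.length := by rw [vl_len]; exact hj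
  simp only [List.getD_eq_getElem?_getD, List.getElem?_eq_getElem hi',
    List.getElem?_eq_getElem hj', Option.getD_some] at h2
  exact (List.Nodup.getElem_inj_iff vl_nodup).mp h2

theorem idx_spec (x : Exc) (h : Relv x) : idx x < 126 ∧ ee (idx x) = x := by
  have hm := mem_vl x h
  have h1 : idx x < vl.length := List.idxOf_lt_length_of_mem hm
  have h1' : idx x < 126 := by rw [← vl_len]; exact h1
  refine ⟨h1', ?_⟩
  apply Subtype.ext
  rw [ee_val _ h1']
  apply List.ofFn_injective
  rw [ofFn_fv _ h1']
  simp only [List.getD_eq_getElem?_getD, List.getElem?_eq_getElem h1, Option.getD_some]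
  exact List.getElem_idxOf h1

theorem o1_Bx (i j : ℕ) (hi : i < 126) (hj : j < 126) :
    o1 i j = true ↔ Bx (ee i) (ee j) = 1 := by
  rw [o1_iff, Bx, B_eq_BL, ee_val i hi, ee_val j hj, ofFn_fv i hi, ofFn_fv j hj]
  simp [hi, hj]

theorem o2_Bx (i j : ℕ) (hi : i < 126) (hj : j < 126) :
    o2 i j = true ↔ Bx (ee i) (ee j) = 2 := by
  rw [o2_iff, Bx, B_eq_BL, ee_val i hi, ee_val j hj, ofFn_fv i hi, ofFn_fv j hj]
  simp [hi, hj]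

theorem o1_comm (i j : ℕ) (h : o1 i j = true) : o1 j i = true := by
  obtain ⟨hi, hj, _⟩ := (o1_iff i j).mp h
  rw [o1_Bx j i hj hi, Bx_comm, ← o1_Bx i j hi hj]; exact h

theorem o2_comm (i j : ℕ) (h : o2 i j = true) : o2 j i = true := by
  obtain ⟨hi, hj, _⟩ := (o2_iff i j).mp h
  rw [o2_Bx j i hj hi, Bx_comm, ← o2_Bx i j hi hj]; exact h

theorem Bx_self (x : Exc) : Bx x x = -1 := x.2.1

theorem o1_irr (i : ℕ) : o1 i i ≠ true := by
  intro h
  obtain ⟨hi, hj, _⟩ := (o1_iff i i).mp h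
  rw [o1_Bx i i hi hi, Bx_self] at h
  omega

theorem o2_irr (i : ℕ) : o2 i i ≠ true := by
  intro h
  obtain ⟨hi, hj, _⟩ := (o2_iff i i).mp h
  rw [o2_Bx i i hi hi, Bx_self] at h
  omega

theorem ee0 : (ee 0).1 = l12 := by
  rw [ee_val 0 (by norm_num)]
  apply List.ofFn_injective
  rw [ofFn_fv 0 (by norm_num), l12_list]; rfl

theorem ee1 : (ee 1).1 = l34 := by
  rw [ee_val 1 (by norm_num)]
  apply List.ofFn_injective
  rw [ofFn_fv 1 (by norm_num), l34_list]; rfl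

theorem fil_eq {α : Type} (p : α → Bool) (l : List α) : fil p l = l.filter p := by
  induction l with
  | nil => rfl
  | cons a l ih =>
    have : fil p (a :: l) = Bool.rec (motive := fun _ => List α) (fil p l) (a :: fil p l) (p a) := rfl
    rw [this, ih, List.filter_cons]
    cases p a <;> simp

theorem app_eq {α : Type} (l m : List α) : app l m = l ++ m := by
  induction l with
  | nil => rfl
  | cons a l ih =>
    have : app (a :: l) m = a :: app l m := rfl
    rw [this, ih]; rfl

theorem flm_eq {α β : Type} (f : α → List β) (l : List α) : flm f l = l.flatMap f := by
  induction l with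
  | nil => rfl
  | cons a l ih =>
    have : flm f (a :: l) = app (f a) (flm f l) := rfl
    rw [this, ih, app_eq]; simp

theorem mp_eq {α β : Type} (f : α → β) (l : List α) : mp f l = l.map f := by
  induction l with
  | nil => rfl
  | cons a l ih =>
    have : mp f (a :: l) = f a :: mp f l := rfl
    rw [this, ih]; rfl

theorem len_eq {α : Type} (l : List α) : len l = l.length := by
  induction l with
  | nil => rfl
  | cons a l ih =>
    have : len (a :: l) = Nat.succ (len l) := rfl
    rw [this, ih]; rfl

theorem slen_eq (l : List (ℕ × List ℕ)) : slen l = (l.flatMap fun g => g.2).length := by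
  induction l with
  | nil => rfl
  | cons a l ih =>
    have : slen (a :: l) = len a.2 + slen l := rfl
    rw [this, ih, len_eq]; simp

theorem al_iff {α : Type} (p : α → Bool) (l : List α) : al p l = true ↔ ∀ a ∈ l, p a = true := by
  induction l with
  | nil => simp [al]
  | cons a l ih =>
    have : al p (a :: l) = Bool.rec (motive := fun _ => Bool) false (al p l) (p a) := rfl
    rw [this]
    cases h : p a <;> simp [h, ih]

theorem nin_iff (x : ℕ) (l : List ℕ) : nin x l = true ↔ x ∉ l := by
  induction l with
  | nil => simp [nin]
  | cons a l ih =>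
    have : nin x (a :: l) = Bool.rec (motive := fun _ => Bool) (nin x l) false (Nat.beq x a) := rfl
    rw [this]
    cases h : Nat.beq x a
    · have := Nat.ne_of_beq_eq_false h
      simp [ih, this]
    · have := Nat.eq_of_beq_eq_true h
      simp [this]

theorem qnd_nodup (n : ℕ) (l : List ℕ) (h : qnd n l = true) : l.Nodup := by
  induction n generalizing l with
  | zero => exact absurd h (by simp [qnd])
  | succ n ih =>
    cases l with
    | nil => simp
    | cons x l =>
      have e : qnd (n + 1) (x :: l) = and (nin x l) (and (qnd n (fil (fun y => Nat.blt y x) l))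
        (qnd n (fil (fun y => Nat.blt x y) l))) := rfl
      rw [e, Bool.and_eq_true, Bool.and_eq_true, nin_iff, fil_eq, fil_eq] at h
      obtain ⟨h1, h2, h3⟩ := h
      have h2 := ih _ h2
      have h3 := ih _ h3
      refine List.nodup_cons.mpr ⟨h1, ?_⟩
      rw [List.nodup_iff_count_le_one] at h2 h3 ⊢
      intro y
      rcases lt_trichotomy y x with hy | hy | hy
      · have := h2 y
        rwa [List.count_filter (by simpa [Nat.blt_eq] using hy)] at this
      · subst hy
        rw [List.count_eq_zero_of_not_mem h1]; omega
      · have := h3 y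
        rwa [List.count_filter (by simpa [Nat.blt_eq] using hy)] at this

theorem LL_eq : LL = GG.flatMap fun g => g.2 := flm_eq _ _

theorem LL_length : LL.length = 5120 := by
  rw [LL_eq, ← slen_eq]; exact GG_len

theorem LL_nodup : LL.Nodup := by
  rw [LL_eq, List.nodup_flatMap]
  have hq := (al_iff _ _).mp GG_q
  refine ⟨fun g hg => ?_, ?_⟩
  · have := hq g hg
    rw [Bool.and_eq_true] at this
    exact qnd_nodup _ _ this.1
  · have hk := qnd_nodup _ _ GG_keys
    rw [mp_eq, List.Nodup, List.pairwise_map] at hk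
    refine hk.imp_of_mem ?_
    intro g g' hg hg' hne
    simp only [Function.onFun]
    intro m hm hm'
    have h1 := hq g hg
    have h2 := hq g' hg'
    rw [Bool.and_eq_true, al_iff] at h1 h2
    have e1 := Nat.eq_of_beq_eq_true (h1.2 m hm)
    have e2 := Nat.eq_of_beq_eq_true (h2.2 m hm')
    exact hne (e1.symm.trans e2)

theorem tb_lor (a b i : ℕ) : tb (Nat.lor a b) i = true ↔ (tb a i = true ∨ tb b i = true) := by
  rw [tb_eq, tb_eq, tb_eq]
  change (a ||| b).testBit i = true ↔ _
  simp

theorem tb_land (a b i : ℕ) : tb (Nat.land a b) i = true ↔ (tb a i = true ∧ tb b i = true) := by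
  rw [tb_eq, tb_eq, tb_eq]
  change (a &&& b).testBit i = true ↔ _
  simp

theorem tb_pow (a i : ℕ) : tb (Nat.pow 2 a) i = true ↔ i = a := by
  rw [tb_eq]
  change (2 ^ a).testBit i = true ↔ _
  rw [Nat.testBit_two_pow]
  simp [eq_comm]

structure GT (t : TT) : Prop where
  o : ∀ i, tb t.2.1 i = true ↔ ∀ k ∈ t.1, o1 k i = true
  s : ∀ i, tb t.2.2 i = true ↔ i ∈ t.1

theorem mem_triG (P Q : List ℕ) (t : TT) : t ∈ triG P Q ↔ ∃ p ∈ P, ∃ q ∈ Q, ∃ r ∈ Q,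
    p < q ∧ o2 p q = true ∧ q < r ∧ o2 p r = true ∧ o2 q r = true ∧
    t = ([p, q, r], Nat.land (R1.getD p 0) (Nat.land (R1.getD q 0) (R1.getD r 0)), sm p q r) := by
  simp only [triG, flm_eq, mp_eq, fil_eq, List.mem_flatMap, List.mem_map, List.mem_filter,
    Bool.and_eq_true, Nat.blt_eq]
  constructor
  · rintro ⟨p, hp, q, ⟨hq, h1, h2⟩, r, ⟨hr, h3, h4, h5⟩, rfl⟩
    exact ⟨p, hp, q, hq, r, hr, h1, h2, h3, h4, h5, rfl⟩
  · rintro ⟨p, hp, q, hq, r, hr, h1, h2, h3, h4, h5, rfl⟩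
    exact ⟨p, hp, q, ⟨hq, h1, h2⟩, r, ⟨hr, h3, h4, h5⟩, rfl⟩

theorem GT_of_mem {P Q : List ℕ} {t : TT} (h : t ∈ triG P Q) : GT t := by
  rw [mem_triG] at h
  obtain ⟨p, hp, q, hq, r, hr, h1, h2, h3, h4, h5, rfl⟩ := h
  constructor
  · intro i
    simp only [tb_land, o1, List.forall_mem_cons, List.not_mem_nil, false_imp_iff, implies_true,
      and_true]
  · intro i
    simp only [sm, tb_lor, tb_pow, List.mem_cons, List.not_mem_nil, or_false]

theorem chk_iff (o : ℕ) (t : TT) (h : GT t) : chk o t = true ↔ ∀ i ∈ t.1, tb o i = true := by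
  have h1 : chk o t = true ↔ Nat.land o t.2.2 = t.2.2 := by
    rw [chk]; exact ⟨Nat.eq_of_beq_eq_true, fun h => by rw [h]; exact Nat.beq_refl _⟩
  rw [h1]
  constructor
  · intro e i hi
    have := (h.s i).mpr hi
    rw [← e, tb_land] at this
    exact this.1
  · intro hh
    apply Nat.eq_of_testBit_eq
    intro i
    rw [Bool.eq_iff_iff, ← tb_eq, ← tb_eq, tb_land, h.s]
    exact ⟨fun x => x.2, fun x => ⟨hh i x, x⟩⟩

/-- Three triangles and an isolated vertex. -/
structure QL {α : Type} (r1 r2 : α → α → Prop) (T U W : List α) (r : α) : Prop where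
  lT : T.length = 3
  lU : U.length = 3
  lW : W.length = 3
  pT : T.Pairwise r2
  pU : U.Pairwise r2
  pW : W.Pairwise r2
  TU : ∀ x ∈ T, ∀ y ∈ U, r1 x y
  TW : ∀ x ∈ T, ∀ y ∈ W, r1 x y
  UW : ∀ x ∈ U, ∀ y ∈ W, r1 x y
  rT : ∀ x ∈ T, r1 x r
  rU : ∀ x ∈ U, r1 x r
  rW : ∀ x ∈ W, r1 x r

abbrev QN := QL (fun i j => o1 i j = true) (fun i j => o2 i j = true)

theorem mem_triG' {P Q : List ℕ} {t : TT} (h : t ∈ triG P Q) :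
    t.1.length = 3 ∧ t.1.Pairwise (fun i j => o2 i j = true) ∧
    (∀ i ∈ t.1, i ∈ P ∨ i ∈ Q) ∧ hd t.1 ∈ P ∧ hd t.1 ∈ t.1 := by
  rw [mem_triG] at h
  obtain ⟨p, hp, q, hq, r, hr, h1, h2, h3, h4, h5, rfl⟩ := h
  simp [*, hd]

theorem rA_lt {i : ℕ} (h : i ∈ rA) : i < 126 := by simp [rA] at h; omega
theorem rB_lt {i : ℕ} (h : i ∈ rB) : i < 126 := by simp [rB] at h; omega
theorem rO_lt {i : ℕ} (h : i ∈ rO) : i < 126 := by simp [rO] at h; omega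
theorem rA_iff {i : ℕ} : i ∈ rA ↔ (o2 0 i = true ∧ o1 1 i = true) := by
  by_cases h : i < 126
  · exact tyA i (by simpa using h)
  · exact ⟨fun h' => absurd (rA_lt h') h, fun h' => absurd ((o1_iff _ _).mp h'.2).2.1 h⟩
theorem rB_iff {i : ℕ} : i ∈ rB ↔ (o2 1 i = true ∧ o1 0 i = true) := by
  by_cases h : i < 126
  · exact tyB i (by simpa using h)
  · exact ⟨fun h' => absurd (rB_lt h') h, fun h' => absurd ((o1_iff _ _).mp h'.2).2.1 h⟩
theorem rO_iff {i : ℕ} : i ∈ rO ↔ (o1 0 i = true ∧ o1 1 i = true) := by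
  by_cases h : i < 126
  · exact tyO i (by simpa using h)
  · exact ⟨fun h' => absurd (rO_lt h') h, fun h' => absurd ((o1_iff _ _).mp h'.2).2.1 h⟩

theorem mem_G1 (c : ℕ) (X : List TT) (m : ℕ) : (∃ g ∈ G1 c X, m ∈ g.2) ↔
    ∃ t ∈ X, ∃ u ∈ triO, ∃ w ∈ triO, chk t.2.1 u = true ∧ chk t.2.1 w = true ∧
      hd u.1 < hd w.1 ∧ chk u.2.1 w = true ∧
      m = Nat.lor (Nat.lor (Nat.pow 2 c) t.2.2) (Nat.lor u.2.2 w.2.2) := by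
  simp only [G1, L1a, flm_eq, mp_eq, fil_eq, List.mem_map, exists_exists_and_eq_and,
    List.mem_flatMap, List.mem_filter, Bool.and_eq_true, Nat.blt_eq]
  constructor
  · rintro ⟨t, ht, u, ⟨hu, h1⟩, w, ⟨⟨hw, h2⟩, h3, h4⟩, rfl⟩
    exact ⟨t, ht, u, hu, w, hw, h1, h2, h3, h4, rfl⟩
  · rintro ⟨t, ht, u, hu, w, hw, h1, h2, h3, h4, rfl⟩
    exact ⟨t, ht, u, ⟨hu, h1⟩, w, ⟨⟨hw, h2⟩, h3, h4⟩, rfl⟩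

theorem mem_G2 (m : ℕ) : (∃ g ∈ G2, m ∈ g.2) ↔
    ∃ t ∈ triA, ∃ u ∈ triB, ∃ w ∈ triO, ∃ r ∈ rO, chk t.2.1 u = true ∧ chk t.2.1 w = true ∧
      chk u.2.1 w = true ∧ tb t.2.1 r = true ∧ tb u.2.1 r = true ∧ tb w.2.1 r = true ∧
      m = Nat.lor (Nat.lor (Nat.lor t.2.2 u.2.2) w.2.2) (Nat.pow 2 r) := by
  simp only [G2, G2a, L2b, flm_eq, mp_eq, fil_eq, List.mem_flatMap, List.mem_map, List.mem_filter]
  constructor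
  · rintro ⟨g, ⟨t, ht, u, ⟨hu, h1⟩, rfl⟩, hm⟩
    simp only [List.mem_flatMap, List.mem_map, List.mem_filter] at hm
    obtain ⟨w, ⟨⟨hw, h2⟩, h3⟩, r, ⟨⟨⟨hr, h4⟩, h5⟩, h6⟩, rfl⟩ := hm
    exact ⟨t, ht, u, hu, w, hw, r, hr, h1, h2, h3, h4, h5, h6, rfl⟩
  · rintro ⟨t, ht, u, hu, w, hw, r, hr, h1, h2, h3, h4, h5, h6, rfl⟩
    refine ⟨_, ⟨t, ht, u, ⟨hu, h1⟩, rfl⟩, ?_⟩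
    simp only [List.mem_flatMap, List.mem_map, List.mem_filter]
    exact ⟨w, ⟨⟨hw, h2⟩, h3⟩, r, ⟨⟨⟨hr, h4⟩, h5⟩, h6⟩, rfl⟩

theorem mem_LL (m : ℕ) : m ∈ LL ↔ (∃ g ∈ G1 0 triB, m ∈ g.2) ∨ (∃ g ∈ G1 1 triA, m ∈ g.2) ∨
    (∃ g ∈ G2, m ∈ g.2) := by
  rw [LL_eq, List.mem_flatMap, GG, app_eq, app_eq]
  simp only [List.mem_append]
  constructor
  · rintro ⟨g, h | h | h, hm⟩
    · exact Or.inl ⟨g, h, hm⟩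
    · exact Or.inr (Or.inl ⟨g, h, hm⟩)
    · exact Or.inr (Or.inr ⟨g, h, hm⟩)
  · rintro (⟨g, h, hm⟩ | ⟨g, h, hm⟩ | ⟨g, h, hm⟩)
    · exact ⟨g, Or.inl h, hm⟩
    · exact ⟨g, Or.inr (Or.inl h), hm⟩
    · exact ⟨g, Or.inr (Or.inr h), hm⟩

def Bits (m : ℕ) (T U W : List ℕ) (r : ℕ) : Prop :=
  ∀ i, tb m i = true ↔ (i ∈ T ∨ i ∈ U ∨ i ∈ W ∨ i = r)

theorem chk_o (t u : TT) (ht : GT t) (hu : GT u) :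
    chk t.2.1 u = true ↔ ∀ x ∈ t.1, ∀ y ∈ u.1, o1 x y = true := by
  rw [chk_iff _ _ hu]
  constructor
  · intro h x hx y hy
    exact (ht.o y).mp (h y hy) x hx
  · intro h i hi
    exact (ht.o i).mpr fun k hk => h k hk i hi

theorem LL_fwd (m : ℕ) (hm : m ∈ LL) : ∃ T U W r, QN T U W r ∧ Bits m T U W r ∧
    tb m 0 = true ∧ tb m 1 = true := by
  rw [mem_LL, mem_G1, mem_G1, mem_G2, triA_ok, triB_ok, triO_ok] at hm
  rcases hm with ⟨t, ht, u, hu, w, hw, h1, h2, -, h4, rfl⟩ |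
    ⟨t, ht, u, hu, w, hw, h1, h2, -, h4, rfl⟩ |
    ⟨t, ht, u, hu, w, hw, r, hr, h1, h2, h3, h4, h5, h6, rfl⟩
  all_goals
    have gt := GT_of_mem ht
    have gu := GT_of_mem hu
    have gw := GT_of_mem hw
    obtain ⟨t1, t2, t3, t4, t5⟩ := mem_triG' ht
    obtain ⟨u1, u2, u3, u4, u5⟩ := mem_triG' hu
    obtain ⟨w1, w2, w3, w4, w5⟩ := mem_triG' hw
  · rw [chk_o _ _ gt gu] at h1
    rw [chk_o _ _ gt gw] at h2
    rw [chk_o _ _ gu gw] at h4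
    refine ⟨t.1, u.1, w.1, 0, ⟨t1, u1, w1, t2, u2, w2, h1, h2, h4, ?_, ?_, ?_⟩, ?_, ?_, ?_⟩
    · intro x hx
      apply o1_comm
      rcases t3 x hx with h | h
      · rw [List.mem_singleton.mp h]; exact o01.1
      · exact (rB_iff.mp h).2
    · intro x hx
      exact o1_comm _ _ (rO_iff.mp (or_self_iff.mp (u3 x hx))).1
    · intro x hx
      exact o1_comm _ _ (rO_iff.mp (or_self_iff.mp (w3 x hx))).1
    · intro i
      simp only [tb_lor, tb_pow, gt.s, gu.s, gw.s]; tauto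
    · simp only [tb_lor, tb_pow, true_or]
    · simp only [tb_lor, gt.s]
      rw [List.mem_singleton] at t4
      rw [t4] at t5; tauto
  · rw [chk_o _ _ gt gu] at h1
    rw [chk_o _ _ gt gw] at h2
    rw [chk_o _ _ gu gw] at h4
    refine ⟨t.1, u.1, w.1, 1, ⟨t1, u1, w1, t2, u2, w2, h1, h2, h4, ?_, ?_, ?_⟩, ?_, ?_, ?_⟩
    · intro x hx
      rcases t3 x hx with h | h
      · rw [List.mem_singleton.mp h]; exact o01.1
      · exact o1_comm _ _ (rA_iff.mp h).2
    · intro x hx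
      exact o1_comm _ _ (rO_iff.mp (or_self_iff.mp (u3 x hx))).2
    · intro x hx
      exact o1_comm _ _ (rO_iff.mp (or_self_iff.mp (w3 x hx))).2
    · intro i
      simp only [tb_lor, tb_pow, gt.s, gu.s, gw.s]; tauto
    · simp only [tb_lor, gt.s]
      rw [List.mem_singleton] at t4
      rw [t4] at t5; tauto
    · simp only [tb_lor, tb_pow, true_or]
  · rw [chk_o _ _ gt gu] at h1
    rw [chk_o _ _ gt gw] at h2
    rw [chk_o _ _ gu gw] at h3
    rw [gt.o] at h4
    rw [gu.o] at h5
    rw [gw.o] at h6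
    refine ⟨t.1, u.1, w.1, r, ⟨t1, u1, w1, t2, u2, w2, h1, h2, h3, h4, h5, h6⟩, ?_, ?_, ?_⟩
    · intro i
      simp only [tb_lor, tb_pow, gt.s, gu.s, gw.s]; tauto
    · simp only [tb_lor, gt.s]
      rw [List.mem_singleton] at t4
      rw [t4] at t5; tauto
    · simp only [tb_lor, gu.s]
      rw [List.mem_singleton] at u4
      rw [u4] at u5; tauto

def Goal (T U W : List ℕ) (r : ℕ) : Prop := ∃ m ∈ LL, Bits m T U W r

theorem Goal.swap12 {T U W : List ℕ} {r : ℕ} (h : Goal U T W r) : Goal T U W r := by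
  obtain ⟨m, hm, hb⟩ := h
  exact ⟨m, hm, fun i => by rw [hb i]; tauto⟩

theorem Goal.swap23 {T U W : List ℕ} {r : ℕ} (h : Goal T W U r) : Goal T U W r := by
  obtain ⟨m, hm, hb⟩ := h
  exact ⟨m, hm, fun i => by rw [hb i]; tauto⟩

theorem QN.swap12 {T U W : List ℕ} {r : ℕ} (h : QN T U W r) : QN U T W r :=
  ⟨h.lU, h.lT, h.lW, h.pU, h.pT, h.pW, fun x hx y hy => o1_comm _ _ (h.TU y hy x hx),
    h.UW, h.TW, h.rU, h.rT, h.rW⟩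

theorem QN.swap23 {T U W : List ℕ} {r : ℕ} (h : QN T U W r) : QN T W U r :=
  ⟨h.lT, h.lW, h.lU, h.pT, h.pW, h.pU, h.TW, h.TU,
    fun x hx y hy => o1_comm _ _ (h.UW y hy x hx), h.rT, h.rW, h.rU⟩

theorem sort3 (T : List ℕ) (hl : T.length = 3) (hp : T.Pairwise fun i j => o2 i j = true) :
    ∃ p q r, p < q ∧ q < r ∧ o2 p q = true ∧ o2 p r = true ∧ o2 q r = true ∧
      ∀ i, i ∈ T ↔ i ∈ [p, q, r] := by
  obtain ⟨x, y, z, rfl⟩ := List.length_eq_three.mp hl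
  simp only [List.pairwise_cons, List.mem_cons, List.not_mem_nil, or_false] at hp
  have xy : o2 x y = true := hp.1 y (by simp)
  have xz : o2 x z = true := hp.1 z (by simp)
  have yz : o2 y z = true := hp.2.1 z (by simp)
  have yx := o2_comm _ _ xy
  have zx := o2_comm _ _ xz
  have zy := o2_comm _ _ yz
  have n1 : x ≠ y := fun h => o2_irr y (h ▸ xy)
  have n2 : x ≠ z := fun h => o2_irr z (h ▸ xz)
  have n3 : y ≠ z := fun h => o2_irr z (h ▸ yz)
  rcases lt_or_gt_of_ne n1 with h1 | h1 <;> rcases lt_or_gt_of_ne n2 with h2 | h2 <;>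
    rcases lt_or_gt_of_ne n3 with h3 | h3
  · exact ⟨x, y, z, h1, h3, xy, xz, yz, fun i => by simp⟩
  · exact ⟨x, z, y, h2, h3, xz, xy, zy, fun i => by simp; tauto⟩
  · omega
  · exact ⟨z, x, y, h2, h1, zx, zy, xy, fun i => by simp; tauto⟩
  · exact ⟨y, x, z, h1, h2, yx, yz, xz, fun i => by simp; tauto⟩
  · omega
  · exact ⟨y, z, x, h3, h2, yz, yx, zx, fun i => by simp; tauto⟩
  · exact ⟨z, y, x, h3, h1, zy, zx, yx, fun i => by simp; tauto⟩

theorem mem_triO_of (T : List ℕ) (hl : T.length = 3) (hp : T.Pairwise fun i j => o2 i j = true)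
    (h : ∀ i ∈ T, i ∈ rO) : ∃ t ∈ triG rO rO, ∀ i, i ∈ t.1 ↔ i ∈ T := by
  obtain ⟨p, q, r, h1, h2, h3, h4, h5, h6⟩ := sort3 T hl hp
  refine ⟨_, (mem_triG _ _ _).mpr ⟨p, h p ?_, q, h q ?_, r, h r ?_, h1, h3, h2, h4, h5, rfl⟩, ?_⟩
  · rw [h6]; simp
  · rw [h6]; simp
  · rw [h6]; simp
  · intro i; rw [h6]

theorem mem_triX_of (c : ℕ) (X T : List ℕ) (hX : ∀ i ∈ X, c < i) (hl : T.length = 3)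
    (hp : T.Pairwise fun i j => o2 i j = true) (hc : c ∈ T)
    (h : ∀ i ∈ T, o2 c i = true → i ∈ X) : ∃ t ∈ triG [c] X, ∀ i, i ∈ t.1 ↔ i ∈ T := by
  obtain ⟨p, q, r, h1, h2, h3, h4, h5, h6⟩ := sort3 T hl hp
  have hc' := (h6 c).mp hc
  have mp : p ∈ T := by rw [h6]; simp
  have mq : q ∈ T := by rw [h6]; simp
  have mr : r ∈ T := by rw [h6]; simp
  simp only [List.mem_cons, List.not_mem_nil, or_false] at hc'
  rcases hc' with rfl | rfl | rfl
  · exact ⟨_, (mem_triG _ _ _).mpr ⟨c, by simp, q, h q mq h3, r, h r mr h4,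
      h1, h3, h2, h4, h5, rfl⟩, fun i => by rw [h6]⟩
  · have := hX p (h p mp (o2_comm _ _ h3)); omega
  · have := hX p (h p mp (o2_comm _ _ h4)); omega

theorem o12 {i j : ℕ} (h : o1 i j = true) (h' : o2 i j = true) : False := by
  have h1 := ((o1_iff _ _).mp h).2.2
  have h2 := ((o2_iff _ _).mp h').2.2
  omega

theorem case1 (c : ℕ) (X : List ℕ) (Y : List TT) (hY : Y = triG [1 - c] X)
    (hc : c = 0 ∨ c = 1)
    (hX : ∀ i, i ∈ X ↔ (o2 (1 - c) i = true ∧ o1 c i = true)) (hlt : ∀ i ∈ X, 1 - c < i)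
    (hLL : ∀ m, (∃ g ∈ G1 c Y, m ∈ g.2) → m ∈ LL)
    {T U W : List ℕ} (h : QN T U W c) (hT : 1 - c ∈ T) : Goal T U W c := by
  obtain ⟨t, ht, et⟩ := mem_triX_of (1 - c) X T hlt h.lT h.pT hT (fun i hi hi2 =>
    (hX i).mpr ⟨hi2, o1_comm _ _ (h.rT i hi)⟩)
  have hO : ∀ i, o1 c i = true → o1 (1 - c) i = true → i ∈ rO := by
    intro i h1 h2
    rcases hc with rfl | rfl
    · exact rO_iff.mpr ⟨h1, h2⟩
    · exact rO_iff.mpr ⟨h2, h1⟩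
  obtain ⟨u, hu, eu⟩ := mem_triO_of U h.lU h.pU (fun i hi =>
    hO i (o1_comm _ _ (h.rU i hi)) (h.TU _ hT i hi))
  obtain ⟨w, hw, ew⟩ := mem_triO_of W h.lW h.pW (fun i hi =>
    hO i (o1_comm _ _ (h.rW i hi)) (h.TW _ hT i hi))
  have gt := GT_of_mem ht
  have gu := GT_of_mem hu
  have gw := GT_of_mem hw
  have c1 : chk t.2.1 u = true := (chk_o _ _ gt gu).mpr fun x hx y hy =>
    h.TU x ((et x).mp hx) y ((eu y).mp hy)
  have c2 : chk t.2.1 w = true := (chk_o _ _ gt gw).mpr fun x hx y hy =>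
    h.TW x ((et x).mp hx) y ((ew y).mp hy)
  have c3 : chk u.2.1 w = true := (chk_o _ _ gu gw).mpr fun x hx y hy =>
    h.UW x ((eu x).mp hx) y ((ew y).mp hy)
  have c4 : chk w.2.1 u = true := (chk_o _ _ gw gu).mpr fun x hx y hy =>
    o1_comm _ _ (h.UW y ((eu y).mp hy) x ((ew x).mp hx))
  have hne : hd u.1 ≠ hd w.1 := by
    intro e
    have := h.UW _ ((eu _).mp (mem_triG' hu).2.2.2.2) _ ((ew _).mp (mem_triG' hw).2.2.2.2)
    rw [e] at this
    exact o1_irr _ this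
  rcases lt_or_gt_of_ne hne with hl | hl
  · refine ⟨_, hLL _ ((mem_G1 _ _ _).mpr ⟨t, hY ▸ ht, u, triO_ok ▸ hu, w, triO_ok ▸ hw,
      c1, c2, hl, c3, rfl⟩), ?_⟩
    intro i
    simp only [tb_lor, tb_pow, gt.s, gu.s, gw.s, et, eu, ew]; tauto
  · refine ⟨_, hLL _ ((mem_G1 _ _ _).mpr ⟨t, hY ▸ ht, w, triO_ok ▸ hw, u, triO_ok ▸ hu,
      c2, c1, hl, c4, rfl⟩), ?_⟩
    intro i
    simp only [tb_lor, tb_pow, gt.s, gu.s, gw.s, et, eu, ew]; tauto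

theorem rA_gt (i : ℕ) (h : i ∈ rA) : 0 < i := by simp [rA] at h; omega
theorem rB_gt (i : ℕ) (h : i ∈ rB) : 1 < i := by simp [rB] at h; omega

theorem case2 {T U W : List ℕ} {r : ℕ} (h : QN T U W r) (hT : 0 ∈ T) (hU : 1 ∈ U) :
    Goal T U W r := by
  obtain ⟨t, ht, et⟩ := mem_triX_of 0 rA T rA_gt h.lT h.pT hT (fun i hi hi2 =>
    rA_iff.mpr ⟨hi2, o1_comm _ _ (h.TU i hi 1 hU)⟩)
  obtain ⟨u, hu, eu⟩ := mem_triX_of 1 rB U rB_gt h.lU h.pU hU (fun i hi hi2 =>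
    rB_iff.mpr ⟨hi2, h.TU 0 hT i hi⟩)
  obtain ⟨w, hw, ew⟩ := mem_triO_of W h.lW h.pW (fun i hi =>
    rO_iff.mpr ⟨h.TW _ hT i hi, h.UW _ hU i hi⟩)
  have hr : r ∈ rO := rO_iff.mpr ⟨h.rT _ hT, h.rU _ hU⟩
  have gt := GT_of_mem ht
  have gu := GT_of_mem hu
  have gw := GT_of_mem hw
  have c1 : chk t.2.1 u = true := (chk_o _ _ gt gu).mpr fun x hx y hy =>
    h.TU x ((et x).mp hx) y ((eu y).mp hy)
  have c2 : chk t.2.1 w = true := (chk_o _ _ gt gw).mpr fun x hx y hy =>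
    h.TW x ((et x).mp hx) y ((ew y).mp hy)
  have c3 : chk u.2.1 w = true := (chk_o _ _ gu gw).mpr fun x hx y hy =>
    h.UW x ((eu x).mp hx) y ((ew y).mp hy)
  refine ⟨_, (mem_LL _).mpr (Or.inr (Or.inr ((mem_G2 _).mpr ⟨t, triA_ok ▸ ht, u, triB_ok ▸ hu,
    w, triO_ok ▸ hw, r, hr, c1, c2, c3, ?_, ?_, ?_, rfl⟩))), ?_⟩
  · exact (gt.o r).mpr fun k hk => h.rT k ((et k).mp hk)
  · exact (gu.o r).mpr fun k hk => h.rU k ((eu k).mp hk)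
  · exact (gw.o r).mpr fun k hk => h.rW k ((ew k).mp hk)
  · intro i
    simp only [tb_lor, tb_pow, gt.s, gu.s, gw.s, et, eu, ew]; tauto

theorem tri_no (T : List ℕ) (hp : T.Pairwise fun i j => o2 i j = true) (h0 : 0 ∈ T)
    (h1 : 1 ∈ T) : False := by
  have : Std.Symm (fun i j => o2 i j = true) := ⟨fun _ _ h => o2_comm _ _ h⟩
  have := hp.forall h0 h1 (by norm_num)
  rw [o01.2] at this
  exact Bool.noConfusion this

theorem case0 {T U W : List ℕ} (h : QN T U W 0) (hT : 1 ∈ T) : Goal T U W 0 :=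
  case1 0 rB triB triB_ok (Or.inl rfl) (fun _ => rB_iff) rB_gt
    (fun _ hm => (mem_LL _).mpr (Or.inl hm)) h hT

theorem case0' {T U W : List ℕ} (h : QN T U W 1) (hT : 0 ∈ T) : Goal T U W 1 :=
  case1 1 rA triA triA_ok (Or.inr rfl) (fun _ => rA_iff) rA_gt
    (fun _ hm => (mem_LL _).mpr (Or.inr (Or.inl hm))) h hT

theorem case3 {T U W : List ℕ} {r : ℕ} (h : QN T U W r) (hT : 0 ∈ T)
    (h1 : 1 ∈ T ∨ 1 ∈ U ∨ 1 ∈ W ∨ 1 = r) : Goal T U W r := by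
  rcases h1 with h1 | h1 | h1 | rfl
  · exact (tri_no T h.pT hT h1).elim
  · exact case2 h hT h1
  · exact (case2 h.swap23 hT h1).swap23
  · exact case0' h hT

theorem LL_bwd {T U W : List ℕ} {r : ℕ} (h : QN T U W r)
    (h0 : 0 ∈ T ∨ 0 ∈ U ∨ 0 ∈ W ∨ 0 = r)
    (h1 : 1 ∈ T ∨ 1 ∈ U ∨ 1 ∈ W ∨ 1 = r) : Goal T U W r := by
  rcases h0 with h0 | h0 | h0 | rfl
  · exact case3 h h0 h1
  · exact (case3 h.swap12 h0 (by tauto)).swap12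
  · exact (case3 h.swap23.swap12 h0 (by tauto)).swap12.swap23
  · rcases h1 with h1 | h1 | h1 | h1
    · exact case0 h h1
    · exact (case0 h.swap12 h1).swap12
    · exact (case0 h.swap23.swap12 h1).swap12.swap23
    · omega

def Gram (x : Fin 10 → Exc) : Prop :=
  ∀ i j : Fin 10, i ≠ j → Bx (x i) (x j) = if blockTTTV i = blockTTTV j then 2 else 1

abbrev QE := QL (fun x y : Exc => Bx x y = 1) (fun x y : Exc => Bx x y = 2)

theorem Gram.QE {x : Fin 10 → Exc} (h : Gram x) :
    QE [x 0, x 1, x 2] [x 3, x 4, x 5] [x 6, x 7, x 8] (x 9) := by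
  have h' : ∀ i j : Fin 10, i ≠ j → ∀ c, (if blockTTTV i = blockTTTV j then (2 : ℤ) else 1) = c →
      Bx (x i) (x j) = c := fun i j hij c hc => (h i j hij).trans hc
  constructor
  case lT => rfl
  case lU => rfl
  case lW => rfl
  all_goals
    simp only [List.pairwise_cons, List.forall_mem_cons, List.not_mem_nil, false_imp_iff,
      implies_true, and_true, List.Pairwise.nil]
    refine_lift ?_
    repeat' apply And.intro
  all_goals exact h' _ _ (by decide) _ (by decide)

theorem Gram_of_QE {T U W : List Exc} {r : Exc} (h : QE T U W r) :
    ∃ x, Gram x ∧ T = [x 0, x 1, x 2] ∧ U = [x 3, x 4, x 5] ∧ W = [x 6, x 7, x 8] ∧ r = x 9 := by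
  obtain ⟨a0, a1, a2, rfl⟩ := List.length_eq_three.mp h.lT
  obtain ⟨a3, a4, a5, rfl⟩ := List.length_eq_three.mp h.lU
  obtain ⟨a6, a7, a8, rfl⟩ := List.length_eq_three.mp h.lW
  refine ⟨![a0, a1, a2, a3, a4, a5, a6, a7, a8, r], ?_, rfl, rfl, rfl, rfl⟩
  have key : ∀ i j : Fin 10, i < j →
      Bx (![a0, a1, a2, a3, a4, a5, a6, a7, a8, r] i) (![a0, a1, a2, a3, a4, a5, a6, a7, a8, r] j)
        = if blockTTTV i = blockTTTV j then 2 else 1 := by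
    have h1 := h.pT
    have h2 := h.pU
    have h3 := h.pW
    have h4 := h.TU
    have h5 := h.TW
    have h6 := h.UW
    have h7 := h.rT
    have h8 := h.rU
    have h9 := h.rW
    clear h
    simp only [List.pairwise_cons, List.forall_mem_cons, List.not_mem_nil, false_imp_iff,
      implies_true, and_true, List.Pairwise.nil] at h1 h2 h3 h4 h5 h6 h7 h8 h9
    intro i j hij
    fin_cases i <;> fin_cases j <;> first
      | exact absurd hij (by decide)
      | (simp [blockTTTV, h1, h2, h3, h4, h5, h6, h7, h8, h9])
  intro i j hij
  rcases lt_or_gt_of_ne hij with h | h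
  · exact key i j h
  · rw [Bx_comm, key j i h]
    simp only [eq_comm]

theorem Gram.inj {x : Fin 10 → Exc} (h : Gram x) : Function.Injective x := by
  intro i j hij
  by_contra hne
  have := h i j hne
  rw [hij, Bx_self] at this
  split_ifs at this

def SS : Set (Finset Exc) := {S : Finset Exc | S.card = 10 ∧ IsClique {1, 2} S ∧
      HasWeight2Graph (fun i j => blockTTTV i = blockTTTV j) S ∧
      (∃ x ∈ S, x.1 = l12) ∧ (∃ x ∈ S, x.1 = l34)}

theorem mem_SS (S : Finset Exc) : S ∈ SS ↔ (∃ x, Gram x ∧ ∀ y, y ∈ S ↔ ∃ i, x i = y) ∧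
    ee 0 ∈ S ∧ ee 1 ∈ S := by
  have e0 : (∃ x ∈ S, x.1 = l12) ↔ ee 0 ∈ S := by
    constructor
    · rintro ⟨x, hx, h⟩
      rw [← ee0] at h
      rwa [← Subtype.ext h]
    · intro h; exact ⟨_, h, ee0⟩
  have e1 : (∃ x ∈ S, x.1 = l34) ↔ ee 1 ∈ S := by
    constructor
    · rintro ⟨x, hx, h⟩
      rw [← ee1] at h
      rwa [← Subtype.ext h]
    · intro h; exact ⟨_, h, ee1⟩
  rw [SS, Set.mem_ofPred_eq, e0, e1]
  constructor
  · rintro ⟨hc, hcl, ⟨σ, hσ⟩, h0, h1⟩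
    refine ⟨⟨fun i => (σ i).1, ?_, ?_⟩, h0, h1⟩
    · intro i j hij
      have hne : (σ i).1 ≠ (σ j).1 := fun h => hij (σ.injective (Subtype.ext h))
      have h12 := hcl _ (σ i).2 _ (σ j).2 hne
      have := hσ i j hij
      simp only [Set.mem_insert_iff, Set.mem_singleton_iff] at h12
      split_ifs with hb
      · exact this.mpr hb
      · rcases h12 with h | h
        · exact h
        · exact absurd (this.mp h) hb
    · intro y
      constructor
      · intro hy
        exact ⟨σ.symm ⟨y, hy⟩, by simp⟩
      · rintro ⟨i, rfl⟩
        exact (σ i).2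
  · rintro ⟨⟨x, hx, hS⟩, h0, h1⟩
    have hSe : S = Finset.univ.image x := by
      ext y; rw [hS]; simp
    refine ⟨?_, ?_, ?_, h0, h1⟩
    · rw [hSe, Finset.card_image_of_injective _ hx.inj]; simp
    · intro y hy z hz hne
      obtain ⟨i, rfl⟩ := (hS y).mp hy
      obtain ⟨j, rfl⟩ := (hS z).mp hz
      rw [hx i j (fun h => hne (by rw [h]))]
      split_ifs <;> simp
    · refine ⟨Equiv.ofBijective (fun i => ⟨x i, (hS _).mpr ⟨i, rfl⟩⟩) ⟨?_, ?_⟩, ?_⟩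
      · intro i j hij
        exact hx.inj (Subtype.ext_iff.mp hij)
      · rintro ⟨y, hy⟩
        obtain ⟨i, rfl⟩ := (hS y).mp hy
        exact ⟨i, rfl⟩
      · intro i j hij
        have := hx i j hij
        change Bx (x i) (x j) = 2 ↔ _
        rw [this]
        split_ifs with hb <;> simp [hb]

theorem Bx01 : Bx (ee 0) (ee 1) = 1 :=
  (o1_Bx 0 1 (by norm_num) (by norm_num)).mp o01.1

theorem Gram.rel {x : Fin 10 → Exc} (h : Gram x) (h0 : ∃ i, x i = ee 0) (h1 : ∃ i, x i = ee 1)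
    (k : Fin 10) : Relv (x k) := by
  obtain ⟨i, hi⟩ := h0
  obtain ⟨j, hj⟩ := h1
  by_cases hki : i = k
  · left; rw [← hki, hi, ee0]
  by_cases hkj : j = k
  · right; left; rw [← hkj, hj, ee1]
  right; right
  have a1 := h i k hki
  have a2 := h j k hkj
  have hij : i ≠ j := by
    rintro rfl
    have := Bx01
    rw [← hi, ← hj, Bx_self] at this
    omega
  have a3 := h i j hij
  rw [hi, hj, Bx01] at a3
  rw [hi, Bx, ee0] at a1
  rw [hj, Bx, ee1] at a2
  rw [a1, a2]
  have hb : ¬ blockTTTV i = blockTTTV j := by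
    intro hb
    rw [if_pos hb] at a3
    omega
  refine ⟨?_, ?_, ?_⟩
  · split_ifs <;> simp
  · split_ifs <;> simp
  · rintro ⟨b1, b2⟩
    by_cases c1 : blockTTTV i = blockTTTV k
    · by_cases c2 : blockTTTV j = blockTTTV k
      · exact hb (c1.trans c2.symm)
      · rw [if_neg c2] at b2; omega
    · rw [if_neg c1] at b1; omega

noncomputable def ff (m : ℕ) : Finset Exc := ((Finset.range 126).filter fun i => tb m i = true).image ee

theorem QN.lt {T U W : List ℕ} {r : ℕ} (h : QN T U W r) (i : ℕ)
    (hi : i ∈ T ∨ i ∈ U ∨ i ∈ W ∨ i = r) : i < 126 := by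
  rcases hi with hi | hi | hi | rfl
  · exact ((o1_iff _ _).mp (h.rT i hi)).1
  · exact ((o1_iff _ _).mp (h.rU i hi)).1
  · exact ((o1_iff _ _).mp (h.rW i hi)).1
  · have hl := h.lT
    obtain ⟨a, b, c, rfl⟩ := List.length_eq_three.mp hl
    exact ((o1_iff _ _).mp (h.rT a (by simp))).2.1

theorem QL.map {α β : Type} {r1 r2 : α → α → Prop} {s1 s2 : β → β → Prop} {T U W : List α} {r : α}
    (h : QL r1 r2 T U W r) (f : α → β) (P : α → Prop)
    (hP : ∀ i, (i ∈ T ∨ i ∈ U ∨ i ∈ W ∨ i = r) → P i)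
    (h1 : ∀ i j, P i → P j → r1 i j → s1 (f i) (f j))
    (h2 : ∀ i j, P i → P j → r2 i j → s2 (f i) (f j)) :
    QL s1 s2 (T.map f) (U.map f) (W.map f) (f r) := by
  have pT : ∀ i ∈ T, P i := fun i hi => hP i (by tauto)
  have pU : ∀ i ∈ U, P i := fun i hi => hP i (by tauto)
  have pW : ∀ i ∈ W, P i := fun i hi => hP i (by tauto)
  have pr : P r := hP r (by tauto)
  constructor
  case lT => simp [h.lT]
  case lU => simp [h.lU]
  case lW => simp [h.lW]
  case pT =>
    rw [List.pairwise_map]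
    exact h.pT.imp_of_mem fun ha hb hr => h2 _ _ (pT _ ha) (pT _ hb) hr
  case pU =>
    rw [List.pairwise_map]
    exact h.pU.imp_of_mem fun ha hb hr => h2 _ _ (pU _ ha) (pU _ hb) hr
  case pW =>
    rw [List.pairwise_map]
    exact h.pW.imp_of_mem fun ha hb hr => h2 _ _ (pW _ ha) (pW _ hb) hr
  all_goals simp only [List.forall_mem_map]
  case TU => exact fun a ha b hb => h1 _ _ (pT a ha) (pU b hb) (h.TU a ha b hb)
  case TW => exact fun a ha b hb => h1 _ _ (pT a ha) (pW b hb) (h.TW a ha b hb)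
  case UW => exact fun a ha b hb => h1 _ _ (pU a ha) (pW b hb) (h.UW a ha b hb)
  case rT => exact fun a ha => h1 _ _ (pT a ha) pr (h.rT a ha)
  case rU => exact fun a ha => h1 _ _ (pU a ha) pr (h.rU a ha)
  case rW => exact fun a ha => h1 _ _ (pW a ha) pr (h.rW a ha)

theorem mem_ff {m : ℕ} {T U W : List ℕ} {r : ℕ} (h : QN T U W r) (hb : Bits m T U W r) (y : Exc) :
    y ∈ ff m ↔ ∃ i, (i ∈ T ∨ i ∈ U ∨ i ∈ W ∨ i = r) ∧ ee i = y := by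
  simp only [ff, Finset.mem_image, Finset.mem_filter, Finset.mem_range, hb _]
  constructor
  · rintro ⟨i, ⟨_, h1⟩, h2⟩; exact ⟨i, h1, h2⟩
  · rintro ⟨i, h1, h2⟩; exact ⟨i, ⟨h.lt i h1, h1⟩, h2⟩

theorem ex10 (x : Fin 10 → Exc) (y : Exc) : (∃ i, x i = y) ↔
    (y ∈ [x 0, x 1, x 2] ∨ y ∈ [x 3, x 4, x 5] ∨ y ∈ [x 6, x 7, x 8] ∨ y = x 9) := by
  have : (∃ i, x i = y) ↔ (x 0 = y ∨ x 1 = y ∨ x 2 = y ∨ x 3 = y ∨ x 4 = y ∨ x 5 = y ∨ x 6 = y ∨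
      x 7 = y ∨ x 8 = y ∨ x 9 = y) := by
    constructor
    · rintro ⟨i, hi⟩
      fin_cases i <;> simp at hi <;> tauto
    · rintro (h | h | h | h | h | h | h | h | h | h) <;> exact ⟨_, h⟩
  rw [this]
  simp only [List.mem_cons, List.not_mem_nil, or_false, eq_comm (a := y), or_assoc]

theorem ff_mem (m : ℕ) (hm : m ∈ LL) : ff m ∈ SS := by
  obtain ⟨T, U, W, r, hq, hb, h0, h1⟩ := LL_fwd m hm
  have hE : QE (T.map ee) (U.map ee) (W.map ee) (ee r) :=
    hq.map ee (fun i => i < 126) hq.lt (fun i j hi hj h => (o1_Bx i j hi hj).mp h)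
      (fun i j hi hj h => (o2_Bx i j hi hj).mp h)
  obtain ⟨x, hx, e1, e2, e3, e4⟩ := Gram_of_QE hE
  rw [mem_SS]
  refine ⟨⟨x, hx, fun y => ?_⟩, ?_, ?_⟩
  · rw [mem_ff hq hb, ex10, ← e1, ← e2, ← e3, ← e4]
    simp only [List.mem_map]
    constructor
    · rintro ⟨i, h | h | h | rfl, rfl⟩
      · exact Or.inl ⟨i, h, rfl⟩
      · exact Or.inr (Or.inl ⟨i, h, rfl⟩)
      · exact Or.inr (Or.inr (Or.inl ⟨i, h, rfl⟩))
      · exact Or.inr (Or.inr (Or.inr rfl))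
    · rintro (⟨i, h, rfl⟩ | ⟨i, h, rfl⟩ | ⟨i, h, rfl⟩ | rfl)
      · exact ⟨i, Or.inl h, rfl⟩
      · exact ⟨i, Or.inr (Or.inl h), rfl⟩
      · exact ⟨i, Or.inr (Or.inr (Or.inl h)), rfl⟩
      · exact ⟨r, Or.inr (Or.inr (Or.inr rfl)), rfl⟩
  · rw [mem_ff hq hb]; exact ⟨0, (hb 0).mp h0, rfl⟩
  · rw [mem_ff hq hb]; exact ⟨1, (hb 1).mp h1, rfl⟩

theorem ff_surj (S : Finset Exc) (hS : S ∈ SS) : ∃ m ∈ LL, ff m = S := by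
  rw [mem_SS] at hS
  obtain ⟨⟨x, hx, hm⟩, h0, h1⟩ := hS
  have hrel : ∀ y ∈ S, Relv y := by
    intro y hy
    obtain ⟨k, rfl⟩ := (hm y).mp hy
    exact hx.rel ((hm _).mp h0) ((hm _).mp h1) k
  have hmem : ∀ y, y ∈ S ↔ _ := fun y => (hm y).trans (ex10 x y)
  have hq : QN _ _ _ _ := hx.QE.map (s1 := fun i j => o1 i j = true) (s2 := fun i j => o2 i j = true)
    idx Relv (fun y hy => hrel y ((hmem y).mpr hy))
    (fun y z hy hz h => by
      obtain ⟨a1, a2⟩ := idx_spec y hy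
      obtain ⟨b1, b2⟩ := idx_spec z hz
      rw [o1_Bx _ _ a1 b1, a2, b2]; exact h)
    (fun y z hy hz h => by
      obtain ⟨a1, a2⟩ := idx_spec y hy
      obtain ⟨b1, b2⟩ := idx_spec z hz
      rw [o2_Bx _ _ a1 b1, a2, b2]; exact h)
  have hidx : ∀ i < 126, ee i ∈ S → idx (ee i) = i := by
    intro i hi hS
    obtain ⟨a1, a2⟩ := idx_spec _ (hrel _ hS)
    exact ee_inj _ _ a1 hi a2
  have hin : ∀ y ∈ S, idx y ∈ [x 0, x 1, x 2].map idx ∨ idx y ∈ [x 3, x 4, x 5].map idx ∨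
      idx y ∈ [x 6, x 7, x 8].map idx ∨ idx y = idx (x 9) := by
    intro y hy
    rcases (hmem y).mp hy with h | h | h | h
    · exact Or.inl (List.mem_map_of_mem h)
    · exact Or.inr (Or.inl (List.mem_map_of_mem h))
    · exact Or.inr (Or.inr (Or.inl (List.mem_map_of_mem h)))
    · exact Or.inr (Or.inr (Or.inr (by rw [h])))
  have g0 := hin _ h0
  have g1 := hin _ h1
  rw [hidx 0 (by norm_num) h0] at g0
  rw [hidx 1 (by norm_num) h1] at g1
  obtain ⟨m, hmL, hb⟩ := LL_bwd hq g0 g1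
  refine ⟨m, hmL, ?_⟩
  ext y
  rw [mem_ff hq hb]
  constructor
  · rintro ⟨i, hi, rfl⟩
    have : ∃ y ∈ S, idx y = i := by
      simp only [List.mem_map] at hi
      rcases hi with ⟨y, h, e⟩ | ⟨y, h, e⟩ | ⟨y, h, e⟩ | e
      · exact ⟨y, (hmem y).mpr (Or.inl h), e⟩
      · exact ⟨y, (hmem y).mpr (Or.inr (Or.inl h)), e⟩
      · exact ⟨y, (hmem y).mpr (Or.inr (Or.inr (Or.inl h))), e⟩
      · exact ⟨x 9, (hmem _).mpr (Or.inr (Or.inr (Or.inr rfl))), e.symm⟩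
    obtain ⟨y, hy, rfl⟩ := this
    rw [(idx_spec y (hrel y hy)).2]; exact hy
  · intro hy
    exact ⟨idx y, hin y hy, (idx_spec y (hrel y hy)).2⟩

theorem ff_inj (m m' : ℕ) (hm : m ∈ LL) (hm' : m' ∈ LL) (h : ff m = ff m') : m = m' := by
  have key : ∀ m m', m ∈ LL → m' ∈ LL → ff m = ff m' → ∀ i, tb m i = true → tb m' i = true := by
    intro m m' hm hm' h i hi
    obtain ⟨T, U, W, r, hq, hb, -, -⟩ := LL_fwd m hm
    obtain ⟨T', U', W', r', hq', hb', -, -⟩ := LL_fwd m' hm'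
    have h1 : ee i ∈ ff m := (mem_ff hq hb _).mpr ⟨i, (hb i).mp hi, rfl⟩
    rw [h, mem_ff hq' hb'] at h1
    obtain ⟨j, hj, e⟩ := h1
    have := ee_inj j i (hq'.lt j hj) (hq.lt i ((hb i).mp hi)) e
    subst this
    exact (hb' j).mpr hj
  apply Nat.eq_of_testBit_eq
  intro i
  rw [Bool.eq_iff_iff, ← tb_eq, ← tb_eq]
  exact ⟨key m m' hm hm' h i, key m' m hm' hm h.symm i⟩

theorem SS_ncard : SS.ncard = 5120 := by
  have e : SS = ff '' (LL.toFinset : Set ℕ) := by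
    ext S
    simp only [Set.mem_image, Finset.mem_coe, List.mem_toFinset]
    constructor
    · exact ff_surj S
    · rintro ⟨m, hm, rfl⟩; exact ff_mem m hm
  rw [e, Set.ncard_image_of_injOn, Set.ncard_coe_finset, List.toFinset_card_of_nodup LL_nodup,
    LL_length]
  intro m hm m' hm' h
  simp only [Finset.mem_coe, List.mem_toFinset] at hm hm'
  exact ff_inj m m' hm hm' h


/-- Exactly 5,120 of the 10-element cliques in `C` with weights in `{1,2}` whose weight-2
graph is three triangles plus an isolated vertex contain both `ℓ_{1,2}` and `ℓ_{3,4}`. -/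
theorem stmt15 :
    {S : Finset Exc | S.card = 10 ∧ IsClique {1, 2} S ∧
      HasWeight2Graph (fun i j => blockTTTV i = blockTTTV j) S ∧
      (∃ x ∈ S, x.1 = l12) ∧ (∃ x ∈ S, x.1 = l34)}.ncard = 5120 := by
  exact SS_ncard
end

section
/- For every prime p < 17 (i.e., p in {2, 3, 5, 7, 11, 13}), there do not exist eight points in general position in the projective plane over the field F_p. Equivalently: for any eight pairwise non-proportional nonzero vectors v_1, ..., v_8 in F_p^3, either some three of the vectors are linearly dependent (three of the points are collinear), or there is a nonzero homogeneous polynomial of degree 2 over F_p in three variables vanishing at six of the vectors (six points lie on a conic), or there is a nonzero homogeneous polynomial F of degree 3 over F_p in three variables vanishing at all eight vectors such that all three partial derivatives of F vanish at one of the eight vectors (the eight points lie on a cubic singular at one of them). -/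
open MvPolynomial

section S16
variable {F : Type*} [Field F]

def cubv (c : Fin 10 → F) (x y z : F) : F :=
  c 0*x^3 + c 1*x^2*y + c 2*x^2*z + c 3*x*y^2 + c 4*x*y*z + c 5*x*z^2
    + c 6*y^3 + c 7*y^2*z + c 8*y*z^2 + c 9*z^3

def quadv (c : Fin 6 → F) (x y z : F) : F :=
  c 0*x^2 + c 1*x*y + c 2*x*z + c 3*y^2 + c 4*y*z + c 5*z^2

def IsCub (f : (Fin 3 → F) → F) : Prop := ∃ c, ∀ s, f s = cubv c (s 0) (s 1) (s 2)
def IsQuad (f : (Fin 3 → F) → F) : Prop := ∃ c, ∀ s, f s = quadv c (s 0) (s 1) (s 2)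

def sub3 (u v w : Fin 3 → F) (s : Fin 3 → F) : Fin 3 → F := s 0 • u + s 1 • v + s 2 • w

def Ind3 (u v w : Fin 3 → F) : Prop :=
  ∀ a b c : F, a • u + b • v + c • w = 0 → a = 0 ∧ b = 0 ∧ c = 0
def Ind2 (u v : Fin 3 → F) : Prop :=
  ∀ a b : F, a • u + b • v = 0 → a = 0 ∧ b = 0

def Sng (f : (Fin 3 → F) → F) (v : Fin 3 → F) : Prop :=
  ∀ w, ∃ a b : F, ∀ s : F, f (v + s • w) = a * s^2 + b * s^3

def NL (f : (Fin 3 → F) → F) : Prop :=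
  ∀ u w, Ind2 u w → ¬ ∀ a b : F, f (a • u + b • w) = 0

def GP (v : Fin 8 → Fin 3 → F) : Prop :=
  (∀ i j k, i ≠ j → i ≠ k → j ≠ k → Ind3 (v i) (v j) (v k)) ∧
  (∀ g, IsQuad g → ∀ T : Finset (Fin 8), T.card = 6 → (∀ i ∈ T, g (v i) = 0) → ∀ s, g s = 0) ∧
  (∀ f, IsCub f → (∀ i, f (v i) = 0) → ∀ i, Sng f (v i) → ∀ s, f s = 0)

lemma sub3_add (u v w s t : Fin 3 → F) : sub3 u v w (s + t) = sub3 u v w s + sub3 u v w t := by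
  ext i; simp [sub3]; ring
lemma sub3_smul (u v w s : Fin 3 → F) (a : F) : sub3 u v w (a • s) = a • sub3 u v w s := by
  ext i; simp [sub3]; ring
lemma sub3_inj {u v w : Fin 3 → F} (h : Ind3 u v w) : Function.Injective (sub3 u v w) := by
  intro s t hst
  have h1 : sub3 u v w (s + (-1 : F) • t) = 0 := by
    rw [sub3_add, sub3_smul, hst]; simp
  obtain ⟨a, b, c⟩ := h _ _ _ h1
  simp at a b c
  ext i; fin_cases i
  · simpa using (by linear_combination a : s 0 = t 0)
  · simpa using (by linear_combination b : s 1 = t 1)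
  · simpa using (by linear_combination c : s 2 = t 2)
lemma sub3_zero (u v w : Fin 3 → F) : sub3 u v w 0 = 0 := by
  ext i; simp [sub3]

lemma sub3_bij [Finite F] {u v w : Fin 3 → F} (h : Ind3 u v w) : Function.Bijective (sub3 u v w) :=
  Finite.injective_iff_bijective.1 (sub3_inj h)

lemma sub3_inv [Finite F] {u v w : Fin 3 → F} (h : Ind3 u v w) :
    ∃ u' v' w' : Fin 3 → F, (∀ s, sub3 u v w (sub3 u' v' w' s) = s) ∧
      (∀ s, sub3 u' v' w' (sub3 u v w s) = s) := by
  obtain ⟨u', hu⟩ := (sub3_bij h).2 ![1,0,0]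
  obtain ⟨v', hv⟩ := (sub3_bij h).2 ![0,1,0]
  obtain ⟨w', hw⟩ := (sub3_bij h).2 ![0,0,1]
  have key : ∀ s, sub3 u v w (sub3 u' v' w' s) = s := by
    intro s
    conv_lhs => rw [sub3.eq_1 u' v' w']
    rw [sub3_add, sub3_add, sub3_smul, sub3_smul, sub3_smul, hu, hv, hw]
    ext i; fin_cases i <;> simp
  exact ⟨u', v', w', key, fun s => sub3_inj h (key _)⟩

lemma cub_add {f g : (Fin 3 → F) → F} (hf : IsCub f) (hg : IsCub g) : IsCub (fun s => f s + g s) := by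
  obtain ⟨c, hc⟩ := hf
  obtain ⟨d, hd⟩ := hg
  exact ⟨c + d, fun s => by simp only [hc, hd, cubv, Pi.add_apply]; ring⟩
lemma cub_smul {f : (Fin 3 → F) → F} (hf : IsCub f) (a : F) : IsCub (fun s => a * f s) := by
  obtain ⟨c, hc⟩ := hf
  exact ⟨a • c, fun s => by simp only [hc, cubv, Pi.smul_apply, smul_eq_mul]; ring⟩

lemma cub_lin3 (a b c d e f g h k : F) : IsCub (fun s : Fin 3 → F =>
    (a * s 0 + b * s 1 + c * s 2) * (d * s 0 + e * s 1 + f * s 2) * (g * s 0 + h * s 1 + k * s 2)) := by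
  refine ⟨![a*d*g, a*d*h + a*e*g + b*d*g, a*d*k + a*f*g + c*d*g, a*e*h + b*d*h + b*e*g,
    a*e*k + a*f*h + b*d*k + b*f*g + c*d*h + c*e*g, a*f*k + c*d*k + c*f*g, b*e*h,
    b*e*k + b*f*h + c*e*h, b*f*k + c*e*k + c*f*h, c*f*k], fun s => ?_⟩
  simp [cubv, Matrix.cons_val]
  ring

lemma quad_add {f g : (Fin 3 → F) → F} (hf : IsQuad f) (hg : IsQuad g) : IsQuad (fun s => f s + g s) := by
  obtain ⟨c, hc⟩ := hf
  obtain ⟨d, hd⟩ := hg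
  exact ⟨c + d, fun s => by simp only [hc, hd, quadv, Pi.add_apply]; ring⟩
lemma quad_smul {f : (Fin 3 → F) → F} (hf : IsQuad f) (a : F) : IsQuad (fun s => a * f s) := by
  obtain ⟨c, hc⟩ := hf
  exact ⟨a • c, fun s => by simp only [hc, quadv, Pi.smul_apply, smul_eq_mul]; ring⟩
lemma quad_lin2 (a b c d e f : F) : IsQuad (fun s : Fin 3 → F =>
    (a * s 0 + b * s 1 + c * s 2) * (d * s 0 + e * s 1 + f * s 2)) := by
  refine ⟨![a*d, a*e+b*d, a*f+c*d, b*e, b*f+c*e, c*f], fun s => ?_⟩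
  simp [quadv, Matrix.cons_val]
  ring

lemma cub_comp {f : (Fin 3 → F) → F} (hf : IsCub f) (u v w : Fin 3 → F) :
    IsCub (fun s => f (sub3 u v w s)) := by
  obtain ⟨c, hc⟩ := hf
  have M : ∀ i j k : Fin 3, IsCub (fun s : Fin 3 → F => _) := fun i j k =>
    cub_lin3 (u i) (v i) (w i) (u j) (v j) (w j) (u k) (v k) (w k)
  obtain ⟨d, hd⟩ := cub_add (cub_add (cub_add (cub_add (cub_add (cub_add (cub_add (cub_add (cub_add
    (cub_smul (M 0 0 0) (c 0)) (cub_smul (M 0 0 1) (c 1))) (cub_smul (M 0 0 2) (c 2)))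
    (cub_smul (M 0 1 1) (c 3))) (cub_smul (M 0 1 2) (c 4))) (cub_smul (M 0 2 2) (c 5)))
    (cub_smul (M 1 1 1) (c 6))) (cub_smul (M 1 1 2) (c 7))) (cub_smul (M 1 2 2) (c 8)))
    (cub_smul (M 2 2 2) (c 9))
  refine ⟨d, fun s => ?_⟩
  rw [← hd s]
  beta_reduce
  rw [hc]
  simp only [cubv, sub3, Pi.add_apply, Pi.smul_apply, smul_eq_mul]
  ring

lemma quad_comp {f : (Fin 3 → F) → F} (hf : IsQuad f) (u v w : Fin 3 → F) :
    IsQuad (fun s => f (sub3 u v w s)) := by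
  obtain ⟨c, hc⟩ := hf
  have M : ∀ i j : Fin 3, IsQuad (fun s : Fin 3 → F => _) := fun i j =>
    quad_lin2 (u i) (v i) (w i) (u j) (v j) (w j)
  obtain ⟨d, hd⟩ := quad_add (quad_add (quad_add (quad_add (quad_add
    (quad_smul (M 0 0) (c 0)) (quad_smul (M 0 1) (c 1))) (quad_smul (M 0 2) (c 2)))
    (quad_smul (M 1 1) (c 3))) (quad_smul (M 1 2) (c 4))) (quad_smul (M 2 2) (c 5))
  refine ⟨d, fun s => ?_⟩
  rw [← hd s]
  beta_reduce
  rw [hc]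
  simp only [quadv, sub3, Pi.add_apply, Pi.smul_apply, smul_eq_mul]
  ring

/-- transport of general position -/
lemma GP_comp [Finite F] {v : Fin 8 → Fin 3 → F} (h : GP v) {a b c : Fin 3 → F} (hi : Ind3 a b c)
    (v' : Fin 8 → Fin 3 → F) (hv : ∀ i, sub3 a b c (v' i) = v i) : GP v' := by
  obtain ⟨h1, h2, h3⟩ := h
  obtain ⟨a', b', c', e1, e2⟩ := sub3_inv hi
  have hv2 : ∀ i, sub3 a' b' c' (v i) = v' i := fun i => by rw [← hv, e2]
  refine ⟨?_, ?_, ?_⟩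
  · intro i j k hij hik hjk x y z hz
    refine h1 i j k hij hik hjk x y z ?_
    rw [← hv, ← hv, ← hv, ← sub3_smul, ← sub3_smul, ← sub3_smul, ← sub3_add, ← sub3_add, hz,
      sub3_zero]
  · intro g hg T hT hz s
    have := h2 _ (quad_comp hg a' b' c') T hT (fun i hi => by rw [hv2]; exact hz i hi) (sub3 a b c s)
    simpa [e2] using this
  · intro f hf hz i hs s
    have := h3 _ (cub_comp hf a' b' c') (fun i => by rw [hv2]; exact hz i) i (by
      intro w
      obtain ⟨x, y, hxy⟩ := hs (sub3 a' b' c' w)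
      exact ⟨x, y, fun t => by beta_reduce; rw [sub3_add, sub3_smul, hv2]; exact hxy t⟩) (sub3 a b c s)
    simpa [e2] using this

lemma NL_comp [Finite F] {f : (Fin 3 → F) → F} (h : NL f) {a b c : Fin 3 → F} (hi : Ind3 a b c) :
    NL (fun s => f (sub3 a b c s)) := by
  intro u w huw hz
  refine h (sub3 a b c u) (sub3 a b c w) ?_ ?_
  · intro x y hxy
    rw [← sub3_smul, ← sub3_smul, ← sub3_add] at hxy
    exact huw x y (sub3_inj hi (hxy.trans (sub3_zero _ _ _).symm))
  · intro x y
    rw [← sub3_smul, ← sub3_smul, ← sub3_add]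
    exact hz x y

lemma exists_ind3 [Finite F] {u w : Fin 3 → F} (h : Ind2 u w) : ∃ e, Ind3 e u w := by
  classical
  have := Fintype.ofFinite F
  have : ∃ e, e ∉ Set.range (fun x : F × F => x.1 • u + x.2 • w) := by
    by_contra! hc
    have hs : Function.Surjective (fun x : F × F => x.1 • u + x.2 • w) := hc
    have := Fintype.card_le_of_surjective _ hs
    simp at this
    have h1 : 1 < Fintype.card F := Fintype.one_lt_card
    nlinarith [Nat.mul_lt_mul_of_pos_left h1 (show 0 < Fintype.card F * Fintype.card F by positivity)]
  obtain ⟨e, he⟩ := this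
  refine ⟨e, fun a b c habc => ?_⟩
  have ha : a = 0 := by
    by_contra ha
    apply he
    refine ⟨(-(b / a), -(c / a)), ?_⟩
    ext i
    have := congrFun habc i
    simp at this ⊢
    field_simp
    linear_combination -this
  subst ha
  simp at habc
  exact ⟨rfl, h b c habc⟩

/-- a cubic function vanishing identically has zero coefficients -/
lemma cub_zero (h2 : (2 : F) ≠ 0) {c : Fin 10 → F} (h : ∀ x y z, cubv c x y z = 0) : c = 0 := by
  have e0 := h 1 0 0
  have e6 := h 0 1 0
  have e9 := h 0 0 1
  have a1 := h 1 1 0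
  have a2 := h 1 (-1) 0
  have b1 := h 1 0 1
  have b2 := h 1 0 (-1)
  have d1 := h 0 1 1
  have d2 := h 0 1 (-1)
  have g := h 1 1 1
  simp only [cubv] at *
  ring_nf at *
  have z : ∀ x : F, 2 * x = 0 → x = 0 := fun x hx => (mul_eq_zero.1 hx).resolve_left h2
  have c3 : c 3 = 0 := z _ (by linear_combination a1 + a2 - 2 * e0)
  have c1 : c 1 = 0 := z _ (by linear_combination a1 - a2 - 2 * e6)
  have c5 : c 5 = 0 := z _ (by linear_combination b1 + b2 - 2 * e0)
  have c2 : c 2 = 0 := z _ (by linear_combination b1 - b2 - 2 * e9)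
  have c8 : c 8 = 0 := z _ (by linear_combination d1 + d2 - 2 * e6)
  have c7 : c 7 = 0 := z _ (by linear_combination d1 - d2 - 2 * e9)
  have c4 : c 4 = 0 := by linear_combination g - c1 - c2 - c3 - c5 - c7 - c8 - e0 - e6 - e9
  ext i; fin_cases i <;> simp <;> assumption

lemma cub_nl [Finite F] (h2 : (2 : F) ≠ 0) {v : Fin 8 → Fin 3 → F} (h : GP v)
    {f : (Fin 3 → F) → F} (hf : IsCub f) (hz : ∀ i, f (v i) = 0) (hn : ¬ ∀ s, f s = 0) : NL f := by
  classical
  intro u w huw hl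
  apply hn
  obtain ⟨e, he⟩ := exists_ind3 huw
  obtain ⟨c, hc⟩ := cub_comp hf e u w
  obtain ⟨v', hv'⟩ : ∃ v' : Fin 8 → Fin 3 → F, ∀ i, sub3 e u w (v' i) = v i :=
    ⟨fun i => ((sub3_bij he).2 (v i)).choose, fun i => ((sub3_bij he).2 (v i)).choose_spec⟩
  obtain ⟨g1, g2, -⟩ := GP_comp h he v' hv'
  have hl' : ∀ y z, cubv c 0 y z = 0 := fun y z => by
    have := hc ![0, y, z]
    simp only [sub3, Matrix.cons_val] at this
    rw [← this, zero_smul, zero_add]; exact hl y z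
  have e6 := hl' 1 0
  have e9 := hl' 0 1
  have d1 := hl' 1 1
  have d2 := hl' 1 (-1)
  simp only [cubv] at e6 e9 d1 d2
  ring_nf at e6 e9 d1 d2
  have z : ∀ x : F, 2 * x = 0 → x = 0 := fun x hx => (mul_eq_zero.1 hx).resolve_left h2
  have c8 : c 8 = 0 := z _ (by linear_combination d1 + d2 - 2 * e6)
  have c7 : c 7 = 0 := z _ (by linear_combination d1 - d2 - 2 * e9)
  have fac : ∀ s, f (sub3 e u w s) =
      s 0 * quadv ![c 0, c 1, c 2, c 3, c 4, c 5] (s 0) (s 1) (s 2) := by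
    intro s
    rw [show f (sub3 e u w s) = _ from hc s]
    simp only [cubv, quadv, c7, c8, e6, e9, Matrix.cons_val]
    ring
  set T0 := (Finset.univ.filter fun i => v' i 0 ≠ 0) with hT0
  have hcard : 6 ≤ T0.card := by
    by_contra! hlt
    have hcompl : 2 < (T0ᶜ).card := by
      rw [Finset.card_compl, Fintype.card_fin]; omega
    obtain ⟨i, j, k, hi, hj, hk, hij, hik, hjk⟩ := Finset.two_lt_card_iff.1 hcompl
    simp [hT0] at hi hj hk
    have hI := g1 i j k hij hik hjk
    obtain ⟨s, hs⟩ := (sub3_bij hI).2 ![1, 0, 0]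
    have := congrFun hs 0
    simp [sub3, hi, hj, hk] at this
  obtain ⟨T, hT, hT6⟩ := Finset.exists_subset_card_eq hcard
  have q0 := g2 (fun s => quadv ![c 0, c 1, c 2, c 3, c 4, c 5] (s 0) (s 1) (s 2)) ⟨_, fun s => rfl⟩
    T hT6 (fun i hi => by
      have hi := hT hi
      simp [hT0] at hi
      have := fac (v' i)
      rw [hv', hz] at this
      exact (mul_eq_zero.1 this.symm).resolve_left hi)
  intro s
  obtain ⟨t, rfl⟩ := (sub3_bij he).2 s
  rw [fac, q0, mul_zero]

end S16


section S16b
variable {F : Type*} [Field F] [Fintype F] [DecidableEq F]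

def HB (F : Type*) [Field F] [Fintype F] [DecidableEq F] (B : ℕ) : Prop :=
  ∀ a b : F, (Finset.univ.filter fun x : F × F => x.2^2 = x.1^3+a*x.1+b).card ≤ Fintype.card F + B

def cnt (f : (Fin 3 → F) → F) : ℕ := (Finset.univ.filter fun s => f s = 0).card

lemma cnt_cubic {B : ℕ} (hB : HB F B) (h3 : (3 : F) ≠ 0) (a b c d : F) (ha : a ≠ 0) :
    (Finset.univ.filter fun x : F × F => x.2^2 = a*x.1^3+b*x.1^2+c*x.1+d).card
      ≤ Fintype.card F + B := by
  refine le_trans ?_ (hB (c*a - b^2/3) (2*b^3/27 - c*a*b/3 + d*a^2))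
  apply Finset.card_le_card_of_injOn (fun x => (a * x.1 + b/3, a * x.2))
  · intro x hx
    simp only [Finset.coe_filter, Finset.mem_univ, true_and, Set.mem_ofPred_eq] at hx ⊢
    have h27 : (27 : F) ≠ 0 := by
      have : (27 : F) = 3^3 := by norm_num
      rw [this]; exact pow_ne_zero _ h3
    have e : (a * x.2)^2 = a^2 * (a*x.1^3+b*x.1^2+c*x.1+d) := by rw [← hx]; ring
    rw [e]
    field_simp
    ring
  · intro x _ y _ hxy
    simp only [Prod.mk.injEq] at hxy
    have h1 : x.1 = y.1 := mul_left_cancel₀ ha (by linear_combination hxy.1)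
    have h2 : x.2 = y.2 := mul_left_cancel₀ ha hxy.2
    exact Prod.ext h1 h2

/-- split by the vanishing of the first coordinate -/
lemma cnt_split (c : Fin 10 → F) (m : ℕ)
    (h0 : (Finset.univ.filter fun x : F × F => cubv c 0 x.1 x.2 = 0).card ≤ m) (n : ℕ)
    (h1 : (Finset.univ.filter fun x : F × F => cubv c 1 x.1 x.2 = 0).card ≤ n) :
    cnt (fun s => cubv c (s 0) (s 1) (s 2)) ≤ m + (Fintype.card F - 1) * n := by
  classical
  unfold cnt
  rw [← Finset.card_filter_add_card_filter_not (fun s : Fin 3 → F => s 0 = 0)]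
  apply Nat.add_le_add
  · refine le_trans ?_ h0
    apply Finset.card_le_card_of_injOn (fun s => (s 1, s 2))
    · intro s hs
      simp only [Finset.coe_filter, Finset.mem_filter, Finset.mem_univ, true_and, Set.mem_ofPred_eq] at hs ⊢
      have := hs.1
      rwa [hs.2] at this
    · intro s hs t ht hst
      simp only [Finset.coe_filter, Finset.mem_filter, Finset.mem_univ, true_and, Set.mem_ofPred_eq] at hs ht
      simp only [Prod.mk.injEq] at hst
      ext i; fin_cases i
      · exact hs.2.trans ht.2.symm
      · exact hst.1
      · exact hst.2
  · have : (Fintype.card F - 1) * n ≥ ((Finset.univ.erase (0:F)) ×ˢ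
        (Finset.univ.filter fun x : F × F => cubv c 1 x.1 x.2 = 0)).card := by
      rw [Finset.card_product, Finset.card_erase_of_mem (Finset.mem_univ _), Finset.card_univ]
      exact Nat.mul_le_mul_left _ h1
    refine le_trans ?_ this
    apply Finset.card_le_card_of_injOn (fun s => (s 0, (s 1 / s 0, s 2 / s 0)))
    · intro s hs
      simp only [Finset.coe_filter, Finset.mem_filter, Finset.mem_univ, true_and, Set.mem_ofPred_eq] at hs
      obtain ⟨hs, hs0⟩ := hs
      simp only [Finset.coe_product, Set.mem_prod, Finset.mem_coe, Finset.mem_erase,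
        Finset.mem_filter, Finset.mem_univ, and_true, true_and]
      refine ⟨hs0, ?_⟩
      have : cubv c (s 0) (s 1) (s 2) = (s 0)^3 * cubv c 1 (s 1 / s 0) (s 2 / s 0) := by
        simp only [cubv]; field_simp
      rw [this] at hs
      exact (mul_eq_zero.1 hs).resolve_left (pow_ne_zero _ hs0)
    · intro s hs t ht hst
      simp only [Finset.coe_filter, Finset.mem_filter, Finset.mem_univ, true_and, Set.mem_ofPred_eq] at hs ht
      simp only [Prod.mk.injEq] at hst
      obtain ⟨e0, e1, e2⟩ := hst
      have hs0 := hs.2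
      rw [← e0] at e1 e2
      ext i; fin_cases i
      · exact e0
      · exact (div_left_inj' hs0).1 e1
      · exact (div_left_inj' hs0).1 e2

lemma hasse_flex {B : ℕ} (hB : HB F B) (h2 : (2 : F) ≠ 0) (h3 : (3 : F) ≠ 0) (c : Fin 10 → F)
    (c6 : c 6 = 0) (c7 : c 7 = 0) (c8 : c 8 = 0) (c3 : c 3 ≠ 0) (c9 : c 9 ≠ 0) :
    cnt (fun s => cubv c (s 0) (s 1) (s 2))
      ≤ Fintype.card F + (Fintype.card F - 1) * (Fintype.card F + B) := by
  apply cnt_split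
  · rw [← Finset.card_univ (α := F)]
    apply Finset.card_le_card_of_injOn (fun s => s.1)
    · intro s hs; simp
    · intro s hs t ht hst
      simp [cubv, c6, c7, c8, c9] at hs ht
      exact Prod.ext hst (hs.trans ht.symm)
  · have h4 : (4 : F) ≠ 0 := by
      have : (4 : F) = 2^2 := by norm_num
      rw [this]; exact pow_ne_zero _ h2
    refine le_trans ?_ (cnt_cubic hB h3 (-4 * c 3 * c 9) ((c 4)^2 - 4 * c 3 * c 5)
      (2 * c 1 * c 4 - 4 * c 3 * c 2) ((c 1)^2 - 4 * c 3 * c 0) (by simp [h4, c3, c9]))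
    apply Finset.card_le_card_of_injOn (fun x => (x.2, 2 * c 3 * x.1 + (c 1 + c 4 * x.2)))
    · intro x hx
      simp only [Finset.coe_filter, Finset.mem_univ, true_and, Set.mem_ofPred_eq, cubv, c6, c7, c8] at hx ⊢
      linear_combination 4 * c 3 * hx
    · intro x _ y _ hxy
      simp only [Prod.mk.injEq] at hxy
      obtain ⟨e1, e2⟩ := hxy
      rw [e1] at e2
      refine Prod.ext ?_ e1
      exact mul_left_cancel₀ (mul_ne_zero h2 c3) (by linear_combination e2)

lemma hasse_gen {B : ℕ} (hB : HB F B) (h2 : (2 : F) ≠ 0) (h3 : (3 : F) ≠ 0) (c : Fin 10 → F)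
    (c6 : c 6 = 0) (c7 : c 7 = 0) (c9 : c 9 = 0) (c3 : c 3 ≠ 0) (c8 : c 8 ≠ 0)
    (hnl : NL (fun s => cubv c (s 0) (s 1) (s 2))) :
    cnt (fun s => cubv c (s 0) (s 1) (s 2))
      ≤ (2 * Fintype.card F - 1) + (Fintype.card F - 1) * (Fintype.card F + B - 1) := by
  classical
  apply cnt_split
  · have : (2 * Fintype.card F - 1) ≥ ((Finset.univ.image (fun y : F => ((0:F), y))) ∪
        ((Finset.univ.erase (0:F)).image (fun y : F => (y, (0:F))))).card := by
      refine (Finset.card_union_le _ _).trans ?_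
      have e1 := Finset.card_image_le (s := Finset.univ) (f := (fun y : F => ((0:F), y)))
      have e2 := Finset.card_image_le (s := Finset.univ.erase (0:F)) (f := (fun y : F => (y, (0:F))))
      rw [Finset.card_erase_of_mem (Finset.mem_univ _)] at e2
      rw [Finset.card_univ] at e1 e2
      have := Fintype.card_pos (α := F)
      omega
    refine le_trans (Finset.card_le_card ?_) this
    rintro ⟨y, z⟩ hx
    simp [cubv, c6, c7, c8, c9] at hx
    simp
    tauto
  · have h4 : (4 : F) ≠ 0 := by
      have : (4 : F) = 2^2 := by norm_num
      rw [this]; exact pow_ne_zero _ h2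
    have key := cnt_cubic hB h3 (-4 * c 3 * c 8) ((c 4)^2 - 4 * c 8 * c 1 - 4 * c 5 * c 3)
      (2 * c 2 * c 4 - 4 * c 8 * c 0 - 4 * c 5 * c 1) ((c 2)^2 - 4 * c 5 * c 0) (by simp [h4, c3, c8])
    set S := (Finset.univ.filter fun x : F × F => x.2^2 = (-4 * c 3 * c 8)*x.1^3+
      ((c 4)^2 - 4 * c 8 * c 1 - 4 * c 5 * c 3)*x.1^2+
      (2 * c 2 * c 4 - 4 * c 8 * c 0 - 4 * c 5 * c 1)*x.1+((c 2)^2 - 4 * c 5 * c 0)) with hS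
    set y0 := -(c 5 / c 8) with hy0
    have hL0 : c 5 + c 8 * y0 = 0 := by rw [hy0]; field_simp; ring
    have hL1 : ∀ y, c 5 + c 8 * y = 0 → y = y0 := fun y hy =>
      mul_left_cancel₀ c8 (by linear_combination hy - hL0)
    have hline : ∀ y, c 5 + c 8 * y = 0 → c 2 + c 4 * y = 0 → c 0 + c 1 * y + c 3 * y^2 = 0 →
        False := by
      intro y a1 a2 a3
      refine hnl ![1, y, 0] ![0,0,1] ?_ ?_
      · intro a b hab
        have e0 := congrFun hab 0
        have e2 := congrFun hab 2
        simp at e0 e2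
        exact ⟨e0, e2⟩
      · intro a b
        simp [cubv, c6, c7, c9]
        linear_combination a^3 * a3 + a^2*b*a2 + a*b^2*a1
    have hmem : (y0, -(c 2 + c 4 * y0)) ∈ S := by
      simp only [hS, Finset.mem_filter, Finset.mem_univ, true_and]
      linear_combination (4 * (c 0 + c 1 * y0 + c 3 * y0^2)) * hL0
    have : Fintype.card F + B - 1 ≥ (S.erase (y0, -(c 2 + c 4 * y0))).card := by
      rw [Finset.card_erase_of_mem hmem]; omega
    refine le_trans ?_ this
    apply Finset.card_le_card_of_injOn (fun x => (x.1, 2 * (c 5 + c 8 * x.1) * x.2 + (c 2 + c 4 * x.1)))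
    · rintro ⟨y, z⟩ hx
      simp only [Finset.coe_filter, Finset.mem_univ, true_and, Set.mem_ofPred_eq, cubv, c6, c7, c9] at hx
      simp only [Finset.coe_erase, Set.mem_sdiff, Finset.mem_coe, hS, Finset.mem_filter,
        Finset.mem_univ, true_and, Set.mem_singleton_iff, Prod.mk.injEq, not_and]
      constructor
      · linear_combination 4 * (c 5 + c 8 * y) * hx
      · rintro rfl he
        rw [hL0] at he
        have hq : c 2 + c 4 * y0 = 0 := by
          have : 2 * (c 2 + c 4 * y0) = 0 := by linear_combination he
          exact (mul_eq_zero.1 this).resolve_left h2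
        exact hline y0 hL0 hq (by linear_combination hx - z^2 * hL0 - z * hq)
    · rintro ⟨y, z⟩ hx ⟨y', z'⟩ hx' hxy
      simp only [Finset.coe_filter, Finset.mem_univ, true_and, Set.mem_ofPred_eq, cubv, c6, c7, c9] at hx hx'
      simp only [Prod.mk.injEq] at hxy
      obtain ⟨rfl, e2⟩ := hxy
      refine Prod.ext rfl ?_
      by_cases hl : c 5 + c 8 * y = 0
      · have hq : c 2 + c 4 * y ≠ 0 := fun hq =>
          hline y hl hq (by linear_combination hx - z^2 * hl - z * hq)
        exact mul_left_cancel₀ hq (by linear_combination hx - hx' - (z^2 - z'^2) * hl)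
      · exact mul_left_cancel₀ (mul_ne_zero h2 hl) (by linear_combination e2)

lemma cnt_comp (f : (Fin 3 → F) → F) {u v w : Fin 3 → F} (h : Ind3 u v w) :
    cnt f = cnt (fun s => f (sub3 u v w s)) := by
  symm
  apply Finset.card_bij (fun s _ => sub3 u v w s)
  · intro s hs; simpa using hs
  · intro s _ t _ hst; exact sub3_inj h hst
  · intro t ht
    obtain ⟨s, rfl⟩ := (sub3_bij h).2 t
    exact ⟨s, by simpa using ht, rfl⟩

lemma hasse3 {B : ℕ} (hB : HB F B) (h2 : (2 : F) ≠ 0) (h3 : (3 : F) ≠ 0) (c : Fin 10 → F)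
    (c6 : c 6 = 0) (c7 : c 7 = 0) (c3 : c 3 ≠ 0)
    (hnl : NL (fun s => cubv c (s 0) (s 1) (s 2))) :
    cnt (fun s => cubv c (s 0) (s 1) (s 2))
      ≤ 1 + (Fintype.card F - 1) * (Fintype.card F + B + 1) := by
  have hq := Fintype.card_pos (α := F)
  obtain ⟨r, hr⟩ : ∃ r, Fintype.card F = r + 1 := ⟨_, (Nat.succ_pred_eq_of_pos hq).symm⟩
  by_cases c8 : c 8 = 0
  · by_cases c9 : c 9 = 0
    · exfalso
      refine hnl ![0,1,0] ![0,0,1] ?_ ?_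
      · intro a b hab
        have e0 := congrFun hab 1
        have e2 := congrFun hab 2
        simp at e0 e2
        exact ⟨e0, e2⟩
      · intro a b; simp [cubv, c6, c7, c8, c9]
    · refine (hasse_flex hB h2 h3 c c6 c7 c8 c3 c9).trans (le_of_eq ?_)
      rw [hr]; simp; ring
  · set k := c 9 / c 8 with hk
    have hi : Ind3 (![1,0,0] : Fin 3 → F) ![0,1,0] ![0,-k,1] := by
      intro x y z hxyz
      have e0 := congrFun hxyz 0
      have e1 := congrFun hxyz 1
      have e2 := congrFun hxyz 2
      simp at e0 e1 e2
      subst e2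
      simp at e1
      exact ⟨e0, e1, rfl⟩
    have hck : c 8 * k = c 9 := by rw [hk]; field_simp
    rw [cnt_comp _ hi]
    have hnl' := NL_comp hnl hi
    have e : (fun s => (fun s => cubv c (s 0) (s 1) (s 2)) (sub3 (![1,0,0] : Fin 3 → F) ![0,1,0] ![0,-k,1] s))
       = fun s => cubv ![c 0, c 1, c 2 - k * c 1, c 3, c 4 - 2 * k * c 3, c 5 - k * c 4 + k^2 * c 3,
          0, 0, c 8, 0] (s 0) (s 1) (s 2) := by
      funext s
      simp [cubv, sub3, c6, c7]
      linear_combination (-(s 2)^3) * hck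
    rw [e] at hnl' ⊢
    refine (hasse_gen hB h2 h3 _ ?_ ?_ ?_ ?_ ?_ hnl').trans (le_of_eq ?_)
    · simp
    · simp
    · simp
    · simpa using c3
    · simpa using c8
    · rw [hr]; simp
      rw [show 2 * (r+1) - 1 = 2 * r + 1 by omega]; ring

lemma hasse4 {B : ℕ} (hB : HB F B) (h2 : (2 : F) ≠ 0) (h3 : (3 : F) ≠ 0) (c : Fin 10 → F)
    (c6 : c 6 = 0) (hc : c 3 ≠ 0 ∨ c 7 ≠ 0)
    (hnl : NL (fun s => cubv c (s 0) (s 1) (s 2))) :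
    cnt (fun s => cubv c (s 0) (s 1) (s 2))
      ≤ 1 + (Fintype.card F - 1) * (Fintype.card F + B + 1) := by
  by_cases c3 : c 3 = 0
  · have c7 : c 7 ≠ 0 := by tauto
    have hi : Ind3 (![0,0,1] : Fin 3 → F) ![0,1,0] ![1,0,0] := by
      intro x y z hxyz
      have e0 := congrFun hxyz 0
      have e1 := congrFun hxyz 1
      have e2 := congrFun hxyz 2
      simp at e0 e1 e2
      exact ⟨e2, e1, e0⟩
    rw [cnt_comp _ hi]
    have hnl' := NL_comp hnl hi
    have e : (fun s => (fun s => cubv c (s 0) (s 1) (s 2)) (sub3 (![0,0,1] : Fin 3 → F) ![0,1,0] ![1,0,0] s))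
       = fun s => cubv ![c 9, c 8, c 5, c 7, c 4, c 2, 0, 0, c 1, c 0] (s 0) (s 1) (s 2) := by
      funext s
      simp [cubv, sub3, c6, c3]
      ring
    rw [e] at hnl' ⊢
    refine hasse3 hB h2 h3 _ ?_ ?_ ?_ hnl'
    · simp
    · simp
    · simpa using c7
  · set k := c 7 / c 3 with hk
    have hi : Ind3 (![1,0,0] : Fin 3 → F) ![0,1,0] ![-k,0,1] := by
      intro x y z hxyz
      have e0 := congrFun hxyz 0
      have e1 := congrFun hxyz 1
      have e2 := congrFun hxyz 2
      simp at e0 e1 e2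
      subst e2
      simp at e0
      exact ⟨e0, e1, rfl⟩
    have hck : c 3 * k = c 7 := by rw [hk]; field_simp
    rw [cnt_comp _ hi]
    have hnl' := NL_comp hnl hi
    have e : (fun s => (fun s => cubv c (s 0) (s 1) (s 2)) (sub3 (![1,0,0] : Fin 3 → F) ![0,1,0] ![-k,0,1] s))
       = fun s => cubv ![c 0, c 1, c 2 - 3 * k * c 0, c 3, c 4 - 2 * k * c 1,
          c 5 - 2 * k * c 2 + 3 * k^2 * c 0, 0, 0, c 8 - k * c 4 + k^2 * c 1,
          c 9 - k * c 5 + k^2 * c 2 - k^3 * c 0] (s 0) (s 1) (s 2) := by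
      funext s
      simp [cubv, sub3, c6]
      linear_combination (-(s 1)^2 * s 2) * hck
    rw [e] at hnl' ⊢
    refine hasse3 hB h2 h3 _ ?_ ?_ ?_ hnl'
    · simp
    · simp
    · simpa using c3

/-- The Hasse type bound at the second coordinate point. -/
lemma hasse {B : ℕ} (hB : HB F B) (h2 : (2 : F) ≠ 0) (h3 : (3 : F) ≠ 0) (c : Fin 10 → F)
    (hz : cubv c 0 1 0 = 0) (hs : ¬ Sng (fun s => cubv c (s 0) (s 1) (s 2)) ![0,1,0])
    (hnl : NL (fun s => cubv c (s 0) (s 1) (s 2))) :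
    cnt (fun s => cubv c (s 0) (s 1) (s 2))
      ≤ 1 + (Fintype.card F - 1) * (Fintype.card F + B + 1) := by
  have c6 : c 6 = 0 := by simpa [cubv] using hz
  refine hasse4 hB h2 h3 c c6 ?_ hnl
  by_contra! hc
  apply hs
  intro w
  refine ⟨c 1 * (w 0)^2 + c 4 * (w 0) * w 2 + c 8 * (w 2)^2, cubv c (w 0) (w 1) (w 2), fun s => ?_⟩
  simp [cubv, c6, hc.1, hc.2]
  ring

end S16b


section S16c
variable {F : Type*} [Field F]

lemma poly_root (p : Polynomial F) (hd : p.natDegree ≤ 7) (h7 : p.coeff 7 ≠ 0) (S : Finset F)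
    (hS : S.card = 6) (h : ∀ t ∈ S, p.eval t = 0 ∧ p.derivative.eval t ≠ 0) :
    ∃ t0, t0 ∉ S ∧ p.eval t0 = 0 := by
  classical
  have hp0 : p ≠ 0 := by rintro rfl; simp at h7
  have hd7 : p.natDegree = 7 := le_antisymm hd (Polynomial.le_natDegree_of_ne_zero h7)
  have hdvd : (∏ t ∈ S, (Polynomial.X - Polynomial.C t)) ∣ p := by
    apply Finset.prod_dvd_of_coprime
    · intro a _ b _ hab
      exact Polynomial.isCoprime_X_sub_C_of_isUnit_sub (sub_ne_zero.2 hab).isUnit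
    · intro t ht
      exact Polynomial.dvd_iff_isRoot.2 (h t ht).1
  obtain ⟨r, hr⟩ := hdvd
  have hr0 : r ≠ 0 := by rintro rfl; simp at hr; exact hp0 hr
  have hP0 : (∏ t ∈ S, (Polynomial.X - Polynomial.C t)) ≠ 0 := by
    intro h0; rw [h0] at hr; simp at hr; exact hp0 hr
  have hdeg : r.natDegree = 1 := by
    have e := congrArg Polynomial.natDegree hr
    rw [Polynomial.natDegree_mul hP0 hr0, hd7, Polynomial.natDegree_finsetProd_X_sub_C_eq_card, hS] at e
    omega
  obtain ⟨t0, ht0⟩ := Polynomial.exists_root_of_degree_eq_one (Polynomial.degree_eq_iff_natDegree_eq hr0 |>.2 hdeg)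
  refine ⟨t0, fun hm => (h t0 hm).2 ?_, ?_⟩
  · rw [hr, Polynomial.derivative_mul]
    have e1 : (∏ t ∈ S, (Polynomial.X - Polynomial.C t)).eval t0 = 0 := by
      rw [Polynomial.eval_prod]; exact Finset.prod_eq_zero hm (by simp)
    simp [e1, show r.eval t0 = 0 from ht0]
  · rw [hr]; simp [show r.eval t0 = 0 from ht0]

noncomputable def RP (c d : Fin 10 → F) : Polynomial F :=
  ((Polynomial.C (c 5) + Polynomial.C (c 8) * Polynomial.X) * (Polynomial.C (d 0) + Polynomial.C (d 1) * Polynomial.X + Polynomial.C (d 3) * Polynomial.X^2)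
    - (Polynomial.C (d 5) + Polynomial.C (d 8) * Polynomial.X) * (Polynomial.C (c 0) + Polynomial.C (c 1) * Polynomial.X + Polynomial.C (c 3) * Polynomial.X^2))^2
  - ((Polynomial.C (c 5) + Polynomial.C (c 8) * Polynomial.X) * (Polynomial.C (d 2) + Polynomial.C (d 4) * Polynomial.X + Polynomial.C (d 7) * Polynomial.X^2)
    - (Polynomial.C (d 5) + Polynomial.C (d 8) * Polynomial.X) * (Polynomial.C (c 2) + Polynomial.C (c 4) * Polynomial.X + Polynomial.C (c 7) * Polynomial.X^2))
   * ((Polynomial.C (c 2) + Polynomial.C (c 4) * Polynomial.X + Polynomial.C (c 7) * Polynomial.X^2) * (Polynomial.C (d 0) + Polynomial.C (d 1) * Polynomial.X + Polynomial.C (d 3) * Polynomial.X^2)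
    - (Polynomial.C (d 2) + Polynomial.C (d 4) * Polynomial.X + Polynomial.C (d 7) * Polynomial.X^2) * (Polynomial.C (c 0) + Polynomial.C (c 1) * Polynomial.X + Polynomial.C (c 3) * Polynomial.X^2))

lemma RP_deg (c d : Fin 10 → F) : (RP c d).natDegree ≤ 7 := by
  unfold RP
  compute_degree

lemma RP_coeff (c d : Fin 10 → F) : (RP c d).coeff 7 =
    -((c 8 * d 7 - d 8 * c 7) * (c 7 * d 3 - d 7 * c 3)) := by
  unfold RP
  compute_degree
  all_goals norm_num

lemma ext3 {s t : Fin 3 → F} (h0 : s 0 = t 0) (h1 : s 1 = t 1) (h2 : s 2 = t 2) : s = t := by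
  ext i; fin_cases i
  · exact h0
  · exact h1
  · exact h2

lemma x_ne {v : Fin 8 → Fin 3 → F} (h : ∀ i j k, i ≠ j → i ≠ k → j ≠ k → Ind3 (v i) (v j) (v k))
    (v6 : v 6 = ![0,1,0]) (v7 : v 7 = ![0,0,1]) : ∀ i : Fin 8, i ≠ 6 → i ≠ 7 → v i 0 ≠ 0 := by
  intro i i6 i7 h0
  have := h i 6 7 i6 i7 (by decide) 1 (-v i 1) (-v i 2) (by
    rw [v6, v7]
    apply ext3 <;> simp only [Pi.add_apply, Pi.smul_apply, smul_eq_mul, Pi.zero_apply, Matrix.cons_val, h0] <;>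
      ring)
  simpa using this.1

lemma t_inj {v : Fin 8 → Fin 3 → F} (h : ∀ i j k, i ≠ j → i ≠ k → j ≠ k → Ind3 (v i) (v j) (v k))
    (v6 : v 6 = ![0,1,0]) (v7 : v 7 = ![0,0,1]) : ∀ i j : Fin 8, (i ≠ 6 ∧ i ≠ 7) → (j ≠ 6 ∧ j ≠ 7) →
      v i 1 / v i 0 = v j 1 / v j 0 → i = j := by
  intro i j hi hj hij
  by_contra hne
  have hi0 := x_ne h v6 v7 i hi.1 hi.2
  have hj0 := x_ne h v6 v7 j hj.1 hj.2
  rw [div_eq_div_iff hi0 hj0] at hij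
  have := h i j 7 hne hi.2 hj.2 (v j 0) (-v i 0) (-(v j 0 * v i 2 - v i 0 * v j 2)) (by
    rw [v7]; apply ext3 <;> simp
    · ring
    · linear_combination hij
    · ring)
  exact hj0 this.1

lemma sng_of_grad (c : Fin 10 → F) (x y z : F) (h0 : cubv c x y z = 0)
    (hx : 3*c 0*x^2+2*c 1*x*y+2*c 2*x*z+c 3*y^2+c 4*y*z+c 5*z^2 = 0)
    (hy : c 1*x^2+2*c 3*x*y+c 4*x*z+3*c 6*y^2+2*c 7*y*z+c 8*z^2 = 0)
    (hz : c 2*x^2+c 4*x*y+2*c 5*x*z+c 7*y^2+2*c 8*y*z+3*c 9*z^2 = 0)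
    (v : Fin 3 → F) (v0 : v 0 = x) (v1 : v 1 = y) (v2 : v 2 = z) :
    Sng (fun s => cubv c (s 0) (s 1) (s 2)) v := by
  intro w
  refine ⟨(3*c 0*(w 0)^2+2*c 1*(w 0)*(w 1)+2*c 2*(w 0)*(w 2)+c 3*(w 1)^2+c 4*(w 1)*(w 2)+c 5*(w 2)^2) * x
    + (c 1*(w 0)^2+2*c 3*(w 0)*(w 1)+c 4*(w 0)*(w 2)+3*c 6*(w 1)^2+2*c 7*(w 1)*(w 2)+c 8*(w 2)^2) * y
    + (c 2*(w 0)^2+c 4*(w 0)*(w 1)+2*c 5*(w 0)*(w 2)+c 7*(w 1)^2+2*c 8*(w 1)*(w 2)+3*c 9*(w 2)^2) * z,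
    cubv c (w 0) (w 1) (w 2), fun s => ?_⟩
  simp only [Pi.add_apply, Pi.smul_apply, smul_eq_mul, v0, v1, v2]
  simp only [cubv] at h0 ⊢
  linear_combination h0 + s * w 0 * hx + s * w 1 * hy + s * w 2 * hz

lemma cubv_comb (c d : Fin 10 → F) (a b x y z : F) :
    cubv (a • c + b • d) x y z = a * cubv c x y z + b * cubv d x y z := by
  simp only [cubv, Pi.add_apply, Pi.smul_apply, smul_eq_mul]; ring

lemma comb_ok [Finite F] (h2 : (2 : F) ≠ 0) {v : Fin 8 → Fin 3 → F} (h : GP v) (c d : Fin 10 → F)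
    (hc : ∀ i, cubv c (v i 0) (v i 1) (v i 2) = 0) (hd : ∀ i, cubv d (v i 0) (v i 1) (v i 2) = 0)
    (hi : ∀ a b : F, a • c + b • d = 0 → a = 0 ∧ b = 0) (a b : F) (hab : a ≠ 0 ∨ b ≠ 0) :
    NL (fun s => cubv (a • c + b • d) (s 0) (s 1) (s 2)) ∧
    ∀ i, ¬ Sng (fun s => cubv (a • c + b • d) (s 0) (s 1) (s 2)) (v i) := by
  have hC : IsCub (fun s => cubv (a • c + b • d) (s 0) (s 1) (s 2)) := ⟨_, fun s => rfl⟩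
  have hz : ∀ i, cubv (a • c + b • d) (v i 0) (v i 1) (v i 2) = 0 := fun i => by
    rw [cubv_comb, hc, hd]; simp
  have hn : ¬ ∀ s : Fin 3 → F, cubv (a • c + b • d) (s 0) (s 1) (s 2) = 0 := by
    intro h0
    have := hi a b (cub_zero h2 fun x y z => by simpa using h0 ![x, y, z])
    tauto
  exact ⟨cub_nl h2 h hC hz hn, fun i hs => hn (h.2.2 _ hC hz i hs)⟩

/-- existence of the ninth base point -/
lemma base_pt [Finite F] (h2 : (2 : F) ≠ 0) {v : Fin 8 → Fin 3 → F} (h : GP v)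
    (v6 : v 6 = ![0,1,0]) (v7 : v 7 = ![0,0,1]) (c d : Fin 10 → F)
    (hc : ∀ i, cubv c (v i 0) (v i 1) (v i 2) = 0) (hd : ∀ i, cubv d (v i 0) (v i 1) (v i 2) = 0)
    (hi : ∀ a b : F, a • c + b • d = 0 → a = 0 ∧ b = 0) :
    ∃ t z, cubv c 1 t z = 0 ∧ cubv d 1 t z = 0 ∧ ∀ i, v i 0 = 0 ∨ v i 1 ≠ t * v i 0 := by
  classical
  have ok := comb_ok h2 h c d hc hd hi
  have c6 : c 6 = 0 := by simpa [cubv, v6] using hc 6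
  have d6 : d 6 = 0 := by simpa [cubv, v6] using hd 6
  have c9 : c 9 = 0 := by simpa [cubv, v7] using hc 7
  have d9 : d 9 = 0 := by simpa [cubv, v7] using hd 7
  -- no combination has both pairs proportional
  have two : ∀ x y x' y' : F, x * y' - x' * y = 0 → ∃ a b : F, (a ≠ 0 ∨ b ≠ 0) ∧ a * x + b * x' = 0 ∧
      a * y + b * y' = 0 := by
    intro x y x' y' e
    by_cases hx : x = 0 ∧ x' = 0
    · by_cases hy : y = 0 ∧ y' = 0
      · exact ⟨1, 0, by simp, by simp [hx], by simp [hy]⟩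
      · refine ⟨y', -y, ?_, by simp [hx], by ring⟩
        by_contra! hh; exact hy ⟨by simpa using hh.2, hh.1⟩
    · refine ⟨x', -x, ?_, by ring, by linear_combination -e⟩
      by_contra! hh; exact hx ⟨by simpa using hh.2, hh.1⟩
  -- transversality at v 7
  have g7 : c 5 * d 8 - d 5 * c 8 ≠ 0 := by
    intro e
    obtain ⟨a, b, hab, e1, e2⟩ := two _ _ _ _ e
    refine (ok a b hab).2 7 (sng_of_grad _ 0 0 1 ?_ ?_ ?_ ?_ _ ?_ ?_ ?_) <;>
      simp [cubv, v7, c9, d9, e1, e2]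
  have g6 : c 7 * d 3 - d 7 * c 3 ≠ 0 := by
    intro e
    obtain ⟨a, b, hab, e1, e2⟩ := two _ _ _ _ e
    refine (ok a b hab).2 6 (sng_of_grad _ 0 1 0 ?_ ?_ ?_ ?_ _ ?_ ?_ ?_) <;>
      simp [cubv, v6, c6, d6, e1, e2]
  have l67 : c 8 * d 7 - d 8 * c 7 ≠ 0 := by
    intro e
    obtain ⟨a, b, hab, e1, e2⟩ := two _ _ _ _ e
    refine (ok a b hab).1 ![0,1,0] ![0,0,1] ?_ ?_
    · intro x y hxy
      have e0 := congrFun hxy 1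
      have e2 := congrFun hxy 2
      simp at e0 e2
      exact ⟨e0, e2⟩
    · intro x y
      simp [cubv, c6, d6, c9, d9, e1, e2]
  -- lines through v 7
  have lin : ∀ t, (c 5 + c 8 * t) * (d 2 + d 4 * t + d 7 * t^2)
      - (d 5 + d 8 * t) * (c 2 + c 4 * t + c 7 * t^2) = 0 →
      (c 5 + c 8 * t) * (d 0 + d 1 * t + d 3 * t^2)
      - (d 5 + d 8 * t) * (c 0 + c 1 * t + c 3 * t^2) = 0 → False := by
    intro t hW hA
    have hne : (d 5 + d 8 * t) ≠ 0 ∨ -(c 5 + c 8 * t) ≠ 0 := by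
      by_contra! hh
      apply g7
      linear_combination -d 8 * hh.2 - c 8 * hh.1
    refine (ok _ _ hne).1 ![1,t,0] ![0,0,1] ?_ ?_
    · intro x y hxy
      have e0 := congrFun hxy 0
      have e2 := congrFun hxy 2
      simp at e0 e2
      exact ⟨e0, e2⟩
    · intro x y
      simp [cubv, c6, d6, c9, d9]
      linear_combination (-x^2*y) * hW - x^3 * hA
  -- the six other points
  have hx := x_ne h.1 v6 v7
  set I : Finset (Fin 8) := {0,1,2,3,4,5} with hI
  have hI' : ∀ i, i ∈ I ↔ i ≠ 6 ∧ i ≠ 7 := by rw [hI]; decide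
  set S : Finset F := I.image (fun i => v i 1 / v i 0) with hSdef
  have hScard : S.card = 6 := by
    rw [hSdef, Finset.card_image_of_injOn]
    · rfl
    · intro i hi j hj hij
      rw [Finset.mem_coe, hI'] at hi hj
      exact t_inj h.1 v6 v7 i j hi hj hij
  obtain ⟨t, htS, ht⟩ := poly_root (RP c d) (RP_deg c d) (by
      rw [RP_coeff]; exact neg_ne_zero.2 (mul_ne_zero l67 g6)) S hScard (by
    intro t ht
    rw [hSdef, Finset.mem_image] at ht
    obtain ⟨i, hiI, rfl⟩ := ht
    rw [hI'] at hiI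
    have hi0 := hx i hiI.1 hiI.2
    set t := v i 1 / v i 0 with ht
    set s := v i 2 / v i 0 with hs
    have hom : ∀ c : Fin 10 → F, cubv c (v i 0) (v i 1) (v i 2) = (v i 0)^3 * cubv c 1 t s := by
      intro c; rw [ht, hs]; simp only [cubv]; field_simp
    have fc : cubv c 1 t s = 0 := by
      have := hc i; rw [hom] at this
      exact (mul_eq_zero.1 this).resolve_left (pow_ne_zero _ hi0)
    have fd : cubv d 1 t s = 0 := by
      have := hd i; rw [hom] at this
      exact (mul_eq_zero.1 this).resolve_left (pow_ne_zero _ hi0)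
    have kc : c 0 + c 1 * t + c 3 * t^2 = -(s^2 * (c 5 + c 8 * t) + s * (c 2 + c 4 * t + c 7 * t^2)) := by
      simp only [cubv, c6, c9] at fc; linear_combination fc
    have kd : d 0 + d 1 * t + d 3 * t^2 = -(s^2 * (d 5 + d 8 * t) + s * (d 2 + d 4 * t + d 7 * t^2)) := by
      simp only [cubv, d6, d9] at fd; linear_combination fd
    have hW : (c 5 + c 8 * t) * (d 2 + d 4 * t + d 7 * t^2)
      - (d 5 + d 8 * t) * (c 2 + c 4 * t + c 7 * t^2) ≠ 0 := by
      intro hW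
      refine lin t hW ?_
      rw [kc, kd]
      linear_combination -s * hW
    have hJ : (s^2 * c 8 + s * (c 4 + 2 * c 7 * t) + (c 1 + 2 * c 3 * t)) *
          (2 * (d 5 + d 8 * t) * s + (d 2 + d 4 * t + d 7 * t^2))
        - (s^2 * d 8 + s * (d 4 + 2 * d 7 * t) + (d 1 + 2 * d 3 * t)) *
          (2 * (c 5 + c 8 * t) * s + (c 2 + c 4 * t + c 7 * t^2)) ≠ 0 := by
      intro e
      obtain ⟨a, b, hab, e1, e2⟩ := two _ _ _ _ e
      have eq0 : Sng (fun s => cubv (a • c + b • d) (s 0) (s 1) (s 2)) ![1, t, s] := by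
        have q0 : cubv (a • c + b • d) 1 t s = 0 := by rw [cubv_comb, fc, fd]; ring
        have q1 := q0
        simp only [cubv, Pi.add_apply, Pi.smul_apply, smul_eq_mul] at q1
        refine sng_of_grad _ 1 t s q0 ?_ ?_ ?_ _ ?_ ?_ ?_
        · simp only [Pi.add_apply, Pi.smul_apply, smul_eq_mul, c6, d6, c9, d9] at q1 ⊢
          linear_combination 3 * q1 - t * e1 - s * e2
        · simp only [Pi.add_apply, Pi.smul_apply, smul_eq_mul, c6, d6]
          linear_combination e1
        · simp only [Pi.add_apply, Pi.smul_apply, smul_eq_mul, c9, d9]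
          linear_combination e2
        · simp
        · simp
        · simp
      refine (ok a b hab).2 i ?_
      have hvi : v i = v i 0 • ![1, t, s] := by
        rw [ht, hs]; ext k; fin_cases k <;> simp <;> field_simp
      intro w
      obtain ⟨x, y, hxy⟩ := eq0 ((v i 0)⁻¹ • w)
      refine ⟨(v i 0)^3 * x, (v i 0)^3 * y, fun r => ?_⟩
      have e3 : v i + r • w = v i 0 • (![1, t, s] + r • ((v i 0)⁻¹ • w)) := by
        rw [smul_add, ← hvi]; congr 1
        ext k; simp; field_simp
      have hom' : ∀ (c : Fin 10 → F) (k : F) (u : Fin 3 → F), cubv c ((k • u) 0) ((k • u) 1) ((k • u) 2)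
          = k^3 * cubv c (u 0) (u 1) (u 2) := by
        intro c k u; simp only [cubv, Pi.smul_apply, smul_eq_mul]; ring
      rw [e3]
      have := hxy r
      beta_reduce at this ⊢
      rw [hom', this]; ring
    constructor
    · simp [RP]
      rw [kc, kd]; ring
    · have : (RP c d).derivative.eval t = ((c 5 + c 8 * t) * (d 2 + d 4 * t + d 7 * t^2)
      - (d 5 + d 8 * t) * (c 2 + c 4 * t + c 7 * t^2)) * ((s^2 * c 8 + s * (c 4 + 2 * c 7 * t) + (c 1 + 2 * c 3 * t)) *
          (2 * (d 5 + d 8 * t) * s + (d 2 + d 4 * t + d 7 * t^2))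
        - (s^2 * d 8 + s * (d 4 + 2 * d 7 * t) + (d 1 + 2 * d 3 * t)) *
          (2 * (c 5 + c 8 * t) * s + (c 2 + c 4 * t + c 7 * t^2))) := by
        simp [RP, Polynomial.derivative_pow]
        rw [kc, kd]; ring
      rw [this]; exact mul_ne_zero hW hJ)
  have hR : ((c 5 + c 8 * t) * (d 0 + d 1 * t + d 3 * t^2)
      - (d 5 + d 8 * t) * (c 0 + c 1 * t + c 3 * t^2))^2
    - ((c 5 + c 8 * t) * (d 2 + d 4 * t + d 7 * t^2)
      - (d 5 + d 8 * t) * (c 2 + c 4 * t + c 7 * t^2)) *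
     ((c 2 + c 4 * t + c 7 * t^2) * (d 0 + d 1 * t + d 3 * t^2)
      - (d 2 + d 4 * t + d 7 * t^2) * (c 0 + c 1 * t + c 3 * t^2)) = 0 := by
    simpa [RP] using ht
  have hnew : ∀ i, v i 0 = 0 ∨ v i 1 ≠ t * v i 0 := by
    intro i
    by_contra! hh
    apply htS
    rw [hSdef, Finset.mem_image]
    refine ⟨i, ?_, ?_⟩
    · rw [hI']
      constructor
      · rintro rfl; rw [v6] at hh; simp at hh
      · rintro rfl; rw [v7] at hh; simp at hh
    · rw [hh.2]; field_simp [hh.1]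
  have ec : ∀ z, cubv c 1 t z = (c 5 + c 8 * t) * z^2 + (c 2 + c 4 * t + c 7 * t^2) * z
      + (c 0 + c 1 * t + c 3 * t^2) := by
    intro z; simp only [cubv, c6, c9]; ring
  have ed : ∀ z, cubv d 1 t z = (d 5 + d 8 * t) * z^2 + (d 2 + d 4 * t + d 7 * t^2) * z
      + (d 0 + d 1 * t + d 3 * t^2) := by
    intro z; simp only [cubv, d6, d9]; ring
  have lint := lin t
  generalize c 5 + c 8 * t = L1 at *
  generalize c 2 + c 4 * t + c 7 * t^2 = Q1 at *
  generalize c 0 + c 1 * t + c 3 * t^2 = K1 at *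
  generalize d 5 + d 8 * t = L2 at *
  generalize d 2 + d 4 * t + d 7 * t^2 = Q2 at *
  generalize d 0 + d 1 * t + d 3 * t^2 = K2 at *
  by_cases hW : L1 * Q2 - L2 * Q1 = 0
  · exfalso
    refine lint hW ?_
    rw [hW] at hR
    simpa using hR
  · refine ⟨t, -(L1 * K2 - L2 * K1) / (L1 * Q2 - L2 * Q1), ?_, ?_, hnew⟩
    · rw [ec]; field_simp
      linear_combination L1 * hR
    · rw [ed]; field_simp
      linear_combination L2 * hR

end S16c


section S16d
variable {F : Type*} [Field F]

lemma normalize8 [Finite F] {v : Fin 8 → Fin 3 → F}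
    (h : ∀ i j k, i ≠ j → i ≠ k → j ≠ k → Ind3 (v i) (v j) (v k)) :
    ∃ v' : Fin 8 → Fin 3 → F, (∀ i j k, i ≠ j → i ≠ k → j ≠ k → Ind3 (v' i) (v' j) (v' k)) ∧
      v' 6 = ![0,1,0] ∧ v' 7 = ![0,0,1] ∧ (GP v → GP v') := by
  have he := h 5 6 7 (by decide) (by decide) (by decide)
  obtain ⟨v', hv'⟩ : ∃ v' : Fin 8 → Fin 3 → F, ∀ i, sub3 (v 5) (v 6) (v 7) (v' i) = v i :=
    ⟨fun i => ((sub3_bij he).2 (v i)).choose, fun i => ((sub3_bij he).2 (v i)).choose_spec⟩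
  refine ⟨v', ?_, ?_, ?_, fun hg => GP_comp hg he v' hv'⟩
  · intro i j k hij hik hjk x y z hz
    refine h i j k hij hik hjk x y z ?_
    rw [← hv' i, ← hv' j, ← hv' k, ← sub3_smul, ← sub3_smul, ← sub3_smul, ← sub3_add, ← sub3_add,
      hz, sub3_zero]
  · apply sub3_inj he; rw [hv']; simp [sub3]
  · apply sub3_inj he; rw [hv']; simp [sub3]

lemma small_q [Fintype F] (hq : Fintype.card F < 6) {v : Fin 8 → Fin 3 → F}
    (h : ∀ i j k, i ≠ j → i ≠ k → j ≠ k → Ind3 (v i) (v j) (v k)) : False := by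
  obtain ⟨v', h', v6, v7, -⟩ := normalize8 h
  have hh : ∀ i : Fin 6, (Fin.castLE (by norm_num) i : Fin 8) ≠ 6 ∧
    (Fin.castLE (by norm_num) i : Fin 8) ≠ 7 := by decide
  have hinj : Function.Injective (fun i : Fin 6 =>
      v' (Fin.castLE (by norm_num) i) 1 / v' (Fin.castLE (by norm_num) i) 0) := by
    intro i j hij
    have := t_inj h' v6 v7 _ _ (hh i) (hh j) hij
    exact Fin.castLE_injective _ this
  have := Fintype.card_le_of_injective _ hinj
  simp at this
  omega

lemma pencil_count [Fintype F] [DecidableEq F] (f g : (Fin 3 → F) → F) (M n : ℕ)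
    (hM : ∀ a b : F, (a ≠ 0 ∨ b ≠ 0) → cnt (fun s => a * f s + b * g s) ≤ M)
    (hn : n ≤ (Finset.univ.filter fun s => f s = 0 ∧ g s = 0).card) :
    Fintype.card F * Fintype.card F ^ 3 + (Fintype.card F ^ 2 - Fintype.card F) * n
      ≤ Fintype.card F ^ 3 + (Fintype.card F ^ 2 - 1) * M := by
  set q := Fintype.card F with hq
  have hq1 : 1 ≤ q := Fintype.card_pos
  have swap : ∑ x : F × F, cnt (fun s => x.1 * f s + x.2 * g s)
      = ∑ s : Fin 3 → F, (Finset.univ.filter fun x : F × F => x.1 * f s + x.2 * g s = 0).card := by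
    simp only [cnt, Finset.card_filter]
    exact Finset.sum_comm
  have up : ∑ x : F × F, cnt (fun s => x.1 * f s + x.2 * g s) ≤ q^3 + (q^2 - 1) * M := by
    rw [← Finset.add_sum_erase _ _ (Finset.mem_univ ((0:F),(0:F)))]
    apply Nat.add_le_add
    · refine (Finset.card_le_univ _).trans ?_
      simp [hq]
    · refine (Finset.sum_le_card_nsmul _ _ M ?_).trans ?_
      · rintro ⟨a, b⟩ hab
        simp only [Finset.mem_erase, ne_eq, Prod.mk.injEq, Finset.mem_univ, and_true] at hab
        exact hM a b (by tauto)
      · rw [Finset.card_erase_of_mem (Finset.mem_univ _)]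
        simp [hq, sq]
  have lo : ∀ s : Fin 3 → F, q + (if f s = 0 ∧ g s = 0 then q^2 - q else 0)
      ≤ (Finset.univ.filter fun x : F × F => x.1 * f s + x.2 * g s = 0).card := by
    intro s
    split_ifs with h0
    · simp [h0.1, h0.2, ← hq]
      rw [← sq]
      have : q ≤ q^2 := by nlinarith
      omega
    · rw [add_zero, hq, ← Finset.card_univ]
      apply Finset.card_le_card_of_injOn (fun r => (r * g s, - (r * f s)))
      · intro r _
        simp; ring
      · intro r _ r' _ hrr
        simp only [Prod.mk.injEq, neg_inj] at hrr
        by_cases hf : f s = 0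
        · have hg : g s ≠ 0 := fun hg => h0 ⟨hf, hg⟩
          exact mul_right_cancel₀ hg hrr.1
        · exact mul_right_cancel₀ hf hrr.2
  have lo2 := Finset.sum_le_sum (fun s (_ : s ∈ Finset.univ) => lo s)
  rw [← swap, Finset.sum_add_distrib, ← Finset.sum_filter, Finset.sum_const, Finset.sum_const] at lo2
  simp only [Finset.card_univ, Fintype.card_fun, Fintype.card_fin, smul_eq_mul, ← hq] at lo2
  have : (q^2 - q) * n ≤ (Finset.univ.filter fun s => f s = 0 ∧ g s = 0).card * (q^2 - q) := by
    rw [mul_comm]; exact Nat.mul_le_mul_right _ hn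
  rw [mul_comm q]
  omega

lemma base_count [Fintype F] [DecidableEq F] (Z : Finset (Fin 3 → F)) (h0 : 0 ∈ Z)
    {ι : Type} [Fintype ι] (P : ι → Fin 3 → F) (hP0 : ∀ i, P i ≠ 0) (hP : ∀ i j, i ≠ j → Ind2 (P i) (P j))
    (hZ : ∀ i, ∀ a : F, a • P i ∈ Z) : 1 + Fintype.card ι * (Fintype.card F - 1) ≤ Z.card := by
  have h1 : Fintype.card ι * (Fintype.card F - 1) =
      ((Finset.univ : Finset ι) ×ˢ (Finset.univ.erase (0:F))).card := by
    rw [Finset.card_product, Finset.card_erase_of_mem (Finset.mem_univ _)]; rfl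
  have h2 : ((Finset.univ : Finset ι) ×ˢ (Finset.univ.erase (0:F))).card ≤ (Z.erase 0).card := by
    apply Finset.card_le_card_of_injOn (fun x => x.2 • P x.1)
    · rintro ⟨i, a⟩ hx
      simp at hx
      simp [hx, hP0, hZ]
    · rintro ⟨i, a⟩ hx ⟨j, b⟩ hy hxy
      simp at hx hy hxy
      by_cases hij : i = j
      · subst hij
        have := smul_left_injective F (hP0 i) hxy
        rw [this]
      · exact absurd (hP i j hij a (-b) (by rw [hxy]; simp)).1 hx
  rw [Finset.card_erase_of_mem h0] at h2
  have : 0 < Z.card := Finset.card_pos.2 ⟨0, h0⟩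
  omega

def evL (v : Fin 8 → Fin 3 → F) : (Fin 10 → F) →ₗ[F] (Fin 8 → F) where
  toFun c i := cubv c (v i 0) (v i 1) (v i 2)
  map_add' c d := by ext i; simp only [cubv, Pi.add_apply]; ring
  map_smul' a c := by ext i; simp only [cubv, Pi.smul_apply, smul_eq_mul, RingHom.id_apply]; ring

lemma exists_pencil (v : Fin 8 → Fin 3 → F) : ∃ c d : Fin 10 → F,
    (∀ i, cubv c (v i 0) (v i 1) (v i 2) = 0) ∧ (∀ i, cubv d (v i 0) (v i 1) (v i 2) = 0) ∧
    (∀ a b : F, a • c + b • d = 0 → a = 0 ∧ b = 0) := by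
  have h1 := LinearMap.finrank_range_add_finrank_ker (evL v)
  have h2 : Module.finrank F (LinearMap.range (evL v)) ≤ 8 := by
    simpa using Submodule.finrank_le (LinearMap.range (evL v))
  rw [Module.finrank_fin_fun] at h1
  have h3 : 1 < Module.finrank F (LinearMap.ker (evL v)) := by omega
  have : Nontrivial (LinearMap.ker (evL v)) := Module.nontrivial_of_finrank_pos (by omega : 0 < Module.finrank F (LinearMap.ker (evL v)))
  obtain ⟨c, hc⟩ := exists_ne (0 : LinearMap.ker (evL v))
  obtain ⟨d, hd⟩ := exists_linearIndependent_pair_of_one_lt_finrank h3 hc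
  rw [LinearIndependent.pair_iff] at hd
  refine ⟨c.1, d.1, fun i => congrFun c.2 i, fun i => congrFun d.2 i, fun a b hab => hd a b ?_⟩
  exact Subtype.ext hab

lemma cubv_smul (c : Fin 10 → F) (k : F) (u : Fin 3 → F) :
    cubv c ((k • u) 0) ((k • u) 1) ((k • u) 2) = k^3 * cubv c (u 0) (u 1) (u 2) := by
  simp only [cubv, Pi.smul_apply, smul_eq_mul]; ring

lemma no_GP [Fintype F] [DecidableEq F] {B : ℕ} (hB : HB F B) (h2 : (2 : F) ≠ 0) (h3 : (3 : F) ≠ 0)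
    (num : Fintype.card F ^ 3 + (Fintype.card F ^ 2 - 1) *
        (1 + (Fintype.card F - 1) * (Fintype.card F + B + 1)) <
      Fintype.card F * Fintype.card F ^ 3 + (Fintype.card F ^ 2 - Fintype.card F) *
        (1 + 9 * (Fintype.card F - 1)))
    {v : Fin 8 → Fin 3 → F} (h : GP v) : False := by
  obtain ⟨w, -, w6, w7, hw⟩ := normalize8 h.1
  replace h := hw h
  obtain ⟨c, d, hc, hd, hi⟩ := exists_pencil w
  obtain ⟨t, z, zc, zd, hnew⟩ := base_pt h2 h w6 w7 c d hc hd hi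
  have ok := comb_ok h2 h c d hc hd hi
  have hw0 : ∀ i, w i ≠ 0 := by
    intro i h0
    obtain ⟨j, k, hij, hik, hjk⟩ : ∃ j k : Fin 8, i ≠ j ∧ i ≠ k ∧ j ≠ k := by
      clear h0; revert i; decide
    have := h.1 i j k hij hik hjk 1 0 0 (by rw [h0]; simp)
    simpa using this.1
  have hw2 : ∀ i j, i ≠ j → Ind2 (w i) (w j) := by
    intro i j hij a b hab
    obtain ⟨k, hik, hjk⟩ : ∃ k : Fin 8, i ≠ k ∧ j ≠ k := by
      clear hab; revert i j; decide
    have := h.1 i j k hij hik hjk a b 0 (by simpa using hab)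
    exact ⟨this.1, this.2.1⟩
  have hO : ∀ i, Ind2 ![1, t, z] (w i) := by
    intro i a b hab
    have e0 := congrFun hab 0
    have e1 := congrFun hab 1
    simp only [Pi.add_apply, Pi.smul_apply, smul_eq_mul, Pi.zero_apply, Matrix.cons_val] at e0 e1
    have hb : b = 0 := by
      by_contra hb
      rcases hnew i with h0 | h1
      · have ha : a = 0 := by simpa [h0] using e0
        have : b • w i = 0 := by simpa [ha] using hab
        exact hw0 i ((smul_eq_zero.1 this).resolve_left hb)
      · apply h1
        exact mul_left_cancel₀ hb (by linear_combination e1 - t * e0)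
    subst hb
    exact ⟨by simpa using e0, rfl⟩
  have hn := base_count (Finset.univ.filter fun s : Fin 3 → F =>
      cubv c (s 0) (s 1) (s 2) = 0 ∧ cubv d (s 0) (s 1) (s 2) = 0)
    (by rw [Finset.mem_filter]; exact ⟨Finset.mem_univ _, by simp [cubv], by simp [cubv]⟩)
    (fun o : Option (Fin 8) => o.elim ![1, t, z] w)
    (by
      rintro (_ | i)
      · intro h0; simpa using congrFun h0 0
      · exact hw0 i)
    (by
      rintro (_ | i) (_ | j) hij
      · exact absurd rfl hij
      · exact hO j
      · intro a b hab
        have := hO i b a (by rw [add_comm]; exact hab)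
        exact ⟨this.2, this.1⟩
      · exact hw2 i j (by simpa using hij))
    (by
      intro i a
      rw [Finset.mem_filter]
      refine ⟨Finset.mem_univ _, ?_, ?_⟩ <;> rw [cubv_smul]
      · rcases i with _ | i
        · simp [zc]
        · simp [hc]
      · rcases i with _ | i
        · simp [zd]
        · simp [hd])
  have key := pencil_count _ _ (1 + (Fintype.card F - 1) * (Fintype.card F + B + 1)) _ (by
    intro a b hab
    obtain ⟨hnl, hs⟩ := ok a b hab
    have hz : cubv (a • c + b • d) 0 1 0 = 0 := by
      have e1 := hc 6
      have e2 := hd 6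
      rw [w6] at e1 e2
      simp only [Matrix.cons_val] at e1 e2
      rw [cubv_comb, e1, e2]; simp
    have := hasse hB h2 h3 (a • c + b • d) hz (by rw [← w6]; exact hs 6) hnl
    simpa only [cubv_comb] using this) hn
  simp only [Fintype.card_option, Fintype.card_fin] at key
  norm_num at key num
  omega

/-- polynomials from coefficients -/
noncomputable def cubP (c : Fin 10 → F) : MvPolynomial (Fin 3) F :=
  C (c 0) * (X 0 * X 0 * X 0) + C (c 1) * (X 0 * X 0 * X 1) + C (c 2) * (X 0 * X 0 * X 2)
  + C (c 3) * (X 0 * X 1 * X 1) + C (c 4) * (X 0 * X 1 * X 2) + C (c 5) * (X 0 * X 2 * X 2)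
  + C (c 6) * (X 1 * X 1 * X 1) + C (c 7) * (X 1 * X 1 * X 2) + C (c 8) * (X 1 * X 2 * X 2)
  + C (c 9) * (X 2 * X 2 * X 2)

noncomputable def quadP (c : Fin 6 → F) : MvPolynomial (Fin 3) F :=
  C (c 0) * (X 0 * X 0) + C (c 1) * (X 0 * X 1) + C (c 2) * (X 0 * X 2)
  + C (c 3) * (X 1 * X 1) + C (c 4) * (X 1 * X 2) + C (c 5) * (X 2 * X 2)

lemma mon3 (a : F) (i j k : Fin 3) : (C a * (X i * X j * X k) : MvPolynomial (Fin 3) F).IsHomogeneous 3 :=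
  (isHomogeneous_C _ _).mul (((isHomogeneous_X _ i).mul (isHomogeneous_X _ j)).mul (isHomogeneous_X _ k))
lemma mon2 (a : F) (i j : Fin 3) : (C a * (X i * X j) : MvPolynomial (Fin 3) F).IsHomogeneous 2 :=
  (isHomogeneous_C _ _).mul ((isHomogeneous_X _ i).mul (isHomogeneous_X _ j))

lemma cubP_hom (c : Fin 10 → F) : (cubP c).IsHomogeneous 3 := by
  unfold cubP
  repeat' apply IsHomogeneous.add
  all_goals apply mon3
lemma quadP_hom (c : Fin 6 → F) : (quadP c).IsHomogeneous 2 := by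
  unfold quadP
  repeat' apply IsHomogeneous.add
  all_goals apply mon2
lemma cubP_eval (c : Fin 10 → F) (s : Fin 3 → F) : eval s (cubP c) = cubv c (s 0) (s 1) (s 2) := by
  simp [cubP, cubv]; ring
lemma quadP_eval (c : Fin 6 → F) (s : Fin 3 → F) : eval s (quadP c) = quadv c (s 0) (s 1) (s 2) := by
  simp [quadP, quadv]; ring

lemma lin_coeff (h2 : (2 : F) ≠ 0) (h3 : (3 : F) ≠ 0) (a b c0 c1 c2 c3 : F)
    (h : ∀ s : F, c0 + c1 * s + c2 * s^2 + c3 * s^3 = a * s^2 + b * s^3) : c1 = 0 := by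
  have e0 := h 0
  have e1 := h 1
  have e2 := h (-1)
  have e3 := h 2
  have h6 : (6 : F) ≠ 0 := by
    have : (6 : F) = 2 * 3 := by norm_num
    rw [this]; exact mul_ne_zero h2 h3
  have : 6 * c1 = 0 := by
    ring_nf at e0 e1 e2 e3
    linear_combination 6 * e1 - 2 * e2 - e3 - 3 * e0
  exact (mul_eq_zero.1 this).resolve_left h6

lemma pderiv_zero (h2 : (2 : F) ≠ 0) (h3 : (3 : F) ≠ 0) (c : Fin 10 → F) (v : Fin 3 → F)
    (hs : Sng (fun s => cubv c (s 0) (s 1) (s 2)) v) (t : Fin 3) : eval v (pderiv t (cubP c)) = 0 := by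
  fin_cases t
  · obtain ⟨a, b, hab⟩ := hs ![1,0,0]
    simp only [Pi.add_apply, Pi.smul_apply, smul_eq_mul, Matrix.cons_val] at hab
    rw [← lin_coeff h2 h3 a b (cubv c (v 0) (v 1) (v 2))
      (3*c 0*(v 0)^2+2*c 1*(v 0)*(v 1)+2*c 2*(v 0)*(v 2)+c 3*(v 1)^2+c 4*(v 1)*(v 2)+c 5*(v 2)^2)
      (3*c 0*(v 0)+c 1*(v 1)+c 2*(v 2)) (c 0) (fun s => by
        rw [← hab s]; simp only [cubv]; ring)]
    simp [cubP, pderiv_X]; ring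
  · obtain ⟨a, b, hab⟩ := hs ![0,1,0]
    simp only [Pi.add_apply, Pi.smul_apply, smul_eq_mul, Matrix.cons_val] at hab
    rw [← lin_coeff h2 h3 a b (cubv c (v 0) (v 1) (v 2))
      (c 1*(v 0)^2+2*c 3*(v 0)*(v 1)+c 4*(v 0)*(v 2)+3*c 6*(v 1)^2+2*c 7*(v 1)*(v 2)+c 8*(v 2)^2)
      (c 3*(v 0)+3*c 6*(v 1)+c 7*(v 2)) (c 6) (fun s => by
        rw [← hab s]; simp only [cubv]; ring)]
    simp [cubP, pderiv_X]; ring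
  · obtain ⟨a, b, hab⟩ := hs ![0,0,1]
    simp only [Pi.add_apply, Pi.smul_apply, smul_eq_mul, Matrix.cons_val] at hab
    rw [← lin_coeff h2 h3 a b (cubv c (v 0) (v 1) (v 2))
      (c 2*(v 0)^2+c 4*(v 0)*(v 1)+2*c 5*(v 0)*(v 2)+c 7*(v 1)^2+2*c 8*(v 1)*(v 2)+3*c 9*(v 2)^2)
      (c 5*(v 0)+c 8*(v 1)+3*c 9*(v 2)) (c 9) (fun s => by
        rw [← hab s]; simp only [cubv]; ring)]
    simp [cubP, pderiv_X]; ring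

lemma GP_of (h2 : (2 : F) ≠ 0) (h3 : (3 : F) ≠ 0) {v : Fin 8 → Fin 3 → F}
    (H1 : ∀ i j k, i ≠ j → i ≠ k → j ≠ k → Ind3 (v i) (v j) (v k))
    (H2 : ¬ ∃ F' : MvPolynomial (Fin 3) F, F'.IsHomogeneous 2 ∧ F' ≠ 0 ∧
      ∃ T : Finset (Fin 8), T.card = 6 ∧ ∀ i ∈ T, eval (v i) F' = 0)
    (H3 : ¬ ∃ F' : MvPolynomial (Fin 3) F, F'.IsHomogeneous 3 ∧ F' ≠ 0 ∧
      (∀ i : Fin 8, eval (v i) F' = 0) ∧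
      ∃ i : Fin 8, ∀ t : Fin 3, eval (v i) (pderiv t F') = 0) : GP v := by
  refine ⟨H1, ?_, ?_⟩
  · rintro g ⟨c, hc⟩ T hT hz s
    by_contra hs
    refine H2 ⟨quadP c, quadP_hom c, ?_, T, hT, fun i hi => ?_⟩
    · intro h0; apply hs; rw [hc, ← quadP_eval, h0]; simp
    · rw [quadP_eval, ← hc]; exact hz i hi
  · rintro f ⟨c, hc⟩ hz i hsn s
    by_contra hs
    refine H3 ⟨cubP c, cubP_hom c, ?_, fun i => ?_, i, fun t => pderiv_zero h2 h3 c _ ?_ t⟩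
    · intro h0; apply hs; rw [hc, ← cubP_eval, h0]; simp
    · rw [cubP_eval, ← hc]; exact hz i
    · rwa [show f = fun s => cubv c (s 0) (s 1) (s 2) from funext hc] at hsn

end S16d

lemma tw7 : (2 : ZMod 7) ≠ 0 ∧ (3 : ZMod 7) ≠ 0 := by decide
lemma tw11 : (2 : ZMod 11) ≠ 0 ∧ (3 : ZMod 11) ≠ 0 := by decide
lemma tw13 : (2 : ZMod 13) ≠ 0 ∧ (3 : ZMod 13) ≠ 0 := by decide

lemma hb7 : ∀ a b : ZMod 7, (Finset.univ.filter fun x : ZMod 7 × ZMod 7 =>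
    x.2^2 = x.1^3+a*x.1+b).card ≤ 7+5 := by decide +kernel
lemma hb11 : ∀ a b : ZMod 11, (Finset.univ.filter fun x : ZMod 11 × ZMod 11 =>
    x.2^2 = x.1^3+a*x.1+b).card ≤ 11+6 := by decide +kernel
lemma hb13 : ∀ a b : ZMod 13, (Finset.univ.filter fun x : ZMod 13 × ZMod 13 =>
    x.2^2 = x.1^3+a*x.1+b).card ≤ 13+7 := by decide +kernel

/-- For every prime `p < 17`, there do not exist eight points in general position in
`ℙ²(𝔽_p)`: for any eight pairwise non-proportional nonzero vectors in `𝔽_p³`, either three of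
them are linearly dependent, or a nonzero conic vanishes at six of them, or a nonzero cubic
vanishes at all eight of them and is singular at one of them. -/
theorem stmt16 (p : ℕ) (hp : p.Prime) (hlt : p < 17)
    (v : Fin 8 → Fin 3 → ZMod p)
    (hnz : ∀ i : Fin 8, v i ≠ 0)
    (hnp : ∀ i j : Fin 8, i ≠ j → ∀ c : ZMod p, v j ≠ c • v i) :
    (∃ i j k : Fin 8, i ≠ j ∧ i ≠ k ∧ j ≠ k ∧
      ∃ a b c : ZMod p, ¬(a = 0 ∧ b = 0 ∧ c = 0) ∧ a • v i + b • v j + c • v k = 0) ∨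
    (∃ F : MvPolynomial (Fin 3) (ZMod p), F.IsHomogeneous 2 ∧ F ≠ 0 ∧
      ∃ T : Finset (Fin 8), T.card = 6 ∧ ∀ i ∈ T, eval (v i) F = 0) ∨
    (∃ F : MvPolynomial (Fin 3) (ZMod p), F.IsHomogeneous 3 ∧ F ≠ 0 ∧
      (∀ i : Fin 8, eval (v i) F = 0) ∧
      ∃ i : Fin 8, ∀ t : Fin 3, eval (v i) (pderiv t F) = 0) := by
  by_contra hcon
  rw [not_or, not_or] at hcon
  obtain ⟨H1, H2, H3⟩ := hcon
  have : Fact p.Prime := ⟨hp⟩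
  have H1' : ∀ i j k, i ≠ j → i ≠ k → j ≠ k → Ind3 (v i) (v j) (v k) := by
    intro i j k hij hik hjk a b c habc
    by_contra hne
    exact H1 ⟨i, j, k, hij, hik, hjk, a, b, c, hne, habc⟩
  by_cases hs : p < 6
  · exact small_q (by rwa [ZMod.card]) H1'
  · have hG : (2 : ZMod p) ≠ 0 → (3 : ZMod p) ≠ 0 → GP v := fun h2 h3 => GP_of h2 h3 H1' H2 H3
    have hcases : p = 7 ∨ p = 11 ∨ p = 13 := by
      interval_cases p <;> first | omega | (exfalso; revert hp; norm_num)
    rcases hcases with rfl | rfl | rfl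
    · have h2 : (2 : ZMod 7) ≠ 0 := tw7.1
      have h3 : (3 : ZMod 7) ≠ 0 := tw7.2
      exact no_GP (B := 5) (fun a b => by rw [ZMod.card]; convert hb7 a b) h2 h3
        (by rw [ZMod.card]; norm_num) (hG h2 h3)
    · have h2 : (2 : ZMod 11) ≠ 0 := tw11.1
      have h3 : (3 : ZMod 11) ≠ 0 := tw11.2
      exact no_GP (B := 6) (fun a b => by rw [ZMod.card]; convert hb11 a b) h2 h3
        (by rw [ZMod.card]; norm_num) (hG h2 h3)
    · have h2 : (2 : ZMod 13) ≠ 0 := tw13.1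
      have h3 : (3 : ZMod 13) ≠ 0 := tw13.2
      exact no_GP (B := 7) (fun a b => by rw [ZMod.card]; convert hb13 a b) h2 h3
        (by rw [ZMod.card]; norm_num) (hG h2 h3)
end

section
/- The eight points of the projective plane over F_19 represented by the vectors P_1 = (0,1,1), P_2 = (0,1,2), P_3 = (1,0,1), P_4 = (1,0,4), P_5 = (1,1,1), P_6 = (1,1,16), P_7 = (7,1,18), P_8 = (7,1,16) are in general position: they are pairwise non-proportional, no three of the vectors are linearly dependent, there is no nonzero homogeneous polynomial of degree 2 over F_19 in three variables vanishing at six of them, and there is no nonzero homogeneous polynomial F of degree 3 over F_19 in three variables vanishing at all eight of them with all three partial derivatives of F vanishing at one of them. -/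
open MvPolynomial

/-- The eight points over `𝔽₁₉`. -/
def Pv : Fin 8 → Fin 3 → ZMod 19 :=
  ![![0, 1, 1], ![0, 1, 2], ![1, 0, 1], ![1, 0, 4],
    ![1, 1, 1], ![1, 1, 16], ![7, 1, 18], ![7, 1, 16]]

theorem homog_sum (n : ℕ) (F : MvPolynomial (Fin 3) (ZMod 19)) (h : F.IsHomogeneous n) :
    ∃ a : (Fin 3 → ℕ) → ZMod 19, F = ∑ d ∈ Finset.Nat.antidiagonalTuple 3 n,
      C (a d) * (X 0 ^ d 0 * X 1 ^ d 1 * X 2 ^ d 2) := by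
  refine ⟨fun d => coeff (Finsupp.equivFunOnFinite.symm d) F, ?_⟩
  have key : ∀ d : Fin 3 → ℕ, ∀ c : ZMod 19,
      C c * (X 0 ^ d 0 * X 1 ^ d 1 * X 2 ^ d 2 : MvPolynomial (Fin 3) (ZMod 19)) =
      monomial (Finsupp.equivFunOnFinite.symm d) c := by
    intro d c
    rw [monomial_eq, Finsupp.prod_fintype _ _ (by simp), Fin.prod_univ_three]
    simp
  simp only [key]
  ext m
  rw [coeff_sum]
  simp only [coeff_monomial]
  by_cases hm : coeff m F = 0
  · rw [hm, Finset.sum_eq_zero]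
    intro d _
    split_ifs with hd
    · rw [hd, hm]
    · rfl
  · have hdeg := h hm
    rw [Finset.sum_eq_single (⇑m)]
    · simp
    · intro d _ hd
      rw [if_neg]
      rintro rfl
      exact hd (by simp)
    · intro hn
      exfalso; apply hn
      rw [Finset.Nat.mem_antidiagonalTuple]
      rw [← hdeg, Finsupp.weight_apply, Finsupp.sum_fintype _ _ (by simp)]
      simp

theorem at2 : Finset.Nat.antidiagonalTuple 3 2 = {![0,0,2],![0,1,1],![0,2,0],![1,0,1],![1,1,0],![2,0,0]} := by decide
theorem at3 : Finset.Nat.antidiagonalTuple 3 3 = {![0,0,3],![0,1,2],![0,2,1],![0,3,0],![1,0,2],![1,1,1],![1,2,0],![2,0,1],![2,1,0],![3,0,0]} := by decide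

theorem quad (F : MvPolynomial (Fin 3) (ZMod 19)) (h : F.IsHomogeneous 2) :
    ∃ a b c d e f : ZMod 19, F = C a * X 2 ^ 2 + C b * (X 1 * X 2) + C c * X 1 ^ 2
      + C d * (X 0 * X 2) + C e * (X 0 * X 1) + C f * X 0 ^ 2 := by
  obtain ⟨a, ha⟩ := homog_sum 2 F h
  rw [at2] at ha
  refine ⟨a ![0,0,2], a ![0,1,1], a ![0,2,0], a ![1,0,1], a ![1,1,0], a ![2,0,0], ?_⟩
  rw [ha]
  repeat rw [Finset.sum_insert (by decide)]
  simp [add_assoc]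

theorem cub (F : MvPolynomial (Fin 3) (ZMod 19)) (h : F.IsHomogeneous 3) :
    ∃ a b c d e f g h i j : ZMod 19, F = C a * X 2 ^ 3 + C b * (X 1 * X 2 ^ 2)
      + C c * (X 1 ^ 2 * X 2) + C d * X 1 ^ 3 + C e * (X 0 * X 2 ^ 2) + C f * (X 0 * X 1 * X 2)
      + C g * (X 0 * X 1 ^ 2) + C h * (X 0 ^ 2 * X 2) + C i * (X 0 ^ 2 * X 1) + C j * X 0 ^ 3 := by
  obtain ⟨a, ha⟩ := homog_sum 3 F h
  rw [at3] at ha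
  refine ⟨a ![0,0,3], a ![0,1,2], a ![0,2,1], a ![0,3,0], a ![1,0,2], a ![1,1,1], a ![1,2,0],
    a ![2,0,1], a ![2,1,0], a ![3,0,0], ?_⟩
  rw [ha]
  repeat rw [Finset.sum_insert (by decide)]
  simp [add_assoc]

theorem evq (a b c d e f : ZMod 19) (i : Fin 8) : eval (Pv i) (C a * X 2 ^ 2 + C b * (X 1 * X 2) + C c * X 1 ^ 2
      + C d * (X 0 * X 2) + C e * (X 0 * X 1) + C f * X 0 ^ 2) = a * Pv i 2 ^ 2 + b * (Pv i 1 * Pv i 2) + c * Pv i 1 ^ 2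
      + d * (Pv i 0 * Pv i 2) + e * (Pv i 0 * Pv i 1) + f * Pv i 0 ^ 2 := by simp

def Qv (K : Type) [Field K] : Fin 8 → Fin 3 → K :=
  ![![0, 1, 1], ![0, 1, 2], ![1, 0, 1], ![1, 0, 4],
    ![1, 1, 1], ![1, 1, 16], ![7, 1, 18], ![7, 1, 16]]

set_option maxHeartbeats 8000000 in
theorem lin2 {K : Type} [Field K] [CharP K 19] (a b c d e f : K) (p q : Fin 8) (hpq : p < q)
    (hv : ∀ i, i ≠ p → i ≠ q → a * Qv K i 2 ^ 2 + b * (Qv K i 1 * Qv K i 2) + c * Qv K i 1 ^ 2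
      + d * (Qv K i 0 * Qv K i 2) + e * (Qv K i 0 * Qv K i 1) + f * Qv K i 0 ^ 2 = 0) :
    a = 0 ∧ b = 0 ∧ c = 0 ∧ d = 0 ∧ e = 0 ∧ f = 0 := by
  have h0 := hv 0
  have h1 := hv 1
  have h2 := hv 2
  have h3 := hv 3
  have h4 := hv 4
  have h5 := hv 5
  have h6 := hv 6
  have h7 := hv 7
  clear hv
  simp only [Qv] at h0 h1 h2 h3 h4 h5 h6 h7
  fin_cases p <;> fin_cases q <;> first | (exfalso; revert hpq; decide) | skip
  all_goals
    simp at h0 h1 h2 h3 h4 h5 h6 h7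
    clear hpq
    grind

set_option maxHeartbeats 8000000 in
theorem lin3 {K : Type} [Field K] [CharP K 19] (a b c d e f g h i j : K) (p : Fin 8)
    (hv : ∀ n, a * Qv K n 2 ^ 3 + b * Qv K n 1 * Qv K n 2 ^ 2 + c * Qv K n 1 ^ 2 * Qv K n 2 + d * Qv K n 1 ^ 3 + e * Qv K n 0 * Qv K n 2 ^ 2 + f * Qv K n 0 * Qv K n 1 * Qv K n 2 + g * Qv K n 0 * Qv K n 1 ^ 2 + h * Qv K n 0 ^ 2 * Qv K n 2 + i * Qv K n 0 ^ 2 * Qv K n 1 + j * Qv K n 0 ^ 3 = 0)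
    (s0 : e * Qv K p 2 ^ 2 + f * Qv K p 1 * Qv K p 2 + g * Qv K p 1 ^ 2 + 2 * h * Qv K p 0 * Qv K p 2 + 2 * i * Qv K p 0 * Qv K p 1 + 3 * j * Qv K p 0 ^ 2 = 0)
    (s1 : b * Qv K p 2 ^ 2 + 2 * c * Qv K p 1 * Qv K p 2 + 3 * d * Qv K p 1 ^ 2 + f * Qv K p 0 * Qv K p 2 + 2 * g * Qv K p 0 * Qv K p 1 + i * Qv K p 0 ^ 2 = 0)
    (s2 : 3 * a * Qv K p 2 ^ 2 + 2 * b * Qv K p 1 * Qv K p 2 + c * Qv K p 1 ^ 2 + 2 * e * Qv K p 0 * Qv K p 2 + f * Qv K p 0 * Qv K p 1 + h * Qv K p 0 ^ 2 = 0) :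
    a = 0 ∧ b = 0 ∧ c = 0 ∧ d = 0 ∧ e = 0 ∧ f = 0 ∧ g = 0 ∧ h = 0 ∧ i = 0 ∧ j = 0 := by
  have h0 := hv 0
  have h1 := hv 1
  have h2 := hv 2
  have h3 := hv 3
  have h4 := hv 4
  have h5 := hv 5
  have h6 := hv 6
  have h7 := hv 7
  simp [Qv] at h0 h1 h2 h3 h4 h5 h6 h7
  fin_cases p
  all_goals
    simp [Qv] at s0 s1 s2
    grind

set_option maxHeartbeats 8000000 in
theorem part3 : (¬ ∃ F : MvPolynomial (Fin 3) (ZMod 19), F.IsHomogeneous 2 ∧ F ≠ 0 ∧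
      ∃ T : Finset (Fin 8), T.card = 6 ∧ ∀ i ∈ T, eval (Pv i) F = 0) := by
  rintro ⟨F, hF, h0, T, hT, hv⟩
  obtain ⟨a, b, c, d, e, f, rfl⟩ := quad F hF
  apply h0
  simp only [evq] at hv
  suffices a = 0 ∧ b = 0 ∧ c = 0 ∧ d = 0 ∧ e = 0 ∧ f = 0 by
    obtain ⟨rfl, rfl, rfl, rfl, rfl, rfl⟩ := this
    simp
  clear h0 hF
  have hT' : T ∈ (Finset.univ : Finset (Fin 8)).powersetCard 6 := by simp [Finset.mem_powersetCard, hT]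
  have hex : ∃ p q : Fin 8, p < q ∧ ∀ i, i ≠ p → i ≠ q → i ∈ T := by
    clear hv hT; revert T; decide +kernel
  obtain ⟨p, q, hpq, hi⟩ := hex
  replace hv : ∀ i, i ≠ p → i ≠ q → _ := fun i h1 h2 => hv i (hi i h1 h2)
  clear hi hT hT' T
  have : Fact (Nat.Prime 19) := ⟨by norm_num⟩
  exact lin2 a b c d e f p q hpq hv

set_option maxHeartbeats 8000000 in
theorem part4 : (¬ ∃ F : MvPolynomial (Fin 3) (ZMod 19), F.IsHomogeneous 3 ∧ F ≠ 0 ∧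
      (∀ i : Fin 8, eval (Pv i) F = 0) ∧
      ∃ i : Fin 8, ∀ t : Fin 3, eval (Pv i) (pderiv t F) = 0) := by
  rintro ⟨F, hF, h0, hv, p, hs⟩
  obtain ⟨a, b, c, d, e, f, g, h, i, j, rfl⟩ := cub F hF
  apply h0
  suffices a = 0 ∧ b = 0 ∧ c = 0 ∧ d = 0 ∧ e = 0 ∧ f = 0 ∧ g = 0 ∧ h = 0 ∧ i = 0 ∧ j = 0 by
    obtain ⟨rfl, rfl, rfl, rfl, rfl, rfl, rfl, rfl, rfl, rfl⟩ := this
    simp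
  clear h0 hF
  have s0 := hs 0
  have s1 := hs 1
  have s2 := hs 2
  simp [pderiv_X] at s0 s1 s2
  have : Fact (Nat.Prime 19) := ⟨by norm_num⟩
  have hq : Qv (ZMod 19) = Pv := rfl
  refine lin3 a b c d e f g h i j p ?_ ?_ ?_ ?_ <;> rw [hq]
  · intro n
    have := hv n
    simp at this
    linear_combination this
  · linear_combination s0
  · linear_combination s1
  · linear_combination s2

theorem part1 : (∀ i j : Fin 8, i ≠ j → ∀ c : ZMod 19, Pv j ≠ c • Pv i) := by decide +kernel

def det3 (u v w : Fin 3 → ZMod 19) : ZMod 19 :=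
  u 0 * (v 1 * w 2 - v 2 * w 1) - u 1 * (v 0 * w 2 - v 2 * w 0) + u 2 * (v 0 * w 1 - v 1 * w 0)

theorem part2 : (∀ i j k : Fin 8, i ≠ j → i ≠ k → j ≠ k →
      ∀ a b c : ZMod 19, a • Pv i + b • Pv j + c • Pv k = 0 → a = 0 ∧ b = 0 ∧ c = 0) := by
  intro i j k hij hik hjk a b c h
  have hd : det3 (Pv i) (Pv j) (Pv k) ≠ 0 := by
    clear h; revert i j k; decide +kernel
  have e0 := congrFun h 0
  have e1 := congrFun h 1
  have e2 := congrFun h 2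
  simp only [Pi.add_apply, Pi.smul_apply, smul_eq_mul, Pi.zero_apply] at e0 e1 e2
  generalize Pv i = u at *
  generalize Pv j = v at *
  generalize Pv k = w at *
  have : Fact (Nat.Prime 19) := ⟨by norm_num⟩
  refine ⟨?_, ?_, ?_⟩ <;> refine (mul_eq_zero.1 ?_).resolve_right hd <;> unfold det3
  · linear_combination (v 1 * w 2 - v 2 * w 1) * e0 - (v 0 * w 2 - v 2 * w 0) * e1 + (v 0 * w 1 - v 1 * w 0) * e2
  · linear_combination -(u 1 * w 2 - u 2 * w 1) * e0 + (u 0 * w 2 - u 2 * w 0) * e1 - (u 0 * w 1 - u 1 * w 0) * e2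
  · linear_combination (u 1 * v 2 - u 2 * v 1) * e0 - (u 0 * v 2 - u 2 * v 0) * e1 + (u 0 * v 1 - u 1 * v 0) * e2

/-- The eight points `P₁, …, P₈` over `𝔽₁₉` are in general position: pairwise
non-proportional, no three linearly dependent, no nonzero conic through six of them, and no
nonzero cubic through all eight of them singular at one of them. -/
theorem stmt17 :
    (∀ i j : Fin 8, i ≠ j → ∀ c : ZMod 19, Pv j ≠ c • Pv i) ∧
    (∀ i j k : Fin 8, i ≠ j → i ≠ k → j ≠ k →
      ∀ a b c : ZMod 19, a • Pv i + b • Pv j + c • Pv k = 0 → a = 0 ∧ b = 0 ∧ c = 0) ∧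
    (¬ ∃ F : MvPolynomial (Fin 3) (ZMod 19), F.IsHomogeneous 2 ∧ F ≠ 0 ∧
      ∃ T : Finset (Fin 8), T.card = 6 ∧ ∀ i ∈ T, eval (Pv i) F = 0) ∧
    (¬ ∃ F : MvPolynomial (Fin 3) (ZMod 19), F.IsHomogeneous 3 ∧ F ≠ 0 ∧
      (∀ i : Fin 8, eval (Pv i) F = 0) ∧
      ∃ i : Fin 8, ∀ t : Fin 3, eval (Pv i) (pderiv t F) = 0) := by
  exact ⟨part1, part2, part3, part4⟩
end

section
/- Let P_1 = (0,1,1), P_2 = (0,1,2), P_3 = (1,0,1), P_4 = (1,0,4), P_5 = (1,1,1), P_6 = (1,1,16), P_7 = (7,1,18), P_8 = (7,1,16) and P = (0,0,1) be points of the projective plane over F_19 (represented by vectors in F_19^3). Then: (a) for each pair {1,2}, {3,4}, {5,6}, {7,8}, there is a nonzero linear form over F_19 vanishing at the two corresponding points and at P (the line through the pair passes through P); and (b) for each triple (i,j,k) in {(1,3,5), (2,3,8), (2,4,6), (1,4,7), (2,5,7), (1,6,8)}, there exists a nonzero homogeneous polynomial F of degree 4 over F_19 in three variables vanishing at all eight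 points P_1, ..., P_8, with all three partial derivatives of F vanishing at each of P_i, P_j, P_k (so F is singular at these three points), and with F vanishing at P. -/
open MvPolynomial

/-- The point `P = (0 : 0 : 1)`. -/
def Pt : Fin 3 → ZMod 19 := ![0, 0, 1]

/-- There is a nonzero linear form vanishing at `P_i`, `P_j`, and `P` (the line through
`P_i` and `P_j` passes through `P`). -/
def LineThruP (i j : Fin 8) : Prop :=
  ∃ L : MvPolynomial (Fin 3) (ZMod 19), L.IsHomogeneous 1 ∧ L ≠ 0 ∧
    eval (Pv i) L = 0 ∧ eval (Pv j) L = 0 ∧ eval Pt L = 0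

/-- There is a nonzero quartic vanishing at all eight points, singular at `P_i`, `P_j`, `P_k`,
and vanishing at `P`. -/
def QuarticThruP (i j k : Fin 8) : Prop :=
  ∃ F : MvPolynomial (Fin 3) (ZMod 19), F.IsHomogeneous 4 ∧ F ≠ 0 ∧
    (∀ m : Fin 8, eval (Pv m) F = 0) ∧
    (∀ t : Fin 3, eval (Pv i) (pderiv t F) = 0) ∧
    (∀ t : Fin 3, eval (Pv j) (pderiv t F) = 0) ∧
    (∀ t : Fin 3, eval (Pv k) (pderiv t F) = 0) ∧
    eval Pt F = 0

/-- General ternary quartic with coefficient vector `c`. -/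
noncomputable def quartic (c : Fin 15 → ZMod 19) : MvPolynomial (Fin 3) (ZMod 19) :=
    C (c 0) * (X 0 ^ 0 * X 1 ^ 0 * X 2 ^ 4)
    + C (c 1) * (X 0 ^ 0 * X 1 ^ 1 * X 2 ^ 3)
    + C (c 2) * (X 0 ^ 0 * X 1 ^ 2 * X 2 ^ 2)
    + C (c 3) * (X 0 ^ 0 * X 1 ^ 3 * X 2 ^ 1)
    + C (c 4) * (X 0 ^ 0 * X 1 ^ 4 * X 2 ^ 0)
    + C (c 5) * (X 0 ^ 1 * X 1 ^ 0 * X 2 ^ 3)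
    + C (c 6) * (X 0 ^ 1 * X 1 ^ 1 * X 2 ^ 2)
    + C (c 7) * (X 0 ^ 1 * X 1 ^ 2 * X 2 ^ 1)
    + C (c 8) * (X 0 ^ 1 * X 1 ^ 3 * X 2 ^ 0)
    + C (c 9) * (X 0 ^ 2 * X 1 ^ 0 * X 2 ^ 2)
    + C (c 10) * (X 0 ^ 2 * X 1 ^ 1 * X 2 ^ 1)
    + C (c 11) * (X 0 ^ 2 * X 1 ^ 2 * X 2 ^ 0)
    + C (c 12) * (X 0 ^ 3 * X 1 ^ 0 * X 2 ^ 1)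
    + C (c 13) * (X 0 ^ 3 * X 1 ^ 1 * X 2 ^ 0)
    + C (c 14) * (X 0 ^ 4 * X 1 ^ 0 * X 2 ^ 0)

def quarticVal (c : Fin 15 → ZMod 19) (v : Fin 3 → ZMod 19) : ZMod 19 :=
    c 0 * (v 0 ^ 0 * v 1 ^ 0 * v 2 ^ 4)
    + c 1 * (v 0 ^ 0 * v 1 ^ 1 * v 2 ^ 3)
    + c 2 * (v 0 ^ 0 * v 1 ^ 2 * v 2 ^ 2)
    + c 3 * (v 0 ^ 0 * v 1 ^ 3 * v 2 ^ 1)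
    + c 4 * (v 0 ^ 0 * v 1 ^ 4 * v 2 ^ 0)
    + c 5 * (v 0 ^ 1 * v 1 ^ 0 * v 2 ^ 3)
    + c 6 * (v 0 ^ 1 * v 1 ^ 1 * v 2 ^ 2)
    + c 7 * (v 0 ^ 1 * v 1 ^ 2 * v 2 ^ 1)
    + c 8 * (v 0 ^ 1 * v 1 ^ 3 * v 2 ^ 0)
    + c 9 * (v 0 ^ 2 * v 1 ^ 0 * v 2 ^ 2)
    + c 10 * (v 0 ^ 2 * v 1 ^ 1 * v 2 ^ 1)
    + c 11 * (v 0 ^ 2 * v 1 ^ 2 * v 2 ^ 0)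
    + c 12 * (v 0 ^ 3 * v 1 ^ 0 * v 2 ^ 1)
    + c 13 * (v 0 ^ 3 * v 1 ^ 1 * v 2 ^ 0)
    + c 14 * (v 0 ^ 4 * v 1 ^ 0 * v 2 ^ 0)

def quarticD0 (c : Fin 15 → ZMod 19) (v : Fin 3 → ZMod 19) : ZMod 19 :=
    c 5 * (1 * (v 0 ^ 0 * v 1 ^ 0 * v 2 ^ 3))
    + c 6 * (1 * (v 0 ^ 0 * v 1 ^ 1 * v 2 ^ 2))
    + c 7 * (1 * (v 0 ^ 0 * v 1 ^ 2 * v 2 ^ 1))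
    + c 8 * (1 * (v 0 ^ 0 * v 1 ^ 3 * v 2 ^ 0))
    + c 9 * (2 * (v 0 ^ 1 * v 1 ^ 0 * v 2 ^ 2))
    + c 10 * (2 * (v 0 ^ 1 * v 1 ^ 1 * v 2 ^ 1))
    + c 11 * (2 * (v 0 ^ 1 * v 1 ^ 2 * v 2 ^ 0))
    + c 12 * (3 * (v 0 ^ 2 * v 1 ^ 0 * v 2 ^ 1))
    + c 13 * (3 * (v 0 ^ 2 * v 1 ^ 1 * v 2 ^ 0))
    + c 14 * (4 * (v 0 ^ 3 * v 1 ^ 0 * v 2 ^ 0))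

def quarticD1 (c : Fin 15 → ZMod 19) (v : Fin 3 → ZMod 19) : ZMod 19 :=
    c 1 * (1 * (v 0 ^ 0 * v 1 ^ 0 * v 2 ^ 3))
    + c 2 * (2 * (v 0 ^ 0 * v 1 ^ 1 * v 2 ^ 2))
    + c 3 * (3 * (v 0 ^ 0 * v 1 ^ 2 * v 2 ^ 1))
    + c 4 * (4 * (v 0 ^ 0 * v 1 ^ 3 * v 2 ^ 0))
    + c 6 * (1 * (v 0 ^ 1 * v 1 ^ 0 * v 2 ^ 2))
    + c 7 * (2 * (v 0 ^ 1 * v 1 ^ 1 * v 2 ^ 1))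
    + c 8 * (3 * (v 0 ^ 1 * v 1 ^ 2 * v 2 ^ 0))
    + c 10 * (1 * (v 0 ^ 2 * v 1 ^ 0 * v 2 ^ 1))
    + c 11 * (2 * (v 0 ^ 2 * v 1 ^ 1 * v 2 ^ 0))
    + c 13 * (1 * (v 0 ^ 3 * v 1 ^ 0 * v 2 ^ 0))

def quarticD2 (c : Fin 15 → ZMod 19) (v : Fin 3 → ZMod 19) : ZMod 19 :=
    c 0 * (4 * (v 0 ^ 0 * v 1 ^ 0 * v 2 ^ 3))
    + c 1 * (3 * (v 0 ^ 0 * v 1 ^ 1 * v 2 ^ 2))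
    + c 2 * (2 * (v 0 ^ 0 * v 1 ^ 2 * v 2 ^ 1))
    + c 3 * (1 * (v 0 ^ 0 * v 1 ^ 3 * v 2 ^ 0))
    + c 5 * (3 * (v 0 ^ 1 * v 1 ^ 0 * v 2 ^ 2))
    + c 6 * (2 * (v 0 ^ 1 * v 1 ^ 1 * v 2 ^ 1))
    + c 7 * (1 * (v 0 ^ 1 * v 1 ^ 2 * v 2 ^ 0))
    + c 9 * (2 * (v 0 ^ 2 * v 1 ^ 0 * v 2 ^ 1))
    + c 10 * (1 * (v 0 ^ 2 * v 1 ^ 1 * v 2 ^ 0))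
    + c 12 * (1 * (v 0 ^ 3 * v 1 ^ 0 * v 2 ^ 0))

lemma quartic_eval (c v) : eval v (quartic c) = quarticVal c v := by
  simp [quartic, quarticVal]

lemma quartic_d0 (c v) : eval v (pderiv 0 (quartic c)) = quarticD0 c v := by
  simp [quartic, quarticD0, pderiv_X, Derivation.leibniz, Derivation.leibniz_pow]
  try ring

lemma quartic_d1 (c v) : eval v (pderiv 1 (quartic c)) = quarticD1 c v := by
  simp [quartic, quarticD1, pderiv_X, Derivation.leibniz, Derivation.leibniz_pow]
  try ring

lemma quartic_d2 (c v) : eval v (pderiv 2 (quartic c)) = quarticD2 c v := by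
  simp [quartic, quarticD2, pderiv_X, Derivation.leibniz, Derivation.leibniz_pow]
  try ring

lemma mon_hom (a : ZMod 19) (i j k : ℕ) (h : i + j + k = 4) :
    (C a * (X 0 ^ i * X 1 ^ j * X 2 ^ k) : MvPolynomial (Fin 3) (ZMod 19)).IsHomogeneous 4 := by
  have h1 := (((isHomogeneous_X_pow (R := ZMod 19) (0 : Fin 3) i).mul
    (isHomogeneous_X_pow (R := ZMod 19) (1 : Fin 3) j)).mul
    (isHomogeneous_X_pow (R := ZMod 19) (2 : Fin 3) k)).C_mul a
  rwa [h] at h1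

lemma quartic_hom (c) : (quartic c).IsHomogeneous 4 := by
  unfold quartic
  repeat' apply IsHomogeneous.add
  all_goals exact mon_hom _ _ _ _ rfl

lemma quartic_main (i j k : Fin 8) (c : Fin 15 → ZMod 19) (w : Fin 3 → ZMod 19)
    (hw : quarticVal c w ≠ 0) (hv : ∀ m, quarticVal c (Pv m) = 0)
    (hs : ∀ m, m = i ∨ m = j ∨ m = k →
      quarticD0 c (Pv m) = 0 ∧ quarticD1 c (Pv m) = 0 ∧ quarticD2 c (Pv m) = 0)
    (hP : quarticVal c Pt = 0) : QuarticThruP i j k := by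
  have key : ∀ m, m = i ∨ m = j ∨ m = k →
      ∀ t : Fin 3, eval (Pv m) (pderiv t (quartic c)) = 0 := by
    intro m hm t
    obtain ⟨h0, h1, h2⟩ := hs m hm
    fin_cases t
    · exact (quartic_d0 c _).trans h0
    · exact (quartic_d1 c _).trans h1
    · exact (quartic_d2 c _).trans h2
  refine ⟨quartic c, quartic_hom c, ?_, fun m => (quartic_eval c _).trans (hv m),
    key i (by simp), key j (by simp), key k (by simp), (quartic_eval c _).trans hP⟩
  intro h
  apply hw
  rw [← quartic_eval, h, map_zero]

lemma line_main (i j : Fin 8) (a b : ZMod 19) (w : Fin 3 → ZMod 19)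
    (hw : a * w 0 + b * w 1 ≠ 0) (hi : a * Pv i 0 + b * Pv i 1 = 0)
    (hj : a * Pv j 0 + b * Pv j 1 = 0) : LineThruP i j := by
  have ev : ∀ v : Fin 3 → ZMod 19,
      eval v (C a * X 0 + C b * X 1 : MvPolynomial (Fin 3) (ZMod 19)) = a * v 0 + b * v 1 := by
    intro v; simp
  refine ⟨C a * X 0 + C b * X 1, ?_, ?_, (ev _).trans hi, (ev _).trans hj, ?_⟩
  · exact ((isHomogeneous_X _ _).C_mul a).add ((isHomogeneous_X _ _).C_mul b)
  · intro h
    apply hw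
    rw [← ev, h, map_zero]
  · rw [ev]; simp [Pt]

/-- The four lines `ℓ_{1,2}, ℓ_{3,4}, ℓ_{5,6}, ℓ_{7,8}` pass through `P`, and for each triple
`(i,j,k) ∈ {(1,3,5), (2,3,8), (2,4,6), (1,4,7), (2,5,7), (1,6,8)}` there is a nonzero quartic
through the eight points, singular at `P_i, P_j, P_k`, passing through `P`. -/
theorem stmt18 :
    LineThruP 0 1 ∧ LineThruP 2 3 ∧ LineThruP 4 5 ∧ LineThruP 6 7 ∧
    QuarticThruP 0 2 4 ∧ QuarticThruP 1 2 7 ∧ QuarticThruP 1 3 5 ∧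
    QuarticThruP 0 3 6 ∧ QuarticThruP 1 4 6 ∧ QuarticThruP 0 5 7 := by
  refine ⟨?_, ?_, ?_, ?_, ?_, ?_, ?_, ?_, ?_, ?_⟩
  · exact line_main _ _ 1 0 ![1, 0, 0] (by decide) (by decide) (by decide)
  · exact line_main _ _ 0 1 ![0, 1, 0] (by decide) (by decide) (by decide)
  · exact line_main _ _ 1 (-1) ![1, 0, 0] (by decide) (by decide) (by decide)
  · exact line_main _ _ 1 (-7) ![1, 0, 0] (by decide) (by decide) (by decide)
  · exact quartic_main _ _ _ ![0, 15, 16, 18, 8, 14, 2, 18, 4, 11, 16, 12, 12, 5, 1] ![0, 1, 0]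
      (by decide +kernel) (by decide +kernel) (by decide +kernel) (by decide +kernel)
  · exact quartic_main _ _ _ ![0, 8, 17, 7, 6, 14, 13, 3, 1, 11, 1, 4, 12, 16, 1] ![0, 1, 0]
      (by decide +kernel) (by decide +kernel) (by decide +kernel) (by decide +kernel)
  · exact quartic_main _ _ _ ![0, 17, 10, 3, 8, 13, 10, 11, 5, 16, 11, 1, 8, 0, 1] ![0, 1, 0]
      (by decide +kernel) (by decide +kernel) (by decide +kernel) (by decide +kernel)
  · exact quartic_main _ _ _ ![0, 16, 12, 4, 6, 13, 17, 4, 4, 16, 4, 10, 8, 18, 1] ![0, 1, 0]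
      (by decide +kernel) (by decide +kernel) (by decide +kernel) (by decide +kernel)
  · exact quartic_main _ _ _ ![0, 12, 16, 1, 9, 10, 13, 8, 4, 12, 18, 15, 15, 18, 1] ![0, 1, 0]
      (by decide +kernel) (by decide +kernel) (by decide +kernel) (by decide +kernel)
  · exact quartic_main _ _ _ ![0, 2, 11, 10, 15, 7, 7, 12, 12, 8, 2, 12, 3, 12, 1] ![0, 1, 0]
      (by decide +kernel) (by decide +kernel) (by decide +kernel) (by decide +kernel)
end
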